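/- Let n ≥ 1 and let V : ℝ → M_n(ℂ) be a continuous Hermitian-matrix-valued function (not necessarily sign definite) such that x ↦ tr(V_+(x)) and x ↦ tr(V_-(x)) are Lebesgue integrable on ℝ. Then for every δ > 0 there exist an integer N ≥ 0, twice continuously differentiable square-integrable functions ψ_1, …, ψ_N : ℝ → ℂ^n forming an orthonormal family in L²(ℝ, ℂ^n), and numbers E_1, …, E_N > 0 with −ψ_j″ + Vψ_j = −E_j ψ_j on ℝ for each j, such that ∑_{j=1}^N √(E_j) ≥ (1/4) ∫_ℝ (tr V_-(x) − tr V_+(x)) dx − δ. -/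

import Mathlib

open MeasureTheory Matrix
open scoped ComplexOrder

/-- The trace of the positive part `M₊ = (|M| + M)/2` of a Hermitian matrix:
`tr M₊ = ∑ max(λ_i, 0)`. -/
noncomputable def trPos {n : ℕ} (A : Matrix (Fin n) (Fin n) ℂ) (hA : A.IsHermitian) : ℝ :=
  ∑ i, max (hA.eigenvalues i) 0

/-- The trace of the negative part `M₋ = (|M| - M)/2` of a Hermitian matrix:
`tr M₋ = ∑ max(-λ_i, 0)`. -/
noncomputable def trNeg {n : ℕ} (A : Matrix (Fin n) (Fin n) ℂ) (hA : A.IsHermitian) : ℝ :=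
  ∑ i, max (-(hA.eigenvalues i)) 0

section WeakConvergence

open Filter Topology
open scoped InnerProductSpace ComplexConjugate

variable {H : Type*} [NormedAddCommGroup H] [InnerProductSpace ℂ H]

/-- Weak convergence of a sequence in a Hilbert space. -/
def WeakLim (u : ℕ → H) (g : H) : Prop :=
  ∀ h : H, Tendsto (fun k => ⟪h, u k⟫_ℂ) atTop (𝓝 ⟪h, g⟫_ℂ)

/-- Bounded sequences in a separable Hilbert space have weakly convergent subsequences. -/
lemma exists_weakLim_subseq [CompleteSpace H] [TopologicalSpace.SeparableSpace H] (u : ℕ → H)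
    (C : ℝ) (hu : ∀ k, ‖u k‖ ≤ C) : ∃ (g : H) (φ : ℕ → ℕ), StrictMono φ ∧ WeakLim (u ∘ φ) g := by
  have hc := WeakDual.isSeqCompact_closedBall ℂ H (0 : StrongDual ℂ H) C
  obtain ⟨ℓ, -, φ, hφ, hlim⟩ := hc
    (x := fun k => StrongDual.toWeakDual (InnerProductSpace.toDual ℂ H (u k))) (fun k => by
      simpa using hu k)
  refine ⟨(InnerProductSpace.toDual ℂ H).symm (WeakDual.toStrongDual ℓ), φ, hφ, fun h => ?_⟩
  have h1 := (WeakDual.eval_continuous (𝕜 := ℂ) (E := H) h).continuousAt.tendsto.comp hlim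
  have h2 := (Complex.continuous_conj.tendsto _).comp h1
  rw [← inner_conj_symm, InnerProductSpace.toDual_symm_apply]
  refine h2.congr fun k => ?_
  simp only [Function.comp_apply]
  rw [← inner_conj_symm h]
  rfl

lemma WeakLim.clm [CompleteSpace H] {u : ℕ → H} {g : H} (h : WeakLim u g) (A : H →L[ℂ] H) :
    WeakLim (fun k => A (u k)) (A g) := fun x => by
  simpa [ContinuousLinearMap.adjoint_inner_left] using h (ContinuousLinearMap.adjoint A x)

/-- A positive semidefinite Hermitian form that vanishes at `g` has `g` in its kernel. -/
lemma form_eq_zero_of_nonneg (B : H →ₗ⋆[ℂ] H →ₗ[ℂ] ℂ) (S : Submodule ℂ H)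
    (hherm : ∀ g h, conj (B g h) = B h g) (hpos : ∀ g ∈ S, 0 ≤ (B g g).re) {g : H} (hg : g ∈ S)
    (h0 : (B g g).re = 0) {h : H} (hh : h ∈ S) : B h g = 0 := by
  have key : ∀ t : ℝ, 0 ≤ (B h h).re - 2 * t * ‖B h g‖ ^ 2 := by
    intro t
    have h1 := hpos (h - ((t : ℂ) * B g h) • g) (S.sub_mem hh (S.smul_mem _ hg))
    have h2 : B g h = conj (B h g) := (hherm h g).symm
    have h3 : B g g = 0 := by
      have := hherm g g
      rw [Complex.conj_eq_iff_im] at this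
      exact Complex.ext h0 this
    simp only [map_sub, LinearMap.map_smulₛₗ, LinearMap.sub_apply, LinearMap.smul_apply,
      smul_eq_mul, h3, map_mul, RingHom.id_apply, Complex.conj_ofReal, h2, Complex.conj_conj,
      mul_zero, sub_zero] at h1
    have h4 : B h g * conj (B h g) = ((‖B h g‖ ^ 2 : ℝ) : ℂ) := by
      rw [Complex.mul_conj, Complex.normSq_eq_norm_sq]
    have h5 : (B h h - (t : ℂ) * conj (B h g) * B h g - (t : ℂ) * B h g * conj (B h g))
        = B h h - ((2 * t * ‖B h g‖ ^ 2 : ℝ) : ℂ) := by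
      push_cast at h4 ⊢
      linear_combination (-2 * (t : ℂ)) * h4
    have h6 : (B h h - (t : ℂ) * conj (B h g) * B h g - (t : ℂ) * B h g * conj (B h g)).re
        = (B h h).re - 2 * t * ‖B h g‖ ^ 2 := by
      rw [h5, Complex.sub_re, Complex.ofReal_re]
    refine h6 ▸ h1.trans (le_of_eq ?_)
    congr 1
    ring
  by_contra hne
  have hn : 0 < ‖B h g‖ ^ 2 := by positivity
  have := key (((B h h).re + 1) / (2 * ‖B h g‖ ^ 2))
  have e : 2 * (((B h h).re + 1) / (2 * ‖B h g‖ ^ 2)) * ‖B h g‖ ^ 2 = (B h h).re + 1 := by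
    field_simp
  rw [e] at this
  linarith

end WeakConvergence

section NegativeEigenvalues

open Filter Topology
open scoped InnerProductSpace ComplexConjugate

variable {H : Type*} [NormedAddCommGroup H] [InnerProductSpace ℂ H]

/-- The sesquilinear form `(h, g) ↦ ⟪A h, A g⟫`. -/
noncomputable def massForm (A : H →L[ℂ] H) : H →ₗ⋆[ℂ] H →ₗ[ℂ] ℂ :=
  LinearMap.mk₂'ₛₗ (starRingEnd ℂ) (RingHom.id ℂ) (fun h g => ⟪A h, A g⟫_ℂ)
    (by intros; simp) (by intros; simp [mul_comm])
    (by intros; simp) (by intros; simp)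

/-- The sesquilinear form `(h, g) ↦ ⟪h, g⟫ - ⟪A h, A g⟫ + v h g`. If `A` is the inverse of
`d/dx + 1`, then this is the Schrödinger form `∫ ⟪f', k'⟫ + v` evaluated at `f = A h`,
`k = A g`. -/
noncomputable def schrForm (A : H →L[ℂ] H) (v : H →ₗ⋆[ℂ] H →ₗ[ℂ] ℂ) : H →ₗ⋆[ℂ] H →ₗ[ℂ] ℂ :=
  innerₛₗ ℂ - massForm A + v

lemma massForm_apply (A : H →L[ℂ] H) (h g : H) : massForm A h g = ⟪A h, A g⟫_ℂ := rfl

lemma schrForm_apply (A : H →L[ℂ] H) (v : H →ₗ⋆[ℂ] H →ₗ[ℂ] ℂ) (h g : H) :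
    schrForm A v h g = ⟪h, g⟫_ℂ - ⟪A h, A g⟫_ℂ + v h g := rfl

lemma schrForm_conj (A : H →L[ℂ] H) {v : H →ₗ⋆[ℂ] H →ₗ[ℂ] ℂ}
    (hv : ∀ g h, conj (v g h) = v h g) (g h : H) :
    conj (schrForm A v g h) = schrForm A v h g := by
  simp [schrForm_apply, hv]

lemma schrForm_self_re (A : H →L[ℂ] H) (v : H →ₗ⋆[ℂ] H →ₗ[ℂ] ℂ) (g : H) :
    (schrForm A v g g).re = ‖g‖ ^ 2 - ‖A g‖ ^ 2 + (v g g).re := by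
  have h1 : (⟪g, g⟫_ℂ).re = ‖g‖ ^ 2 := inner_self_eq_norm_sq (𝕜 := ℂ) g
  have h2 : (⟪A g, A g⟫_ℂ).re = ‖A g‖ ^ 2 := inner_self_eq_norm_sq (𝕜 := ℂ) (A g)
  simp only [schrForm_apply, Complex.add_re, Complex.sub_re, h1, h2]

/-- The hypotheses on a perturbation `v` of the kinetic form under which negative eigenvalues
are discrete: `v` is Hermitian, bounded and weakly sequentially continuous. -/
structure IsCompactForm (A : H →L[ℂ] H) (v : H →ₗ⋆[ℂ] H →ₗ[ℂ] ℂ) : Prop where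
  conj_apply : ∀ g h, conj (v g h) = v h g
  bounded : ∃ B, ∀ g, |(v g g).re| ≤ B * ‖g‖ ^ 2
  weak : ∀ (u : ℕ → H) (g : H) (C : ℝ), (∀ k, ‖u k‖ ≤ C) → WeakLim u g →
    Tendsto (fun k => (v (u k) (u k)).re) atTop (𝓝 (v g g).re)
  ker : ∀ g, A g = 0 → (v g g).re = 0

variable [CompleteSpace H] [TopologicalSpace.SeparableSpace H]

lemma IsCompactForm.relative_bound {A : H →L[ℂ] H} {v : H →ₗ⋆[ℂ] H →ₗ[ℂ] ℂ}
    (hv : IsCompactForm A v) :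
    ∃ C, 0 ≤ C ∧ ∀ g, |(v g g).re| ≤ 1 / 2 * ‖g‖ ^ 2 + C * ‖A g‖ ^ 2 := by
  by_contra hcon
  push Not at hcon
  choose w hw using fun k : ℕ => hcon k (Nat.cast_nonneg k)
  obtain ⟨B, hB⟩ := hv.bounded
  have hw0 : ∀ k, 0 < ‖w k‖ := by
    intro k
    rw [norm_pos_iff]
    intro h0
    have := hw k
    simp [h0] at this
  set u : ℕ → H := fun k => ((‖w k‖⁻¹ : ℝ) : ℂ) • w k with hu
  have hu1 : ∀ k, ‖u k‖ = 1 := by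
    intro k
    simp only [hu, norm_smul, Complex.norm_real, norm_inv, norm_norm]
    exact inv_mul_cancel₀ (hw0 k).ne'
  have hvu : ∀ k, (v (u k) (u k)).re = ‖w k‖⁻¹ ^ 2 * (v (w k) (w k)).re := by
    intro k
    simp only [hu, LinearMap.map_smulₛₗ, LinearMap.smul_apply, smul_eq_mul, Complex.conj_ofReal,
      RingHom.id_apply, Complex.re_ofReal_mul]
    ring
  have hAu : ∀ k, ‖A (u k)‖ ^ 2 = ‖w k‖⁻¹ ^ 2 * ‖A (w k)‖ ^ 2 := by
    intro k
    simp only [hu, map_smul, norm_smul, Complex.norm_real, norm_inv, norm_norm]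
    ring
  have hkey : ∀ k : ℕ, 1 / 2 + k * ‖A (u k)‖ ^ 2 < |(v (u k) (u k)).re| := by
    intro k
    have hp : 0 < ‖w k‖⁻¹ ^ 2 := by have := hw0 k; positivity
    rw [hvu, hAu, abs_mul, abs_of_pos hp]
    have := mul_lt_mul_of_pos_left (hw k) hp
    have e : ‖w k‖⁻¹ ^ 2 * ‖w k‖ ^ 2 = 1 := by
      rw [← mul_pow, inv_mul_cancel₀ (hw0 k).ne', one_pow]
    nlinarith
  have hA0 : Tendsto (fun k => ‖A (u k)‖ ^ 2) atTop (𝓝 0) := by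
    have hlim : Tendsto (fun k : ℕ => B * (1 / (k : ℝ))) atTop (𝓝 0) := by
      simpa using (tendsto_one_div_atTop_nhds_zero_nat (𝕜 := ℝ)).const_mul B
    refine squeeze_zero' (.of_forall fun k => by positivity) ?_ hlim
    filter_upwards [eventually_gt_atTop 0] with k hk
    have hk' : (0 : ℝ) < k := by exact_mod_cast hk
    have h1 := hkey k
    have h2 := hB (u k)
    rw [hu1] at h2
    rw [mul_one_div, le_div_iff₀ hk']
    linarith
  obtain ⟨g, φ, hφ, hg⟩ := exists_weakLim_subseq u 1 (fun k => (hu1 k).le)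
  have hAg : A g = 0 := by
    have h1 := (hg.clm A) (A g)
    have h2 : Tendsto (fun k => ⟪A g, A ((u ∘ φ) k)⟫_ℂ) atTop (𝓝 0) := by
      have h3 : Tendsto (fun k => ‖A (u (φ k))‖) atTop (𝓝 0) := by
        have := (hA0.comp hφ.tendsto_atTop).sqrt
        simpa [Function.comp_def] using this
      refine squeeze_zero_norm (fun k => norm_inner_le_norm _ _) ?_
      simpa using h3.const_mul ‖A g‖
    exact inner_self_eq_zero.1 (tendsto_nhds_unique h1 h2)
  have h3 := (hv.weak (u ∘ φ) g 1 (fun k => (hu1 _).le) hg).abs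
  rw [hv.ker g hAg, abs_zero] at h3
  have h4 : (1 / 2 : ℝ) ≤ 0 := by
    refine ge_of_tendsto' h3 fun k => ?_
    have := hkey (φ k)
    have h5 : 0 ≤ (φ k : ℝ) * ‖A (u (φ k))‖ ^ 2 := by positivity
    simp only [Function.comp_apply]
    linarith
  norm_num at h4

/-- If the form is negative somewhere on a weakly closed subspace, its minimum relative to the
mass form is attained there, and the minimizer satisfies the Euler–Lagrange equation. -/
lemma IsCompactForm.exists_minimizer {A : H →L[ℂ] H} (hA : ∀ g, ‖A g‖ ≤ ‖g‖)
    {v : H →ₗ⋆[ℂ] H →ₗ[ℂ] ℂ} (hv : IsCompactForm A v) (S : Submodule ℂ H)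
    (hS : ∀ (u : ℕ → H) (g : H), (∀ k, u k ∈ S) → WeakLim u g → g ∈ S)
    {g₀ : H} (hg₀ : g₀ ∈ S) (hAg₀ : A g₀ ≠ 0) {E' : ℝ} (hE' : 0 < E')
    (hq : (schrForm A v g₀ g₀).re ≤ -E' * ‖A g₀‖ ^ 2) :
    ∃ g ∈ S, ‖A g‖ = 1 ∧ ∃ E, E' ≤ E ∧
      ∀ h ∈ S, schrForm A v h g = -(E : ℂ) * ⟪A h, A g⟫_ℂ := by
  obtain ⟨C, hC0, hC⟩ := hv.relative_bound
  set T : Set ℝ := {r | ∃ g ∈ S, ‖A g‖ = 1 ∧ (schrForm A v g g).re = r} with hT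
  have hscale : ∀ g ∈ S, A g ≠ 0 → (schrForm A v g g).re / ‖A g‖ ^ 2 ∈ T := by
    intro g hg hAg
    have hn : ‖A g‖ ≠ 0 := norm_ne_zero_iff.2 hAg
    refine ⟨((‖A g‖⁻¹ : ℝ) : ℂ) • g, S.smul_mem _ hg, ?_, ?_⟩
    · rw [map_smul, norm_smul, Complex.norm_real, norm_inv, norm_norm, inv_mul_cancel₀ hn]
    · simp only [LinearMap.map_smulₛₗ, LinearMap.smul_apply, smul_eq_mul, Complex.conj_ofReal,
        RingHom.id_apply, Complex.re_ofReal_mul]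
      field_simp
  have hlow : ∀ g, 1 / 2 * ‖g‖ ^ 2 - (1 + C) * ‖A g‖ ^ 2 ≤ (schrForm A v g g).re := by
    intro g
    rw [schrForm_self_re]
    have := neg_abs_le (v g g).re
    linarith [hC g]
  have hTb : BddBelow T := by
    refine ⟨-(1 + C), ?_⟩
    rintro r ⟨g, -, hg1, rfl⟩
    have := hlow g
    rw [hg1] at this
    nlinarith [sq_nonneg ‖g‖]
  have hTn : T.Nonempty := ⟨_, hscale g₀ hg₀ hAg₀⟩
  set lam := sInf T with hlam
  have hlamE : lam ≤ -E' := by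
    refine (csInf_le hTb (hscale g₀ hg₀ hAg₀)).trans ?_
    rw [div_le_iff₀ (by have := norm_pos_iff.2 hAg₀; positivity)]
    exact hq
  have hmin : ∀ g ∈ S, lam * ‖A g‖ ^ 2 ≤ (schrForm A v g g).re := by
    intro g hg
    by_cases hAg : A g = 0
    · have := hlow g
      simp only [hAg, norm_zero] at this ⊢
      nlinarith [sq_nonneg ‖g‖]
    · have := csInf_le hTb (hscale g hg hAg)
      rwa [le_div_iff₀ (by have := norm_pos_iff.2 hAg; positivity)] at this
  obtain ⟨s, hsanti, hs, hsT⟩ := exists_seq_tendsto_sInf hTn hTb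
  choose u huS hu1 hus using hsT
  have hsb : ∀ k, s k ≤ s 0 := fun k => hsanti (Nat.zero_le k)
  have hub : ∀ k, ‖u k‖ ≤ Real.sqrt (2 * (s 0 + 1 + C)) := by
    intro k
    apply Real.le_sqrt_of_sq_le
    have := hlow (u k)
    rw [hu1, hus] at this
    linarith [hsb k]
  obtain ⟨g, φ, hφ, hg⟩ := exists_weakLim_subseq u _ hub
  have hgS : g ∈ S := hS _ g (fun k => huS _) hg
  have hvlim := hv.weak (u ∘ φ) g _ (fun k => hub _) hg
  have hkin : ‖g‖ ^ 2 - ‖A g‖ ^ 2 + (v g g).re ≤ lam := by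
    have hp : ∀ k, 2 * ((⟪g, u (φ k)⟫_ℂ).re - (⟪A g, A (u (φ k))⟫_ℂ).re)
        - (‖g‖ ^ 2 - ‖A g‖ ^ 2) + (v (u (φ k)) (u (φ k))).re ≤ s (φ k) := by
      intro k
      have h1 := hA (g - u (φ k))
      have h2 : ‖A (g - u (φ k))‖ ^ 2 ≤ ‖g - u (φ k)‖ ^ 2 := by gcongr
      rw [map_sub, @norm_sub_sq ℂ, @norm_sub_sq ℂ] at h2
      have h3 := schrForm_self_re A v (u (φ k))
      rw [hus] at h3
      simp only [RCLike.re_to_complex] at h2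
      linarith
    have hl1 : Tendsto (fun k => (⟪g, u (φ k)⟫_ℂ).re) atTop (𝓝 (⟪g, g⟫_ℂ).re) :=
      (Complex.continuous_re.tendsto _).comp (hg g)
    have hl2 : Tendsto (fun k => (⟪A g, A (u (φ k))⟫_ℂ).re) atTop (𝓝 (⟪A g, A g⟫_ℂ).re) :=
      (Complex.continuous_re.tendsto _).comp (hg.clm A (A g))
    have h1 : (⟪g, g⟫_ℂ).re = ‖g‖ ^ 2 := inner_self_eq_norm_sq (𝕜 := ℂ) g
    have h2 : (⟪A g, A g⟫_ℂ).re = ‖A g‖ ^ 2 := inner_self_eq_norm_sq (𝕜 := ℂ) (A g)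
    rw [h1] at hl1
    rw [h2] at hl2
    have hl := (((hl1.sub hl2).const_mul 2).sub_const (‖g‖ ^ 2 - ‖A g‖ ^ 2)).add hvlim
    have := le_of_tendsto_of_tendsto' hl (hs.comp hφ.tendsto_atTop) hp
    linarith
  rw [← schrForm_self_re] at hkin
  have hAg : ‖A g‖ = 1 := by
    have hle : ‖A g‖ ^ 2 ≤ 1 := by
      have hl := hg.clm A (A g)
      have h1 : ‖⟪A g, A g⟫_ℂ‖ ≤ ‖A g‖ := by
        refine le_of_tendsto' hl.norm fun k => ?_
        refine (norm_inner_le_norm _ _).trans ?_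
        simp [hu1]
      have h2 : ‖⟪A g, A g⟫_ℂ‖ = ‖A g‖ ^ 2 := by
        rw [inner_self_eq_norm_sq_to_K]
        simp
      rw [h2] at h1
      have : ‖A g‖ ≤ 1 := by
        by_contra hlt
        push Not at hlt
        nlinarith
      exact pow_le_one₀ (norm_nonneg _) this
    have hge : 1 ≤ ‖A g‖ ^ 2 := by
      have := hmin g hgS
      nlinarith
    exact (sq_eq_sq₀ (norm_nonneg _) zero_le_one).1 (by linarith)
  refine ⟨g, hgS, hAg, -lam, by linarith, fun h hh => ?_⟩
  have h0 := form_eq_zero_of_nonneg (schrForm A v - (lam : ℂ) • massForm A) S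
    (fun a b => by
      simp [schrForm_conj A hv.conj_apply, massForm_apply])
    (fun a ha => by
      have h1 := hmin a ha
      have h2 : (⟪A a, A a⟫_ℂ).re = ‖A a‖ ^ 2 := inner_self_eq_norm_sq (𝕜 := ℂ) (A a)
      simp only [LinearMap.sub_apply, LinearMap.smul_apply, massForm_apply, smul_eq_mul,
        Complex.sub_re, Complex.re_ofReal_mul, h2]
      linarith) hgS
    (by
      have h1 := hmin g hgS
      have h2 : (⟪A g, A g⟫_ℂ).re = ‖A g‖ ^ 2 := inner_self_eq_norm_sq (𝕜 := ℂ) (A g)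
      simp only [LinearMap.sub_apply, LinearMap.smul_apply, massForm_apply, smul_eq_mul,
        Complex.sub_re, Complex.re_ofReal_mul, h2]
      rw [hAg] at h1 ⊢
      linarith) hh
  simp only [LinearMap.sub_apply, LinearMap.smul_apply, massForm_apply, smul_eq_mul] at h0
  push_cast
  linear_combination h0

/-- An orthonormal family of eigenvectors of the form with negative eigenvalues `-E j`. -/
structure IsEigenfamily (A : H →L[ℂ] H) (v : H →ₗ⋆[ℂ] H →ₗ[ℂ] ℂ) {N : ℕ} (g : Fin N → H)
    (E : Fin N → ℝ) : Prop where
  pos : ∀ j, 0 < E j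
  orthonormal : Orthonormal ℂ fun j => A (g j)
  eigen : ∀ j h, schrForm A v h (g j) = -(E j : ℂ) * ⟪A h, A (g j)⟫_ℂ

/-- An eigenfamily can be enlarged as long as the form is negative somewhere on its
orthogonal complement. -/
lemma IsEigenfamily.exists_snoc {A : H →L[ℂ] H} (hA : ∀ g, ‖A g‖ ≤ ‖g‖)
    {v : H →ₗ⋆[ℂ] H →ₗ[ℂ] ℂ} (hv : IsCompactForm A v) {N : ℕ} {g : Fin N → H} {E : Fin N → ℝ}
    (hg : IsEigenfamily A v g E) {g₀ : H} (hg₀ : ∀ j, ⟪A (g j), A g₀⟫_ℂ = 0) (hAg₀ : A g₀ ≠ 0)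
    {E' : ℝ} (hE' : 0 < E') (hq : (schrForm A v g₀ g₀).re ≤ -E' * ‖A g₀‖ ^ 2) :
    ∃ g' E₁, E' ≤ E₁ ∧
      IsEigenfamily A v (Fin.snoc g g' : Fin (N + 1) → H) (Fin.snoc E E₁ : Fin (N + 1) → ℝ) := by
  set S : Submodule ℂ H := ⨅ j, LinearMap.ker ((innerSL ℂ (A (g j))).comp A).toLinearMap with hSdef
  have hS : ∀ h, h ∈ S ↔ ∀ j, ⟪A (g j), A h⟫_ℂ = 0 := by
    intro h
    simp [hSdef, Submodule.mem_iInf]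
  obtain ⟨g', hg'S, hg'1, E₁, hE₁, heq⟩ := hv.exists_minimizer hA S (fun u h hu hlim => by
    rw [hS]
    intro j
    have h1 := hlim.clm A (A (g j))
    have h2 : ∀ k, ⟪A (g j), A (u k)⟫_ℂ = 0 := fun k => (hS _).1 (hu k) j
    simp only [h2] at h1
    exact tendsto_nhds_unique h1 tendsto_const_nhds) ((hS _).2 hg₀) hAg₀ hE' hq
  have hort := (hS _).1 hg'S
  refine ⟨g', E₁, hE₁, ⟨?_, ?_, ?_⟩⟩
  · intro j
    refine Fin.lastCases ?_ (fun i => ?_) j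
    · simpa using hE'.trans_le hE₁
    · simpa using hg.pos i
  · rw [orthonormal_iff_ite]
    have h1 := orthonormal_iff_ite.1 hg.orthonormal
    intro i j
    refine Fin.lastCases ?_ (fun i => ?_) i <;> refine Fin.lastCases ?_ (fun j => ?_) j
    · simp [hg'1, inner_self_eq_norm_sq_to_K]
    · have : ⟪A g', A (g j)⟫_ℂ = 0 := by rw [← inner_conj_symm, hort, map_zero]
      simp [this, (Fin.castSucc_lt_last j).ne']
    · simp [hort, (Fin.castSucc_lt_last i).ne]
    · simp only [Fin.snoc_castSucc, h1, Fin.castSucc_inj]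
  · intro j h
    refine Fin.lastCases ?_ (fun i => ?_) j
    · simp only [Fin.snoc_last]
      have hz : ∀ i, schrForm A v (g i) g' = 0 := by
        intro i
        rw [← schrForm_conj A hv.conj_apply, hg.eigen, ← inner_conj_symm, hort]
        simp
      set h' := h - ∑ i, ⟪A (g i), A h⟫_ℂ • g i with hh'
      have hh'S : h' ∈ S := by
        rw [hS]
        intro j
        have h1 := orthonormal_iff_ite.1 hg.orthonormal
        simp [hh', h1]
      have h2 := heq h' hh'S
      simpa [hh', hz, inner_sub_left, sum_inner, inner_smul_left, hort] using h2
    · simpa using hg.eigen i h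

end NegativeEigenvalues

section Prim

open Filter Topology Set
open scoped InnerProductSpace ComplexConjugate ENNReal

variable {E : Type*} [NormedAddCommGroup E] [InnerProductSpace ℂ E]

/-- The solution of `f' + f = g` vanishing at `-∞`. -/
noncomputable def prim (g : ℝ → E) (x : ℝ) : E := ∫ y in Iic x, Real.exp (y - x) • g y

lemma integrableOn_exp_sub_Iic (x : ℝ) : IntegrableOn (fun y => Real.exp (y - x)) (Iic x) := by
  simp_rw [Real.exp_sub]
  exact (integrableOn_exp_Iic x).div_const _

lemma integral_exp_sub_Iic (x : ℝ) : ∫ y in Iic x, Real.exp (y - x) = 1 := by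
  simp_rw [Real.exp_sub]
  rw [integral_div, integral_exp_Iic, div_self (Real.exp_pos _).ne']

lemma prim_congr {g h : ℝ → E} (hgh : g =ᵐ[volume] h) : prim g = prim h := by
  funext x
  refine integral_congr_ae ?_
  filter_upwards [ae_restrict_of_ae hgh] with y hy
  rw [hy]

lemma MeasureTheory.MemLp.integrable_norm_sq {F : Type*} [NormedAddCommGroup F] {g : ℝ → F}
    (hg : MemLp g 2) :
    Integrable (fun y => ‖g y‖ ^ 2) := (memLp_two_iff_integrable_sq_norm hg.1).1 hg

lemma integrableOn_exp_mul_norm_sq {F : Type*} [NormedAddCommGroup F] {g : ℝ → F}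
    (hg : MemLp g 2) (x : ℝ) :
    IntegrableOn (fun y => Real.exp (y - x) * ‖g y‖ ^ 2) (Iic x) := by
  refine Integrable.mono' hg.integrable_norm_sq.integrableOn
    ((Continuous.aestronglyMeasurable (by fun_prop)).mul (hg.1.norm.pow 2).restrict) ?_
  filter_upwards [ae_restrict_mem measurableSet_Iic] with y hy
  rw [Real.norm_of_nonneg (by positivity)]
  exact mul_le_of_le_one_left (by positivity) (Real.exp_le_one_iff.2 (by simpa using hy))

lemma integrableOn_exp_smul {g : ℝ → E} (hg : MemLp g 2) (x : ℝ) :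
    IntegrableOn (fun y => Real.exp (y - x) • g y) (Iic x) := by
  refine Integrable.mono' ((integrableOn_exp_sub_Iic x).add (integrableOn_exp_mul_norm_sq hg x))
    (AEStronglyMeasurable.smul (𝕜 := ℝ) (Continuous.aestronglyMeasurable (by fun_prop))
      hg.1.restrict) ?_
  filter_upwards with y
  rw [norm_smul, Real.norm_of_nonneg (Real.exp_pos _).le]
  simp only [Pi.add_apply]
  have := (Real.exp_pos (y - x)).le
  nlinarith [mul_nonneg this (sq_nonneg (‖g y‖ - 1 / 2))]

lemma norm_prim_sq_le {g : ℝ → E} (hg : MemLp g 2) (x : ℝ) :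
    ‖prim g x‖ ^ 2 ≤ ∫ y in Iic x, Real.exp (y - x) * ‖g y‖ ^ 2 := by
  set t := ∫ y in Iic x, ‖Real.exp (y - x) • g y‖
  have ht : ‖prim g x‖ ≤ t := norm_integral_le_integral_norm _
  have h1 : ∫ y in Iic x, (2 * t * ‖Real.exp (y - x) • g y‖) ≤
      ∫ y in Iic x, (Real.exp (y - x) * t ^ 2 + Real.exp (y - x) * ‖g y‖ ^ 2) := by
    refine integral_mono ((integrableOn_exp_smul hg x).norm.const_mul _)
      (((integrableOn_exp_sub_Iic x).mul_const _).add (integrableOn_exp_mul_norm_sq hg x))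
      fun y => ?_
    simp only [norm_smul, Real.norm_of_nonneg (Real.exp_pos _).le]
    nlinarith [mul_nonneg (Real.exp_pos (y - x)).le (sq_nonneg (t - ‖g y‖))]
  rw [integral_const_mul, integral_add ((integrableOn_exp_sub_Iic x).mul_const _)
    (integrableOn_exp_mul_norm_sq hg x), integral_mul_const, integral_exp_sub_Iic] at h1
  have h2 : ‖prim g x‖ ^ 2 ≤ t ^ 2 := pow_le_pow_left₀ (norm_nonneg _) ht 2
  change 2 * t * t ≤ _ at h1
  nlinarith

lemma norm_prim_sq_le_integral {g : ℝ → E} (hg : MemLp g 2) (x : ℝ) :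
    ‖prim g x‖ ^ 2 ≤ ∫ y, ‖g y‖ ^ 2 := by
  refine (norm_prim_sq_le hg x).trans (le_trans ?_
    (setIntegral_le_integral hg.integrable_norm_sq (s := Iic x) (by
      filter_upwards with y; positivity)))
  refine setIntegral_mono_on (integrableOn_exp_mul_norm_sq hg x)
    hg.integrable_norm_sq.integrableOn measurableSet_Iic fun y hy => ?_
  exact mul_le_of_le_one_left (by positivity) (Real.exp_le_one_iff.2 (by simpa using hy))

lemma continuous_prim {g : ℝ → E} (hg : MemLp g 2) : Continuous (prim g) := by
  have h0 : ∀ x, IntegrableOn (fun y => Real.exp y • g y) (Iic x) := fun x => by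
    refine Integrable.congr ((integrableOn_exp_smul hg x).smul (Real.exp x))
      (ae_of_all _ fun y => ?_)
    simp only [Pi.smul_apply, smul_smul]
    rw [← Real.exp_add, add_sub_cancel]
  have h1 : prim g = fun x => Real.exp (-x) •
      ((∫ y in Iic 0, Real.exp y • g y) + ∫ y in (0 : ℝ)..x, Real.exp y • g y) := by
    funext x
    rw [← intervalIntegral.integral_Iic_sub_Iic (h0 0) (h0 x), add_sub_cancel, ← integral_smul]
    refine integral_congr_ae (ae_of_all _ fun y => ?_)
    simp only [smul_smul]
    rw [← Real.exp_add, neg_add_eq_sub]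
  rw [h1]
  refine (Real.continuous_exp.comp continuous_neg).smul (continuous_const.add ?_)
  refine intervalIntegral.continuous_primitive (fun a b => ?_) 0
  exact ((h0 (max a b)).mono_set (fun y hy => hy.2)).intervalIntegrable

lemma lintegral_exp_sub_Ici (y : ℝ) :
    ∫⁻ x in Ici y, ENNReal.ofReal (Real.exp (y - x)) = 1 := by
  have h : ∀ x : ℝ, Real.exp (y - x) = Real.exp y * Real.exp (-x) := fun x => by
    rw [← Real.exp_add, sub_eq_add_neg]
  rw [← ofReal_integral_eq_lintegral_ofReal, integral_Ici_eq_integral_Ioi]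
  · simp_rw [h]
    rw [integral_const_mul, integral_exp_neg_Ioi, ← Real.exp_add]
    simp
  · simp_rw [h]
    rw [← IntegrableOn, integrableOn_Ici_iff_integrableOn_Ioi]
    have := exp_neg_integrableOn_Ioi y one_pos
    simp only [neg_mul, one_mul] at this
    exact this.const_mul _
  · filter_upwards with x
    positivity

lemma lintegral_norm_prim_sq_le {g : ℝ → E} (hg : MemLp g 2) :
    ∫⁻ x, ENNReal.ofReal (‖prim g x‖ ^ 2) ≤ ∫⁻ x, ENNReal.ofReal (‖g x‖ ^ 2) := by
  have hS : MeasurableSet {p : ℝ × ℝ | p.2 ≤ p.1} := measurableSet_le measurable_snd measurable_fst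
  calc ∫⁻ x, ENNReal.ofReal (‖prim g x‖ ^ 2)
      ≤ ∫⁻ x, ∫⁻ y, {p : ℝ × ℝ | p.2 ≤ p.1}.indicator (fun p =>
          ENNReal.ofReal (Real.exp (p.2 - p.1)) * ENNReal.ofReal (‖g p.2‖ ^ 2)) (x, y) := by
        refine lintegral_mono fun x => (ENNReal.ofReal_le_ofReal (norm_prim_sq_le hg x)).trans ?_
        rw [ofReal_integral_eq_lintegral_ofReal (integrableOn_exp_mul_norm_sq hg x)
          (by filter_upwards with y; positivity), ← lintegral_indicator measurableSet_Iic]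
        refine lintegral_mono fun y => ?_
        by_cases hy : y ≤ x
        · simp [hy, ENNReal.ofReal_mul (Real.exp_pos (y - x)).le]
        · simp [hy]
    _ = ∫⁻ y, ∫⁻ x, {p : ℝ × ℝ | p.2 ≤ p.1}.indicator (fun p =>
          ENNReal.ofReal (Real.exp (p.2 - p.1)) * ENNReal.ofReal (‖g p.2‖ ^ 2)) (x, y) := by
        refine lintegral_lintegral_swap ?_
        have h2 : AEMeasurable (fun p : ℝ × ℝ => ENNReal.ofReal (‖g p.2‖ ^ 2))
            (volume.prod volume) := (hg.1.norm.pow 2).comp_snd.aemeasurable.ennreal_ofReal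
        have h1 : Measurable (fun p : ℝ × ℝ => ENNReal.ofReal (Real.exp (p.2 - p.1))) := by
          fun_prop
        exact (h1.aemeasurable.mul h2).indicator hS
    _ = ∫⁻ y, ENNReal.ofReal (‖g y‖ ^ 2) := by
        refine lintegral_congr fun y => ?_
        have : (fun x => {p : ℝ × ℝ | p.2 ≤ p.1}.indicator (fun p =>
          ENNReal.ofReal (Real.exp (p.2 - p.1)) * ENNReal.ofReal (‖g p.2‖ ^ 2)) (x, y)) =
          (Ici y).indicator (fun x => ENNReal.ofReal (Real.exp (y - x)) *
            ENNReal.ofReal (‖g y‖ ^ 2)) := by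
          funext x
          by_cases hy : y ≤ x <;> simp [hy]
        rw [this, lintegral_indicator measurableSet_Ici, lintegral_mul_const _ (by fun_prop),
          lintegral_exp_sub_Ici, one_mul]

lemma memLp_prim {g : ℝ → E} (hg : MemLp g 2) : MemLp (prim g) 2 := by
  have hc := continuous_prim hg
  rw [memLp_two_iff_integrable_sq_norm hc.aestronglyMeasurable]
  refine ⟨by fun_prop, ?_⟩
  rw [hasFiniteIntegral_iff_ofReal (by filter_upwards with x; positivity)]
  exact (lintegral_norm_prim_sq_le hg).trans_lt
    ((hasFiniteIntegral_iff_ofReal (by filter_upwards with x; positivity)).1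
      hg.integrable_norm_sq.2)

lemma integral_norm_prim_sq_le {g : ℝ → E} (hg : MemLp g 2) :
    ∫ x, ‖prim g x‖ ^ 2 ≤ ∫ x, ‖g x‖ ^ 2 := by
  rw [integral_eq_lintegral_of_nonneg_ae (by filter_upwards with x; positivity)
    (memLp_prim hg).integrable_norm_sq.1, integral_eq_lintegral_of_nonneg_ae
    (by filter_upwards with x; positivity) hg.integrable_norm_sq.1]
  refine ENNReal.toReal_mono ?_ (lintegral_norm_prim_sq_le hg)
  exact ((hasFiniteIntegral_iff_ofReal (by filter_upwards with x; positivity)).1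
      hg.integrable_norm_sq.2).ne

lemma prim_add {g h : ℝ → E} (hg : MemLp g 2) (hh : MemLp h 2) (x : ℝ) :
    prim (g + h) x = prim g x + prim h x := by
  simp only [prim, Pi.add_apply, smul_add]
  exact integral_add (integrableOn_exp_smul hg x) (integrableOn_exp_smul hh x)

lemma prim_smul (c : ℂ) (g : ℝ → E) (x : ℝ) : prim (c • g) x = c • prim g x := by
  simp only [prim, Pi.smul_apply]
  rw [← integral_smul]
  exact integral_congr_ae (ae_of_all _ fun y => smul_comm _ _ _)

/-- The Hilbert space `L²(ℝ, E)`. -/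
noncomputable abbrev L2R (E : Type*) [NormedAddCommGroup E] := Lp E 2 (volume : Measure ℝ)

lemma Lp_norm_sq (g : L2R E) : ‖g‖ ^ 2 = ∫ x, ‖g x‖ ^ 2 := by
  have h := (Complex.ofReal_inj.1 (by
    rw [← integral_complex_ofReal]
    have := L2.inner_def (𝕜 := ℂ) g g
    rw [inner_self_eq_norm_sq_to_K] at this
    push_cast
    refine this.trans (integral_congr_ae (ae_of_all _ fun x => ?_))
    simp only [inner_self_eq_norm_sq_to_K]
    rfl) : ((‖g‖ ^ 2 : ℝ)) = ∫ x, ‖g x‖ ^ 2)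
  exact h

/-- `prim` as an operator on `L²`. -/
noncomputable def primL : L2R E →L[ℂ] L2R E :=
  LinearMap.mkContinuous
    { toFun := fun g => (memLp_prim (Lp.memLp g)).toLp _
      map_add' := fun g h => by
        rw [← MemLp.toLp_add]
        refine MemLp.toLp_congr _ _ (ae_of_all _ fun x => ?_)
        rw [prim_congr (Lp.coeFn_add g h), prim_add (Lp.memLp g) (Lp.memLp h), Pi.add_apply]
      map_smul' := fun c g => by
        rw [RingHom.id_apply, ← MemLp.toLp_const_smul]
        refine MemLp.toLp_congr _ _ (ae_of_all _ fun x => ?_)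
        rw [prim_congr (Lp.coeFn_smul c g), prim_smul, Pi.smul_apply] } 1 (fun g => by
      rw [one_mul]
      refine le_of_sq_le_sq ?_ (norm_nonneg _)
      rw [Lp_norm_sq, Lp_norm_sq]
      refine le_trans (le_of_eq ?_) (integral_norm_prim_sq_le (Lp.memLp g))
      refine integral_congr_ae ?_
      filter_upwards [(memLp_prim (Lp.memLp g)).coeFn_toLp] with x hx
      simp only [LinearMap.coe_mk, AddHom.coe_mk]
      rw [hx])

lemma primL_coeFn (g : L2R E) : primL g =ᵐ[volume] prim g :=
  (memLp_prim (Lp.memLp g)).coeFn_toLp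

lemma norm_primL_le (g : L2R E) : ‖primL g‖ ≤ ‖g‖ := by
  have := (primL (E := E)).le_of_opNorm_le (LinearMap.mkContinuous_norm_le _ zero_le_one _) g
  simpa using this

lemma norm_prim_le (g : L2R E) (x : ℝ) : ‖prim g x‖ ≤ ‖g‖ := by
  refine le_of_sq_le_sq ?_ (norm_nonneg _)
  rw [Lp_norm_sq]
  exact norm_prim_sq_le_integral (Lp.memLp g) x

end Prim

section Potential

open Filter Topology Set
open scoped InnerProductSpace ComplexConjugate ENNReal

variable {E : Type*} [NormedAddCommGroup E] [InnerProductSpace ℂ E]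

/-- Evaluation of `prim` at a point. -/
noncomputable def primEval (x : ℝ) : L2R E →L[ℂ] E :=
  LinearMap.mkContinuous
    { toFun := fun g => prim g x
      map_add' := fun g h => by
        rw [prim_congr (Lp.coeFn_add g h), prim_add (Lp.memLp g) (Lp.memLp h)]
      map_smul' := fun c g => by
        rw [RingHom.id_apply, prim_congr (Lp.coeFn_smul c g), prim_smul] } 1 (fun g => by
      rw [one_mul]
      exact norm_prim_le g x)

lemma primEval_apply (x : ℝ) (g : L2R E) : primEval x g = prim g x := rfl

lemma prim_Lp_add (g h : L2R E) (x : ℝ) : prim (g + h : L2R E) x = prim g x + prim h x :=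
  (primEval x).map_add g h

lemma prim_Lp_smul (c : ℂ) (g : L2R E) (x : ℝ) : prim (c • g : L2R E) x = c • prim g x :=
  (primEval x).map_smul c g

lemma prim_Lp_sum {ι : Type*} (s : Finset ι) (c : ι → ℂ) (g : ι → L2R E) (x : ℝ) :
    prim (∑ j ∈ s, c j • g j : L2R E) x = ∑ j ∈ s, c j • prim (g j) x := by
  rw [← primEval_apply, map_sum]
  simp [primEval_apply]

/-- A continuous, self-adjoint, integrable potential. -/
structure IsPotential (U : ℝ → E →L[ℂ] E) : Prop where
  cont : Continuous U
  symm : ∀ x v w, ⟪U x v, w⟫_ℂ = ⟪v, U x w⟫_ℂ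
  integrable : Integrable fun x => ‖U x‖

lemma norm_inner_potential_le (U : ℝ → E →L[ℂ] E) (h g : L2R E) (x : ℝ) :
    ‖⟪prim h x, U x (prim g x)⟫_ℂ‖ ≤ ‖U x‖ * (‖h‖ * ‖g‖) := by
  calc _ ≤ ‖prim h x‖ * (‖U x‖ * ‖prim g x‖) :=
        (norm_inner_le_norm _ _).trans (by gcongr; exact (U x).le_opNorm _)
    _ ≤ ‖h‖ * (‖U x‖ * ‖g‖) := by gcongr <;> exact norm_prim_le _ _
    _ = _ := by ring

lemma IsPotential.integrable_inner {U : ℝ → E →L[ℂ] E} (hU : IsPotential U) (h g : L2R E) :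
    Integrable fun x => ⟪prim h x, U x (prim g x)⟫_ℂ := by
  refine Integrable.mono' (hU.integrable.mul_const (‖h‖ * ‖g‖)) ?_
    (ae_of_all _ (norm_inner_potential_le U h g))
  exact ((continuous_prim (Lp.memLp h)).inner
    (hU.cont.clm_apply (continuous_prim (Lp.memLp g)))).aestronglyMeasurable

/-- The form of the potential, in terms of `g = f' + f`. -/
noncomputable def potForm {U : ℝ → E →L[ℂ] E} (hU : IsPotential U) :
    L2R E →ₗ⋆[ℂ] L2R E →ₗ[ℂ] ℂ :=
  LinearMap.mk₂'ₛₗ (starRingEnd ℂ) (RingHom.id ℂ)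
    (fun h g => ∫ x, ⟪prim h x, U x (prim g x)⟫_ℂ)
    (fun h₁ h₂ g => by
      rw [← integral_add (hU.integrable_inner _ _) (hU.integrable_inner _ _)]
      simp only [prim_Lp_add, inner_add_left])
    (fun c h g => by
      simp only [prim_Lp_smul, inner_smul_left]
      rw [integral_const_mul, smul_eq_mul])
    (fun h g₁ g₂ => by
      rw [← integral_add (hU.integrable_inner _ _) (hU.integrable_inner _ _)]
      simp only [prim_Lp_add, map_add, inner_add_right])
    (fun c h g => by
      simp only [prim_Lp_smul, map_smul, inner_smul_right]
      rw [integral_const_mul, smul_eq_mul, RingHom.id_apply])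

lemma potForm_apply {U : ℝ → E →L[ℂ] E} (hU : IsPotential U) (h g : L2R E) :
    potForm hU h g = ∫ x, ⟪prim h x, U x (prim g x)⟫_ℂ := rfl

lemma potForm_self_re {U : ℝ → E →L[ℂ] E} (hU : IsPotential U) (g : L2R E) :
    (potForm hU g g).re = ∫ x, (⟪prim g x, U x (prim g x)⟫_ℂ).re :=
  (integral_re (hU.integrable_inner g g)).symm

lemma WeakLim.tendsto_clm [FiniteDimensional ℂ E] {H : Type*} [NormedAddCommGroup H]
    [InnerProductSpace ℂ H] [CompleteSpace H] {u : ℕ → H} {g : H} (hu : WeakLim u g)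
    (T : H →L[ℂ] E) : Tendsto (fun k => T (u k)) atTop (𝓝 (T g)) := by
  let b := stdOrthonormalBasis ℂ E
  have hb : ∀ v, T v = ∑ i, ⟪T.adjoint (b i), v⟫_ℂ • b i := fun v => by
    simp_rw [ContinuousLinearMap.adjoint_inner_left]
    exact (b.sum_repr' (T v)).symm
  simp_rw [hb]
  exact tendsto_finsetSum _ fun i _ => (hu (T.adjoint (b i))).smul_const _

lemma IsPotential.isCompactForm [FiniteDimensional ℂ E] {U : ℝ → E →L[ℂ] E}
    (hU : IsPotential U) : IsCompactForm (primL (E := E)) (potForm hU) where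
  conj_apply g h := by
    rw [potForm_apply, potForm_apply, ← integral_conj]
    refine integral_congr_ae (ae_of_all _ fun x => ?_)
    simp only [inner_conj_symm, hU.symm]
  bounded := by
    refine ⟨∫ x, ‖U x‖, fun g => (Complex.abs_re_le_norm _).trans ?_⟩
    rw [potForm_apply, ← integral_mul_const]
    refine norm_integral_le_of_norm_le (hU.integrable.mul_const _) (ae_of_all _ fun x => ?_)
    rw [sq]
    exact norm_inner_potential_le U g g x
  weak u g C hC hu := by
    simp_rw [potForm_self_re hU]
    have hC0 : 0 ≤ C := (norm_nonneg _).trans (hC 0)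
    have hp : ∀ x, Tendsto (fun k => prim (u k) x) atTop (𝓝 (prim g x)) := fun x =>
      hu.tendsto_clm (primEval x)
    refine tendsto_integral_of_dominated_convergence (fun x => ‖U x‖ * (C * C))
      (fun k => (hU.integrable_inner _ _).re.1) (hU.integrable.mul_const _)
      (fun k => ae_of_all _ fun x => ?_) (ae_of_all _ fun x => ?_)
    · refine (Complex.abs_re_le_norm _).trans ((norm_inner_potential_le U (u k) (u k) x).trans ?_)
      gcongr <;> exact hC k
    · exact (Complex.continuous_re.tendsto _).comp
        ((hp x).inner (((U x).continuous.tendsto _).comp (hp x)))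
  ker g hg := by
    have h1 : prim g =ᵐ[volume] (fun _ => (0 : E)) := by
      have h2 := primL_coeFn g
      rw [hg] at h2
      exact h2.symm.trans (Lp.coeFn_zero _ _ _)
    have h3 := (Continuous.ae_eq_iff_eq volume (continuous_prim (Lp.memLp g))
      continuous_const).1 h1
    rw [potForm_self_re, h3]
    simp

end Potential

section Regularity

open Filter Topology Set
open scoped InnerProductSpace ComplexConjugate ENNReal

variable {E : Type*} [NormedAddCommGroup E] [InnerProductSpace ℂ E]

/-- `f` is differentiable with derivative `f₁`, and both are square integrable. -/
structure IsH1 (f f₁ : ℝ → E) : Prop where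
  hasDerivAt : ∀ x, HasDerivAt f (f₁ x) x
  memLp : MemLp f 2
  memLp_deriv : MemLp f₁ 2

lemma IsH1.continuous {f f₁ : ℝ → E} (h : IsH1 f f₁) : Continuous f :=
  continuous_iff_continuousAt.2 fun x => (h.hasDerivAt x).continuousAt

/-- The element `f' + f` of `L²`. -/
noncomputable def IsH1.toL2 {f f₁ : ℝ → E} (h : IsH1 f f₁) : L2R E :=
  (h.memLp.add h.memLp_deriv).toLp (f + f₁)

lemma IsH1.norm_sq_toL2 {f f₁ : ℝ → E} (h : IsH1 f f₁) :
    ‖h.toL2‖ ^ 2 = (∫ x, ‖f x‖ ^ 2) + ∫ x, ‖f₁ x‖ ^ 2 := by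
  have hd : ∀ x, HasDerivAt (fun x => ⟪f x, f x⟫_ℂ) (⟪f x, f₁ x⟫_ℂ + ⟪f₁ x, f x⟫_ℂ) x :=
    fun x => (h.hasDerivAt x).inner ℂ (h.hasDerivAt x)
  have hint : ∀ {u v : ℝ → E}, MemLp u 2 → MemLp v 2 → Integrable fun x => ⟪u x, v x⟫_ℂ := by
    intro u v hu hv
    refine (L2.integrable_inner (𝕜 := ℂ) (hu.toLp u) (hv.toLp v)).congr ?_
    filter_upwards [hu.coeFn_toLp, hv.coeFn_toLp] with x h1 h2
    rw [h1, h2]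
  have hi := (hint h.memLp h.memLp_deriv).add (hint h.memLp_deriv h.memLp)
  have h0 := integral_eq_zero_of_hasDerivAt_of_integrable hd hi (hint h.memLp h.memLp)
  rw [Lp_norm_sq]
  calc ∫ x, ‖h.toL2 x‖ ^ 2
      = ∫ x, ((‖f x‖ ^ 2 + ‖f₁ x‖ ^ 2) + (⟪f x, f₁ x⟫_ℂ + ⟪f₁ x, f x⟫_ℂ).re) := by
        refine integral_congr_ae ?_
        filter_upwards [(h.memLp.add h.memLp_deriv).coeFn_toLp] with x hx
        rw [IsH1.toL2, hx, Pi.add_apply, ← inner_conj_symm (f x), Complex.add_re, Complex.conj_re,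
          norm_add_sq (𝕜 := ℂ), ← inner_conj_symm (f x) (f₁ x), RCLike.conj_re]
        simp only [RCLike.re_to_complex]
        ring
    _ = _ := by
        have hi' : Integrable fun x => (⟪f x, f₁ x⟫_ℂ + ⟪f₁ x, f x⟫_ℂ).re := hi.re
        have hs : Integrable fun x => ‖f x‖ ^ 2 + ‖f₁ x‖ ^ 2 :=
          h.memLp.integrable_norm_sq.add h.memLp_deriv.integrable_norm_sq
        rw [integral_add hs hi',
          integral_add h.memLp.integrable_norm_sq h.memLp_deriv.integrable_norm_sq]
        have : ∫ x, (⟪f x, f₁ x⟫_ℂ + ⟪f₁ x, f x⟫_ℂ).re = 0 := by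
          have := integral_re hi
          simp only [Pi.add_apply, RCLike.re_to_complex] at this
          rw [this, h0, Complex.zero_re]
        rw [this, add_zero]

variable [FiniteDimensional ℂ E]

lemma IsH1.prim_toL2 {f f₁ : ℝ → E} (h : IsH1 f f₁) : prim h.toL2 = f := by
  have hm := h.memLp.add h.memLp_deriv
  rw [IsH1.toL2, prim_congr hm.coeFn_toLp]
  funext x
  have hd : ∀ y, HasDerivAt (fun y => Real.exp (y - x) • f y) (Real.exp (y - x) • (f + f₁) y) y :=
    fun y => by
      have h1 : HasDerivAt (fun y => Real.exp (y - x)) (Real.exp (y - x)) y := by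
        simpa using ((hasDerivAt_id y).sub_const x).exp
      refine HasDerivAt.congr_deriv (h1.smul (h.hasDerivAt y)) ?_
      simp only [Pi.add_apply, smul_add]
      abel
  have h0 := tendsto_zero_of_hasDerivAt_of_integrableOn_Iic (a := x) (fun y _ => hd y)
    (integrableOn_exp_smul hm x) (integrableOn_exp_smul h.memLp x)
  have h1 := integral_Iic_of_hasDerivAt_of_tendsto (a := x) (hd x).continuousAt.continuousWithinAt
    (fun y _ => hd y) (integrableOn_exp_smul hm x) h0
  rw [prim, h1]
  simp

lemma IsH1.primL_toL2 {f f₁ : ℝ → E} (h : IsH1 f f₁) : primL h.toL2 =ᵐ[volume] f := by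
  have := primL_coeFn h.toL2
  rwa [h.prim_toL2] at this

lemma IsH1.schrForm_re {U : ℝ → E →L[ℂ] E} (hU : IsPotential U) {f f₁ : ℝ → E} (h : IsH1 f f₁) :
    (schrForm primL (potForm hU) h.toL2 h.toL2).re =
      (∫ x, ‖f₁ x‖ ^ 2) + ∫ x, (⟪f x, U x (f x)⟫_ℂ).re := by
  have h1 : ‖primL h.toL2‖ ^ 2 = ∫ x, ‖f x‖ ^ 2 := by
    rw [Lp_norm_sq]
    refine integral_congr_ae ?_
    filter_upwards [h.primL_toL2] with x hx
    rw [hx]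
  rw [schrForm_self_re, h.norm_sq_toL2, h1, potForm_self_re, h.prim_toL2]
  ring

lemma integral_Iic_smul_eq_integral_smul_Ioi {w : ℝ → ℝ} {q : ℝ → E} {a : ℝ}
    (hw : Integrable w) (hwa : ∀ y < a, w y = 0) (hq : ∀ b, IntegrableOn q (Ioi b)) :
    Integrable (fun x => (∫ y in Iic x, w y) • q x) ∧
    ∫ x, (∫ y in Iic x, w y) • q x = ∫ y, w y • ∫ x in Ioi y, q x := by
  have hT : MeasurableSet {z : ℝ × ℝ | z.1 ≤ z.2} := measurableSet_le measurable_fst measurable_snd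
  have hqa : Integrable ((Ici a).indicator q) := by
    rw [integrable_indicator_iff measurableSet_Ici, integrableOn_Ici_iff_integrableOn_Ioi]
    exact hq a
  have hF : Integrable ({z : ℝ × ℝ | z.1 ≤ z.2}.indicator
      fun z => w z.1 • (Ici a).indicator q z.2) (volume.prod volume) :=
    (hw.smul_prod hqa).indicator hT
  have h1 : ∀ x, ∫ y, {z : ℝ × ℝ | z.1 ≤ z.2}.indicator
      (fun z => w z.1 • (Ici a).indicator q z.2) (y, x) = (∫ y in Iic x, w y) • q x := fun x => by
    have : (fun y => {z : ℝ × ℝ | z.1 ≤ z.2}.indicator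
      (fun z => w z.1 • (Ici a).indicator q z.2) (y, x)) =
        (Iic x).indicator (fun y => w y • (Ici a).indicator q x) := by
      funext y
      by_cases hy : y ≤ x <;> simp [hy]
    rw [this, integral_indicator measurableSet_Iic, integral_smul_const]
    by_cases hx : a ≤ x
    · simp [hx]
    · have : ∫ y in Iic x, w y = 0 := by
        refine (setIntegral_congr_fun measurableSet_Iic fun y hy => ?_).trans
          (integral_zero _ _)
        exact hwa y (lt_of_le_of_lt hy (not_le.1 hx))
      rw [this, zero_smul, zero_smul]
  have h2 : ∀ y, ∫ x, {z : ℝ × ℝ | z.1 ≤ z.2}.indicator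
      (fun z => w z.1 • (Ici a).indicator q z.2) (y, x) = w y • ∫ x in Ioi y, q x := fun y => by
    have : (fun x => {z : ℝ × ℝ | z.1 ≤ z.2}.indicator
      (fun z => w z.1 • (Ici a).indicator q z.2) (y, x)) =
        (Ici y).indicator (fun x => w y • (Ici a).indicator q x) := by
      funext x
      by_cases hy : y ≤ x <;> simp [hy]
    rw [this, integral_indicator measurableSet_Ici, integral_smul,
      integral_Ici_eq_integral_Ioi]
    by_cases hy : a ≤ y
    · congr 1
      refine setIntegral_congr_fun measurableSet_Ioi fun x hx => ?_
      exact indicator_of_mem (hy.trans (le_of_lt hx) : a ≤ x) q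
    · rw [hwa y (not_le.1 hy), zero_smul, zero_smul]
  refine ⟨?_, ?_⟩
  · refine hF.integral_prod_right.congr (ae_of_all _ fun x => h1 x)
  · rw [← integral_congr_ae (ae_of_all _ h1), ← integral_congr_ae (ae_of_all _ h2)]
    exact (integral_integral_swap (f := fun y x => {z : ℝ × ℝ | z.1 ≤ z.2}.indicator
      (fun z => w z.1 • (Ici a).indicator q z.2) (y, x)) hF).symm

lemma IsPotential.exists_isH1_of_eigen {U : ℝ → E →L[ℂ] E} (hU : IsPotential U) {g : L2R E}
    {lam : ℝ} (hg : ∀ h, schrForm primL (potForm hU) h g = (lam : ℂ) * ⟪primL h, primL g⟫_ℂ) :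
    ∃ f₁ : ℝ → E, IsH1 (prim g) f₁ ∧
      (∀ x, HasDerivAt f₁ (U x (prim g x) - (lam : ℂ) • prim g x) x) ∧
      g =ᵐ[volume] fun x => prim g x + f₁ x := by
  set f : ℝ → E := prim g with hf
  have hfc : Continuous f := continuous_prim (Lp.memLp g)
  have hfm : MemLp f 2 := memLp_prim (Lp.memLp g)
  set r : ℝ → E := fun x => U x (f x) - (1 + lam : ℂ) • f x with hr
  have hrc : Continuous r := (hU.cont.clm_apply hfc).sub (hfc.const_smul _)
  set q : ℝ → E := fun x => Real.exp (-x) • r x with hq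
  have hqc : Continuous q := (Real.continuous_exp.comp continuous_neg).smul hrc
  have hqi : ∀ b, IntegrableOn q (Ioi b) := fun b => by
    refine Integrable.mono' (((hU.integrable.mul_const (Real.exp (-b) * ‖g‖)).integrableOn).add
      ((integrableOn_exp_neg_Ioi b).mul_const (‖(1 + lam : ℂ)‖ * ‖g‖)))
      hqc.aestronglyMeasurable ?_
    filter_upwards [ae_restrict_mem measurableSet_Ioi] with x hx
    have hx' : b < x := hx
    have h1 : ‖f x‖ ≤ ‖g‖ := norm_prim_le g x
    rw [hq]
    simp only [norm_smul, Real.norm_of_nonneg (Real.exp_pos _).le, Pi.add_apply]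
    calc Real.exp (-x) * ‖r x‖ ≤ Real.exp (-x) * (‖U x‖ * ‖g‖ + ‖(1 + lam : ℂ)‖ * ‖g‖) := by
          gcongr
          refine (norm_sub_le _ _).trans ?_
          rw [norm_smul]
          gcongr
          exact ((U x).le_opNorm _).trans (by gcongr)
      _ = ‖U x‖ * (Real.exp (-x) * ‖g‖) + Real.exp (-x) * (‖(1 + lam : ℂ)‖ * ‖g‖) := by ring
      _ ≤ _ := by gcongr
  set ρ : ℝ → E := fun y => -(Real.exp y • ∫ x in Ioi y, q x) with hρ
  have hρd : ∀ y, HasDerivAt ρ (ρ y + r y) y := fun y => by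
    have h1 : (fun y => ∫ x in Ioi y, q x) =
        fun y => (∫ x in Ioi 0, q x) - ∫ x in (0 : ℝ)..y, q x := by
      funext y
      rw [← intervalIntegral.integral_interval_add_Ioi (hqi 0) (hqi y), add_sub_cancel_left]
    have h2 : HasDerivAt (fun y => ∫ x in Ioi y, q x) (-q y) y := by
      rw [h1]
      exact (intervalIntegral.integral_hasDerivAt_right (hqc.intervalIntegrable _ _)
        (hqc.stronglyMeasurableAtFilter _ _) hqc.continuousAt).const_sub _
    refine HasDerivAt.congr_deriv ((Real.hasDerivAt_exp y).smul h2).neg ?_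
    simp only [hρ, hq, smul_neg, smul_smul]
    rw [← Real.exp_add]
    simp only [add_neg_cancel, Real.exp_zero, one_smul]
    abel
  have hρc : Continuous ρ := continuous_iff_continuousAt.2 fun y => (hρd y).continuousAt
  have hgρ : g =ᵐ[volume] ρ := by
    have hgl : LocallyIntegrable g := (Lp.memLp g).locallyIntegrable (by norm_num)
    have h0 : (g - ρ : ℝ → E) =ᵐ[volume] 0 := by
      refine ae_eq_zero_of_forall_setIntegral_isCompact_eq_zero'
        (hgl.sub hρc.locallyIntegrable) fun S hS => ?_
      have hSm := hS.measurableSet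
      have hgS : IntegrableOn g S := hgl.integrableOn_isCompact hS
      have hρS : IntegrableOn ρ S := hρc.locallyIntegrable.integrableOn_isCompact hS
      simp only [Pi.sub_apply]
      rw [integral_sub hgS hρS, sub_eq_zero]
      refine ext_inner_left ℂ fun e => ?_
      have hSfin : volume S ≠ ⊤ := hS.measure_lt_top.ne
      obtain ⟨a, ha⟩ := hS.bddBelow
      set w : ℝ → ℝ := S.indicator Real.exp
      have hw : Integrable w := (integrable_indicator_iff hSm).2
        (Real.continuous_exp.locallyIntegrable.integrableOn_isCompact hS)
      have hwa : ∀ y < a, w y = 0 := fun y hy =>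
        indicator_of_notMem (fun hyS => (not_le.2 hy) (ha hyS)) _
      obtain ⟨hI, hEq⟩ := integral_Iic_smul_eq_integral_smul_Ioi hw hwa hqi
      set h : L2R E := indicatorConstLp 2 hSm hSfin e
      have hph : ∀ x, prim h x = (Real.exp (-x) * ∫ y in Iic x, w y) • e := fun x => by
        rw [prim_congr indicatorConstLp_coeFn, prim, ← integral_const_mul, ← integral_smul_const]
        refine integral_congr_ae (ae_of_all _ fun y => ?_)
        by_cases hy : y ∈ S
        · simp only [hy, indicator_of_mem, w, ← Real.exp_add]
          rw [neg_add_eq_sub]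
        · simp [hy, w]
      have key := hg h
      rw [schrForm_apply, L2.inner_indicatorConstLp_eq_inner_setIntegral, potForm_apply] at key
      have hpp : ⟪primL h, primL g⟫_ℂ = ∫ x, ⟪prim h x, f x⟫_ℂ := by
        rw [L2.inner_def]
        refine integral_congr_ae ?_
        filter_upwards [primL_coeFn h, primL_coeFn g] with x h1 h2
        rw [h1, h2]
      have hppi : Integrable fun x => ⟪prim h x, f x⟫_ℂ := by
        refine (L2.integrable_inner (𝕜 := ℂ) (primL h) (primL g)).congr ?_
        filter_upwards [primL_coeFn h, primL_coeFn g] with x h1 h2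
        rw [h1, h2]
      have h3 : ∫ x, ⟪prim h x, r x⟫_ℂ = (∫ x, ⟪prim h x, U x (prim g x)⟫_ℂ) -
          (1 + lam : ℂ) * ∫ x, ⟪prim h x, f x⟫_ℂ := by
        rw [← integral_const_mul, ← integral_sub (hU.integrable_inner h g) (hppi.const_mul _)]
        simp only [hr, inner_sub_right, inner_smul_right, hf]
      have h4 : ∫ x, ⟪prim h x, r x⟫_ℂ = -⟪e, ∫ y in S, ρ y⟫_ℂ := by
        have h5 : ∫ y in S, ρ y = -∫ y, w y • ∫ x in Ioi y, q x := by
          rw [← integral_indicator hSm, ← integral_neg]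
          refine integral_congr_ae (ae_of_all _ fun y => ?_)
          by_cases hy : y ∈ S <;> simp [hy, w, hρ]
        rw [h5, inner_neg_right, neg_neg, ← hEq, ← integral_inner hI]
        refine integral_congr_ae (ae_of_all _ fun x => ?_)
        simp only [hph, hq]
        rw [smul_smul, mul_comm (∫ y in Iic x, w y)]
        simp only [← Complex.coe_smul, inner_smul_left, inner_smul_right, Complex.conj_ofReal]
      rw [hpp] at key
      rw [h3] at h4
      linear_combination key - h4
    filter_upwards [h0] with x hx
    exact sub_eq_zero.1 hx
  have hfρ : f = prim ρ := prim_congr hgρ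
  have hρm : MemLp ρ 2 := (Lp.memLp g).ae_eq hgρ
  have hfd : ∀ x, HasDerivAt f (ρ x - f x) x := fun x => by
    have hei : ∀ x, IntegrableOn (fun y => Real.exp y • ρ y) (Iic x) := fun x => by
      refine Integrable.congr ((integrableOn_exp_smul hρm x).smul (Real.exp x))
        (ae_of_all _ fun y => ?_)
      simp only [Pi.smul_apply, smul_smul]
      rw [← Real.exp_add, add_sub_cancel]
    have hec : Continuous fun y => Real.exp y • ρ y := Real.continuous_exp.smul hρc
    have h1 : f = fun x => Real.exp (-x) •
        ((∫ y in Iic 0, Real.exp y • ρ y) + ∫ y in (0 : ℝ)..x, Real.exp y • ρ y) := by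
      rw [hfρ]
      funext x
      rw [← intervalIntegral.integral_Iic_sub_Iic (hei 0) (hei x), add_sub_cancel, ← integral_smul]
      refine integral_congr_ae (ae_of_all _ fun y => ?_)
      simp only [smul_smul]
      rw [← Real.exp_add, neg_add_eq_sub]
    have h2 := ((hasDerivAt_neg x).exp.smul ((intervalIntegral.integral_hasDerivAt_right
        (hec.intervalIntegrable 0 x) (hec.stronglyMeasurableAtFilter _ _)
        hec.continuousAt).const_add (∫ y in Iic 0, Real.exp y • ρ y)))
    rw [h1]
    refine HasDerivAt.congr_deriv h2 ?_
    simp only [smul_smul, ← Real.exp_add, neg_add_cancel, Real.exp_zero, one_smul, mul_neg,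
      mul_one, neg_smul]
    abel
  refine ⟨fun x => ρ x - f x, ⟨hfd, hfm, hρm.sub hfm⟩, fun x => ?_, by simpa using hgρ⟩
  refine HasDerivAt.congr_deriv ((hρd x).sub (hfd x)) ?_
  simp only [hr, add_smul, one_smul]
  abel

end Regularity

section BoundStates

open Filter Topology Set
open scoped InnerProductSpace ComplexConjugate ENNReal

variable {E : Type*} [NormedAddCommGroup E] [InnerProductSpace ℂ E]

lemma hasDerivAt_norm_sq_complex {f : ℝ → E} {f' : E} {x : ℝ} (hf : HasDerivAt f f' x) :
    HasDerivAt (fun x => ‖f x‖ ^ 2) (2 * (⟪f x, f'⟫_ℂ).re) x := by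
  have h := (hasDerivAt_iff_hasFDerivAt.1 (hf.inner ℂ hf))
  have h2 := (Complex.reCLM.hasFDerivAt.comp x h).hasDerivAt
  have h3 : (fun x => ‖f x‖ ^ 2) = Complex.reCLM ∘ fun t => ⟪f t, f t⟫_ℂ := by
    funext t
    simp only [Function.comp, Complex.reCLM_apply]
    exact (inner_self_eq_norm_sq (𝕜 := ℂ) (f t)).symm
  rw [h3]
  refine h2.congr_deriv ?_
  simp only [ContinuousLinearMap.comp_apply, Complex.reCLM_apply,
    ContinuousLinearMap.toSpanSingleton_apply, one_smul]
  rw [← inner_conj_symm f', Complex.add_re, Complex.conj_re]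
  ring

/-- Two square integrable solutions: the growing exponential is not square integrable. -/
lemma eq_zero_of_hasDerivAt_smul_of_memLp {z : ℝ → E} {L k : ℝ} (hk : 0 < k)
    (hz : ∀ x, L ≤ x → HasDerivAt z ((k : ℂ) • z x) x) (hm : MemLp z 2) {x : ℝ} (hx : L ≤ x) :
    z x = 0 := by
  have hd : ∀ y, L ≤ y → HasDerivAt (fun y => ‖z y‖ ^ 2) (2 * k * ‖z y‖ ^ 2) y := fun y hy => by
    refine (hasDerivAt_norm_sq_complex (hz y hy)).congr_deriv ?_
    rw [inner_smul_right, inner_self_eq_norm_sq_to_K]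
    simp only [← Complex.ofReal_pow, ← Complex.ofReal_mul, Complex.coe_algebraMap,
      Complex.ofReal_re]
    ring
  have ht : Tendsto (fun y => ‖z y‖ ^ 2) atTop (𝓝 0) :=
    tendsto_zero_of_hasDerivAt_of_integrableOn_Ioi (a := L) (fun y hy => hd y (le_of_lt hy))
      (hm.integrable_norm_sq.const_mul _).integrableOn hm.integrable_norm_sq.integrableOn
  have hmono : MonotoneOn (fun y => ‖z y‖ ^ 2) (Ici L) := by
    refine monotoneOn_of_deriv_nonneg (convex_Ici L)
      (fun y hy => (hd y hy).continuousAt.continuousWithinAt) (fun y hy => ?_) fun y hy => ?_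
    · rw [interior_Ici] at hy
      exact (hd y (le_of_lt hy)).differentiableAt.differentiableWithinAt
    · rw [interior_Ici] at hy
      rw [(hd y (le_of_lt hy)).deriv]
      positivity
  have h0 : ‖z x‖ ^ 2 ≤ 0 := ge_of_tendsto ht <| by
    filter_upwards [eventually_ge_atTop x] with y hy
    exact hmono hx (hx.trans hy) hy
  have h1 : ‖z x‖ = 0 := by nlinarith [norm_nonneg (z x)]
  exact norm_eq_zero.1 h1

/-- Backward uniqueness for `u'' = Q u`. -/
lemma eq_zero_of_second_order {u u₁ : ℝ → E} {Q : ℝ → E →L[ℂ] E} {C : ℝ} (hQ : ∀ x, ‖Q x‖ ≤ C)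
    (hu : ∀ x, HasDerivAt u (u₁ x) x) (hu₁ : ∀ x, HasDerivAt u₁ (Q x (u x)) x) {a : ℝ}
    (ha : u a = 0) (ha₁ : u₁ a = 0) {x : ℝ} (hx : x ≤ a) : u x = 0 := by
  have hC : 0 ≤ C := (norm_nonneg _).trans (hQ 0)
  set φ : ℝ → ℝ := fun x => (‖u x‖ ^ 2 + ‖u₁ x‖ ^ 2) * Real.exp ((1 + C) * x) with hφ
  have hd : ∀ y, HasDerivAt φ ((2 * (⟪u y, u₁ y⟫_ℂ).re + 2 * (⟪u₁ y, Q y (u y)⟫_ℂ).re) *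
      Real.exp ((1 + C) * y) + (‖u y‖ ^ 2 + ‖u₁ y‖ ^ 2) * (Real.exp ((1 + C) * y) * (1 + C))) y :=
    fun y => by
      refine ((hasDerivAt_norm_sq_complex (hu y)).add (hasDerivAt_norm_sq_complex (hu₁ y))).mul ?_
      simpa using ((hasDerivAt_id y).const_mul (1 + C)).exp
  have hm : Monotone φ := by
    refine monotone_of_deriv_nonneg (fun y => (hd y).differentiableAt) fun y => ?_
    rw [(hd y).deriv]
    have h1 : |(⟪u y, u₁ y⟫_ℂ).re| ≤ ‖u y‖ * ‖u₁ y‖ :=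
      (Complex.abs_re_le_norm _).trans (norm_inner_le_norm _ _)
    have h2 : |(⟪u₁ y, Q y (u y)⟫_ℂ).re| ≤ ‖u₁ y‖ * (C * ‖u y‖) := by
      refine (Complex.abs_re_le_norm _).trans ((norm_inner_le_norm _ _).trans ?_)
      gcongr
      exact ((Q y).le_opNorm _).trans (by gcongr; exact hQ y)
    have h3 := neg_abs_le (⟪u y, u₁ y⟫_ℂ).re
    have h4 := neg_abs_le (⟪u₁ y, Q y (u y)⟫_ℂ).re
    have h5 : 0 ≤ (1 + C) * (‖u y‖ - ‖u₁ y‖) ^ 2 := by positivity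
    have : 0 ≤ Real.exp ((1 + C) * y) * ((2 * (⟪u y, u₁ y⟫_ℂ).re +
        2 * (⟪u₁ y, Q y (u y)⟫_ℂ).re) + (‖u y‖ ^ 2 + ‖u₁ y‖ ^ 2) * (1 + C)) := by
      refine mul_nonneg (Real.exp_pos _).le ?_
      nlinarith
    linarith
  have h0 : φ x ≤ 0 := (hm hx).trans (by simp [hφ, ha, ha₁])
  have hexp := Real.exp_pos ((1 + C) * x)
  have h1 : ‖u x‖ ^ 2 + ‖u₁ x‖ ^ 2 ≤ 0 := by
    by_contra! h
    exact (not_lt.2 h0) (mul_pos h hexp)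
  have h2 : ‖u x‖ = 0 := by nlinarith [norm_nonneg (u x), sq_nonneg ‖u₁ x‖]
  exact norm_eq_zero.1 h2

/-- A finite orthonormal family of bound states `-f'' + W f = -e f`. -/
structure IsBoundStates {N : ℕ} (W : ℝ → E →L[ℂ] E) (f f₁ : Fin N → ℝ → E) (e : Fin N → ℝ) :
    Prop where
  pos : ∀ j, 0 < e j
  isH1 : ∀ j, IsH1 (f j) (f₁ j)
  deriv₁ : ∀ j x, HasDerivAt (f₁ j) (W x (f j x) + (e j : ℂ) • f j x) x
  orthonormal : ∀ j l, ∫ x, ⟪f j x, f l x⟫_ℂ = if j = l then 1 else 0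

lemma MeasureTheory.MemLp.integrable_inner₂ {u v : ℝ → E} (hu : MemLp u 2) (hv : MemLp v 2) :
    Integrable fun x => ⟪u x, v x⟫_ℂ := by
  refine (L2.integrable_inner (𝕜 := ℂ) (hu.toLp u) (hv.toLp v)).congr ?_
  filter_upwards [hu.coeFn_toLp, hv.coeFn_toLp] with x h1 h2
  rw [h1, h2]

lemma IsBoundStates.hasDerivAt_sum {N : ℕ} {W : ℝ → E →L[ℂ] E} {f f₁ : Fin N → ℝ → E}
    {e : Fin N → ℝ} (h : IsBoundStates W f f₁ e) (v : Fin N → ℂ) (x : ℝ) :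
    HasDerivAt (fun y => ∑ j, v j • f j y) (∑ j, v j • f₁ j x) x :=
  HasDerivAt.fun_sum fun j _ => ((h.isH1 j).hasDerivAt x).const_smul (v j)

lemma IsBoundStates.hasDerivAt_sum₁ {N : ℕ} {W : ℝ → E →L[ℂ] E} {f f₁ : Fin N → ℝ → E}
    {e : Fin N → ℝ} (h : IsBoundStates W f f₁ e) (v : Fin N → ℂ) (x : ℝ) :
    HasDerivAt (fun y => ∑ j, v j • f₁ j y)
      (W x (∑ j, v j • f j x) + ∑ j, ((e j : ℂ) * v j) • f j x) x := by
  refine (HasDerivAt.fun_sum fun j _ => (h.deriv₁ j x).const_smul (v j)).congr_deriv ?_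
  simp only [smul_add, Finset.sum_add_distrib, map_sum, map_smul, smul_smul]
  congr 1
  exact Finset.sum_congr rfl fun j _ => by rw [mul_comm]

/-- No nontrivial combination of bound states vanishes on a half line. -/
lemma IsBoundStates.eq_zero_of_halfline {N : ℕ} {W : ℝ → E →L[ℂ] E} {f f₁ : Fin N → ℝ → E}
    {e : Fin N → ℝ} (h : IsBoundStates W f f₁ e) {C : ℝ} (hW : ∀ x, ‖W x‖ ≤ C) {a : ℝ}
    {v : Fin N → ℂ} (hv : ∀ x, a < x → ∑ j, v j • f j x = 0) : v = 0 := by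
  let U : Submodule ℂ (Fin N → ℂ) :=
    { carrier := {v | ∀ x, a < x → ∑ j, v j • f j x = 0}
      add_mem' := fun {v w} hv hw x hx => by
        simp only [Pi.add_apply, add_smul, Finset.sum_add_distrib, hv x hx, hw x hx, add_zero]
      zero_mem' := fun x _ => by simp
      smul_mem' := fun c v hv x hx => by
        simp only [Pi.smul_apply, smul_eq_mul, mul_smul, ← Finset.smul_sum, hv x hx, smul_zero] }
  let D : (Fin N → ℂ) →ₗ[ℂ] (Fin N → ℂ) := (Matrix.diagonal fun j => (e j : ℂ)).mulVecLin
  have hD : ∀ v j, D v j = (e j : ℂ) * v j := fun v j => by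
    simp [D, Matrix.mulVec_diagonal]
  have hder : ∀ {w : ℝ → E} {w' : E} {x : ℝ}, (∀ y, a < y → w y = 0) → a < x →
      HasDerivAt w w' x → w' = 0 := by
    intro w w' x hw hx hd
    have h0 : HasDerivAt w 0 x := by
      refine (hasDerivAt_const x (0 : E)).congr_of_eventuallyEq ?_
      filter_upwards [Ioi_mem_nhds hx] with y hy
      exact hw y hy
    exact hd.unique h0
  have hU₁ : ∀ v ∈ U, ∀ x, a < x → ∑ j, v j • f₁ j x = 0 := fun v hv x hx =>
    hder hv hx (h.hasDerivAt_sum v x)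
  have hUD : ∀ v ∈ U, D v ∈ U := fun v hv x hx => by
    have := hder (hU₁ v hv) hx (h.hasDerivAt_sum₁ v x)
    rw [hv x hx, map_zero, zero_add] at this
    simp only [hD]
    exact this
  by_contra hne
  have : Nontrivial U := ⟨⟨⟨v, hv⟩, 0, fun h0 => hne (congrArg Subtype.val h0)⟩⟩
  obtain ⟨μ, hμ⟩ := Module.End.exists_eigenvalue (D.restrict hUD)
  obtain ⟨⟨w, hw⟩, hw'⟩ := hμ.exists_hasEigenvector
  have hw0 : w ≠ 0 := fun h0 => hw'.2 (Subtype.ext h0)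
  have hwe : ∀ j, (e j : ℂ) * w j = μ * w j := fun j => by
    have := congrArg (fun z : U => (z : Fin N → ℂ) j) hw'.apply_eq_smul
    simpa [hD] using this
  have hz : ∀ x, ∑ j, w j • f j x = 0 := by
    intro x
    by_cases hx : a < x
    · exact hw x hx
    refine eq_zero_of_second_order (u₁ := fun x => ∑ j, w j • f₁ j x)
      (Q := fun x => W x + μ • ContinuousLinearMap.id ℂ E) (C := C + ‖μ‖) (fun y => ?_)
      (h.hasDerivAt_sum w) (fun y => ?_) (hw (a + 1) (by linarith)) (hU₁ w hw (a + 1)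
      (by linarith)) (by linarith : x ≤ a + 1)
    · refine (norm_add_le _ _).trans (add_le_add (hW y) ?_)
      rw [norm_smul]
      exact mul_le_of_le_one_right (norm_nonneg _) ContinuousLinearMap.norm_id_le
    · refine (h.hasDerivAt_sum₁ w y).congr_deriv ?_
      simp only [_root_.add_apply, _root_.smul_apply,
        ContinuousLinearMap.id_apply, hwe, mul_smul, Finset.smul_sum]
  refine hw0 (funext fun l => ?_)
  have h1 : ∫ x, ⟪f l x, ∑ j, w j • f j x⟫_ℂ = w l := by
    simp only [inner_sum, inner_smul_right]
    rw [integral_finsetSum _ fun j _ =>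
      ((h.isH1 l).memLp.integrable_inner₂ (h.isH1 j).memLp).const_mul _]
    simp only [integral_const_mul, h.orthonormal, mul_ite, mul_one, mul_zero,
      Finset.sum_ite_eq, Finset.mem_univ, if_true]
  simp only [hz, inner_zero_right, integral_zero] at h1
  exact h1.symm

end BoundStates

section MatrixCalculus

open Filter Topology Set
open scoped InnerProductSpace ComplexConjugate ENNReal

variable {m n p : Type*}

/-- The real part of the trace. -/
noncomputable def rtr [Fintype n] (M : Matrix n n ℂ) : ℝ := M.trace.re

lemma rtr_add [Fintype n] (M M' : Matrix n n ℂ) : rtr (M + M') = rtr M + rtr M' := by simp [rtr]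

lemma rtr_sub [Fintype n] (M M' : Matrix n n ℂ) : rtr (M - M') = rtr M - rtr M' := by simp [rtr]

lemma rtr_neg [Fintype n] (M : Matrix n n ℂ) : rtr (-M) = -rtr M := by simp [rtr]

lemma rtr_smul [Fintype n] (c : ℝ) (M : Matrix n n ℂ) : rtr (c • M) = c * rtr M := by simp [rtr]

lemma rtr_mul_comm [Fintype m] [Fintype n] (M : Matrix n m ℂ) (M' : Matrix m n ℂ) :
    rtr (M * M') = rtr (M' * M) := by
  rw [rtr, rtr, Matrix.trace_mul_comm]

lemma rtr_conjTranspose [Fintype n] (M : Matrix n n ℂ) : rtr Mᴴ = rtr M := by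
  simp [rtr, Matrix.trace_conjTranspose]

lemma rtr_one [Fintype n] [DecidableEq n] : rtr (1 : Matrix n n ℂ) = Fintype.card n := by simp [rtr]

/-- The completed square for the energy of `c + Ψ D`, up to the total derivative. -/
lemma energy_identity [Fintype m] [Fintype n] [DecidableEq m] {Ψ Ψ₁ : Matrix m n ℂ}
    {D P Q : Matrix n m ℂ} {G S : Matrix n n ℂ} {W : Matrix m m ℂ} (c d : ℝ)
    (hG : Gᴴ = G) (hS : Sᴴ = S) (hW : Wᴴ = W)
    (hGP : G * P = Ψᴴ) (hGQ : G * Q = Ψ₁ᴴ + Ψᴴ * (Ψ * P))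
    (hWr : Ψ₁ᴴ * Ψ - Ψᴴ * Ψ₁ = G * S - S * G) :
    rtr ((d • (1 : Matrix m m ℂ) - c • (Ψ * P) + Ψ₁ * D)ᴴ * (d • 1 - c • (Ψ * P) + Ψ₁ * D)) +
      rtr ((c • (1 : Matrix m m ℂ) + Ψ * D)ᴴ * (W * (c • 1 + Ψ * D))) =
    Fintype.card m * d ^ 2 + c ^ 2 * rtr W - 4 * c * d * rtr (Ψ * P) +
    (rtr ((-(c • P))ᴴ * (Ψᴴ * (Ψ₁ * D)) +
        Dᴴ * (Ψ₁ᴴ * (Ψ₁ * D) + Ψᴴ * ((W * Ψ + Ψ * S) * D + Ψ₁ * (-(c • P))))) +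
      2 * (d * rtr (Ψ₁ * D) + c * rtr ((W * Ψ + Ψ * S) * D + Ψ₁ * (-(c • P)))) +
      rtr ((-(c • P))ᴴ * (G * (S * D)) + Dᴴ * (-(Ψᴴ * Ψ) * (S * D) + G * (S * (-(c • P))))) +
      (2 * c * d * rtr (Ψ * P) + c ^ 2 * rtr (Ψ₁ * P + Ψ * Q))) := by
  have hPG : Pᴴ * G = Ψ := by
    have := congrArg conjTranspose hGP
    rwa [conjTranspose_mul, hG, conjTranspose_conjTranspose] at this
  have e1 : rtr (Pᴴ * Ψᴴ) = rtr (Ψ * P) := by rw [← conjTranspose_mul, rtr_conjTranspose]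
  have e2 : rtr (Dᴴ * Ψ₁ᴴ) = rtr (Ψ₁ * D) := by rw [← conjTranspose_mul, rtr_conjTranspose]
  have e3 : rtr (Dᴴ * (Ψᴴ * W)) = rtr (W * (Ψ * D)) := by
    rw [← rtr_conjTranspose (W * (Ψ * D))]
    simp only [conjTranspose_mul, hW, Matrix.mul_assoc]
  have e4 : rtr (Pᴴ * (G * (S * D))) = rtr (Ψ * (S * D)) := by rw [← Matrix.mul_assoc, hPG]
  have e5 : rtr (Ψ * Q) = rtr (Ψ₁ * P) + rtr (Pᴴ * (Ψᴴ * (Ψ * P))) := by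
    nth_rw 1 [← hPG]
    rw [Matrix.mul_assoc, hGQ, Matrix.mul_add, rtr_add, ← conjTranspose_mul, rtr_conjTranspose]
  have e6 : rtr (Dᴴ * (Ψ₁ᴴ * (Ψ * P))) - rtr (Dᴴ * (Ψᴴ * (Ψ₁ * P))) =
      rtr (Dᴴ * (G * (S * P))) - rtr (Ψ * (S * D)) := by
    have h1 : rtr (Dᴴ * ((Ψ₁ᴴ * Ψ - Ψᴴ * Ψ₁) * P)) = rtr (Dᴴ * ((G * S - S * G) * P)) := by
      rw [hWr]
    have h2 : rtr (Dᴴ * (S * Ψᴴ)) = rtr (Ψ * (S * D)) := by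
      rw [← rtr_conjTranspose (Ψ * (S * D))]
      simp only [conjTranspose_mul, hS, Matrix.mul_assoc]
    simp only [Matrix.sub_mul, Matrix.mul_sub, rtr_sub, Matrix.mul_assoc, hGP, h2] at h1
    exact h1
  have e7 : rtr (Pᴴ * (Ψᴴ * (Ψ₁ * D))) = rtr (Dᴴ * (Ψ₁ᴴ * (Ψ * P))) := by
    rw [← rtr_conjTranspose]
    simp only [conjTranspose_mul, conjTranspose_conjTranspose, Matrix.mul_assoc]
  simp only [conjTranspose_add, conjTranspose_sub, conjTranspose_neg, conjTranspose_smul,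
    conjTranspose_one, conjTranspose_mul, star_trivial, Matrix.add_mul, Matrix.mul_add,
    Matrix.sub_mul, Matrix.mul_sub, Matrix.neg_mul, Matrix.mul_neg, Matrix.smul_mul,
    Matrix.mul_smul, Matrix.one_mul, Matrix.mul_one, Matrix.mul_assoc, rtr_add, rtr_sub, rtr_neg,
    rtr_smul, rtr_one, e1, e2, e3, e4, e5, e7]
  linear_combination (-c) * e6

/-- Entrywise differentiability of a matrix valued function. -/
def MatDeriv (F : ℝ → Matrix m n ℂ) (F' : Matrix m n ℂ) (x : ℝ) : Prop :=
  ∀ i j, HasDerivAt (fun y => F y i j) (F' i j) x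

lemma MatDeriv.mul [Fintype n] {F : ℝ → Matrix m n ℂ} {F' : Matrix m n ℂ} {K : ℝ → Matrix n p ℂ}
    {K' : Matrix n p ℂ} {x : ℝ} (hF : MatDeriv F F' x) (hK : MatDeriv K K' x) :
    MatDeriv (fun y => F y * K y) (F' * K x + F x * K') x := fun i j => by
  simp only [Matrix.mul_apply, Matrix.add_apply, ← Finset.sum_add_distrib]
  exact HasDerivAt.fun_sum fun k _ => (hF i k).mul (hK k j)

lemma MatDeriv.add {F K : ℝ → Matrix m n ℂ} {F' K' : Matrix m n ℂ} {x : ℝ}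
    (hF : MatDeriv F F' x) (hK : MatDeriv K K' x) :
    MatDeriv (fun y => F y + K y) (F' + K') x := fun i j => (hF i j).add (hK i j)

lemma MatDeriv.sub {F K : ℝ → Matrix m n ℂ} {F' K' : Matrix m n ℂ} {x : ℝ}
    (hF : MatDeriv F F' x) (hK : MatDeriv K K' x) :
    MatDeriv (fun y => F y - K y) (F' - K') x := fun i j => (hF i j).sub (hK i j)

lemma MatDeriv.smul {c : ℝ → ℝ} {c' : ℝ} {F : ℝ → Matrix m n ℂ} {F' : Matrix m n ℂ} {x : ℝ}
    (hc : HasDerivAt c c' x) (hF : MatDeriv F F' x) :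
    MatDeriv (fun y => c y • F y) (c' • F x + c x • F') x := fun i j => by
  refine (hc.smul (hF i j)).congr_deriv ?_
  simp only [Matrix.add_apply, Matrix.smul_apply]
  rw [add_comm]

lemma MatDeriv.conjTranspose {F : ℝ → Matrix m n ℂ} {F' : Matrix m n ℂ} {x : ℝ}
    (hF : MatDeriv F F' x) : MatDeriv (fun y => (F y)ᴴ) F'ᴴ x := fun i j => (hF j i).star

lemma matDeriv_const (M : Matrix m n ℂ) (x : ℝ) : MatDeriv (fun _ => M) 0 x := fun i j =>
  hasDerivAt_const x (M i j)

lemma MatDeriv.congr_deriv {F : ℝ → Matrix m n ℂ} {F' F'' : Matrix m n ℂ} {x : ℝ}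
    (hF : MatDeriv F F' x) (h : F' = F'') : MatDeriv F F'' x := h ▸ hF

lemma MatDeriv.rtr [Fintype n] {F : ℝ → Matrix n n ℂ} {F' : Matrix n n ℂ} {x : ℝ}
    (hF : MatDeriv F F' x) :
    HasDerivAt (fun y => rtr (F y)) (rtr F') x := by
  have h : HasDerivAt (fun y => (F y).trace) F'.trace x := HasDerivAt.fun_sum fun i _ => hF i i
  have := (Complex.reCLM.hasFDerivAt.comp x h.hasFDerivAt).hasDerivAt
  refine this.congr_deriv ?_
  simp [_root_.rtr]

lemma MatDeriv.continuousAt {F : ℝ → Matrix m n ℂ} {F' : Matrix m n ℂ} {x : ℝ}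
    (hF : MatDeriv F F' x) : ContinuousAt F x :=
  continuousAt_pi.2 fun i => continuousAt_pi.2 fun j => (hF i j).continuousAt

lemma MatDeriv.inv [Fintype n] [DecidableEq n] {F : ℝ → Matrix n n ℂ} {F' : Matrix n n ℂ} {x : ℝ}
    (hF : MatDeriv F F' x) (hu : ∀ y, IsUnit (F y).det) :
    MatDeriv (fun y => (F y)⁻¹) (-((F x)⁻¹ * F' * (F x)⁻¹)) x := by
  have hdet : ∀ {A : ℝ → Matrix n n ℂ}, (∀ i j, DifferentiableAt ℝ (fun y => A y i j) x) →
      DifferentiableAt ℝ (fun y => (A y).det) x := fun {A} hA => by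
    simp only [Matrix.det_apply]
    refine DifferentiableAt.fun_sum fun σ _ => DifferentiableAt.const_smul ?_ _
    exact DifferentiableAt.fun_finsetProd fun i _ => hA _ _
  have hFd : ∀ i j, DifferentiableAt ℝ (fun y => F y i j) x := fun i j =>
    (hF i j).differentiableAt
  have hd : ∀ i j, DifferentiableAt ℝ (fun y => (F y)⁻¹ i j) x := fun i j => by
    simp only [Matrix.inv_def, Matrix.smul_apply, Ring.inverse_eq_inv', smul_eq_mul,
      Matrix.adjugate_apply]
    refine ((hdet hFd).inv (hu x).ne_zero).mul (hdet fun k l => ?_)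
    by_cases hk : k = j
    · subst hk
      simp only [Matrix.updateRow_self]
      exact differentiableAt_const _
    · simp only [Matrix.updateRow_ne hk]
      exact hFd k l
  set R : Matrix n n ℂ := Matrix.of fun i j => deriv (fun y => (F y)⁻¹ i j) x
  have hR : MatDeriv (fun y => (F y)⁻¹) R x := fun i j => (hd i j).hasDerivAt
  have h1 := hF.mul hR
  have h2 : (fun y => F y * (F y)⁻¹) = fun _ => 1 := funext fun y => Matrix.mul_nonsing_inv _ (hu y)
  rw [h2] at h1
  have h3 : F' * (F x)⁻¹ + F x * R = 0 := by
    ext i j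
    exact (h1 i j).unique (matDeriv_const 1 x i j)
  refine hR.congr_deriv ?_
  have h4 : (F x)⁻¹ * (F x * R) = R := by
    rw [← Matrix.mul_assoc, Matrix.nonsing_inv_mul _ (hu x), Matrix.one_mul]
  rw [← h4, eq_neg_of_add_eq_zero_right h3, Matrix.mul_neg, Matrix.mul_assoc]

end MatrixCalculus

section Cutoff

open Filter Topology Set

/-- A smooth decreasing step: `1` on `(-∞, 1]` and `0` on `[2, ∞)`. -/
noncomputable def downStep (x : ℝ) : ℝ := Real.smoothTransition (2 - x)

lemma contDiff_downStep : ContDiff ℝ 1 downStep :=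
  Real.smoothTransition.contDiff.comp (contDiff_const.sub contDiff_id)

lemma hasDerivAt_downStep (x : ℝ) : HasDerivAt downStep (deriv downStep x) x :=
  (contDiff_downStep.differentiable one_ne_zero x).hasDerivAt

lemma continuous_deriv_downStep : Continuous (deriv downStep) :=
  contDiff_downStep.continuous_deriv le_rfl

lemma downStep_nonneg (x : ℝ) : 0 ≤ downStep x := Real.smoothTransition.nonneg _

lemma downStep_le_one (x : ℝ) : downStep x ≤ 1 := Real.smoothTransition.le_one _

lemma downStep_eq_one {x : ℝ} (hx : x ≤ 1) : downStep x = 1 :=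
  Real.smoothTransition.one_of_one_le (by linarith)

lemma downStep_eq_zero {x : ℝ} (hx : 2 ≤ x) : downStep x = 0 :=
  Real.smoothTransition.zero_of_nonpos (by linarith)

lemma deriv_downStep_nonpos (x : ℝ) : deriv downStep x ≤ 0 := by
  have : Antitone downStep := fun x y hxy => Real.smoothTransition.monotone (by linarith)
  exact this.deriv_nonpos

lemma deriv_downStep_of_le {x : ℝ} (hx : x ≤ 1) : deriv downStep x = 0 :=
  IsLocalMax.deriv_eq_zero (Filter.Eventually.of_forall fun y => by
    rw [downStep_eq_one hx]; exact downStep_le_one y)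

lemma deriv_downStep_of_ge {x : ℝ} (hx : 2 ≤ x) : deriv downStep x = 0 :=
  IsLocalMin.deriv_eq_zero (Filter.Eventually.of_forall fun y => by
    rw [downStep_eq_zero hx]; exact downStep_nonneg y)

lemma exists_abs_deriv_downStep_le : ∃ M, 0 ≤ M ∧ ∀ x, |deriv downStep x| ≤ M := by
  obtain ⟨M, hM⟩ := (isCompact_Icc (a := (1 : ℝ)) (b := 2)).exists_bound_of_continuousOn
    continuous_deriv_downStep.continuousOn
  refine ⟨M, (norm_nonneg _).trans (hM 1 (by norm_num)), fun x => ?_⟩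
  have hM0 : 0 ≤ M := (norm_nonneg _).trans (hM 1 (by norm_num))
  rcases le_total x 1 with h | h
  · rwa [deriv_downStep_of_le h, abs_zero]
  rcases le_total 2 x with h' | h'
  · rwa [deriv_downStep_of_ge h', abs_zero]
  · exact hM x ⟨h, h'⟩

/-- A symmetric cutoff `c` at scale `T`, together with its right half `s`. -/
structure IsCutoff (T M : ℝ) (c c' s s' : ℝ → ℝ) : Prop where
  deriv : ∀ x, HasDerivAt c (c' x) x
  deriv_right : ∀ x, HasDerivAt s (s' x) x
  cont : Continuous c'
  cont_right : Continuous s'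
  eq_zero : ∀ x, 2 * T ≤ |x| → c x = 0
  deriv_eq_zero : ∀ x, 2 * T ≤ |x| → c' x = 0
  eq_one : ∀ x, |x| ≤ T → c x = 1
  nonneg : ∀ x, 0 ≤ c x
  deriv_nonneg : ∀ x, x ≤ T → 0 ≤ c' x
  right_eq_one : ∀ x, x ≤ T → s x = 1
  right_eq_zero : ∀ x, 2 * T ≤ x → s x = 0
  deriv_right_of_le : ∀ x, x ≤ T → s' x = 0
  deriv_right_of_ge : ∀ x, 2 * T ≤ x → s' x = 0
  right_eq : ∀ x, T ≤ x → s x = c x ∧ s' x = c' x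
  abs_deriv_le : ∀ x, |c' x| ≤ M / T

lemma exists_isCutoff : ∃ M, 0 ≤ M ∧ ∀ T, 0 < T → ∃ c c' s s' : ℝ → ℝ, IsCutoff T M c c' s s' := by
  obtain ⟨M, hM0, hM⟩ := exists_abs_deriv_downStep_le
  refine ⟨2 * M, by positivity, fun T hT => ?_⟩
  have h1 : ∀ x, HasDerivAt (fun x => downStep (x / T)) (deriv downStep (x / T) * (1 / T)) x :=
    fun x => HasDerivAt.comp (h₂ := downStep) (h := fun x => x / T) x
      (hasDerivAt_downStep (x / T)) ((hasDerivAt_id x).div_const T)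
  have h2 : ∀ x, HasDerivAt (fun x => downStep (-x / T)) (deriv downStep (-x / T) * (-1 / T)) x :=
    fun x => HasDerivAt.comp (h₂ := downStep) (h := fun x => -x / T) x
      (hasDerivAt_downStep (-x / T)) ((hasDerivAt_neg x).div_const T)
  have hdc := continuous_deriv_downStep
  have hsc := contDiff_downStep.continuous
  have hle : ∀ x, x ≤ T → x / T ≤ 1 := fun x hx => (div_le_one hT).2 hx
  have hge : ∀ x, 2 * T ≤ x → 2 ≤ x / T := fun x hx => (le_div_iff₀ hT).2 hx
  refine ⟨fun x => downStep (x / T) * downStep (-x / T), fun x => deriv downStep (x / T) * (1 / T) *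
    downStep (-x / T) + downStep (x / T) * (deriv downStep (-x / T) * (-1 / T)),
    fun x => downStep (x / T), fun x => deriv downStep (x / T) * (1 / T),
    ⟨fun x => (h1 x).mul (h2 x), h1, by fun_prop, by fun_prop, fun x hx => ?_, fun x hx => ?_,
      fun x hx => ?_, fun x => mul_nonneg (downStep_nonneg _) (downStep_nonneg _), fun x hx => ?_,
      fun x hx => downStep_eq_one (hle x hx), fun x hx => downStep_eq_zero (hge x hx),
      fun x hx => by simp [deriv_downStep_of_le (hle x hx)],
      fun x hx => by simp [deriv_downStep_of_ge (hge x hx)], fun x hx => ?_, fun x => ?_⟩⟩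
  · rcases le_abs.1 hx with h | h
    · simp [downStep_eq_zero (hge _ h)]
    · simp [downStep_eq_zero (hge _ h)]
  · rcases le_abs.1 hx with h | h
    · simp [downStep_eq_zero (hge _ h), deriv_downStep_of_ge (hge _ h)]
    · simp [downStep_eq_zero (hge _ h), deriv_downStep_of_ge (hge _ h)]
  · have := abs_le.1 hx
    simp [downStep_eq_one (hle x this.2), downStep_eq_one (hle (-x) (by linarith))]
  · simp only [deriv_downStep_of_le (hle x hx), zero_mul, zero_add]
    refine mul_nonneg (downStep_nonneg _) (mul_nonneg_of_nonpos_of_nonpos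
      (deriv_downStep_nonpos _) ?_)
    exact div_nonpos_of_nonpos_of_nonneg (by norm_num) hT.le
  · have h := hle (-x) (by linarith)
    simp [downStep_eq_one h, deriv_downStep_of_le h]
  · have hb : ∀ a b u : ℝ, |a| ≤ M → 0 ≤ b → b ≤ 1 → |u| = 1 / T → |a * u * b| ≤ M / T := by
      intro a b u ha hb hb' hu
      rw [abs_mul, abs_mul, hu, abs_of_nonneg hb]
      calc |a| * (1 / T) * b ≤ M * (1 / T) * 1 := by gcongr
        _ = M / T := by ring
    refine (abs_add_le _ _).trans ?_
    have e1 := hb _ _ (1 / T) (hM (x / T)) (downStep_nonneg (-x / T)) (downStep_le_one _)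
      (abs_of_pos (by positivity))
    have e2 := hb _ _ (-1 / T) (hM (-x / T)) (downStep_nonneg (x / T)) (downStep_le_one _)
      (by rw [neg_div, abs_neg, abs_of_pos (by positivity)])
    rw [mul_comm] at e2
    calc _ ≤ M / T + M / T := add_le_add e1 e2
      _ = 2 * M / T := by ring

lemma IsCutoff.continuous {T M : ℝ} {c c' s s' : ℝ → ℝ} (h : IsCutoff T M c c' s s') :
    Continuous c := continuous_iff_continuousAt.2 fun x => (h.deriv x).continuousAt

/-- A continuous function vanishing for `|x| ≥ R` has compact support. -/
lemma hasCompactSupport_of_eq_zero {F : Type*} [Zero F] [TopologicalSpace F] {u : ℝ → F}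
    {R : ℝ} (hu : ∀ x, R ≤ |x| → u x = 0) : HasCompactSupport u :=
  HasCompactSupport.intro (isCompact_Icc (a := -R) (b := R)) fun x hx => hu x <| by
    by_contra! h
    exact hx (abs_le.1 h.le)

lemma integrable_of_eq_zero {F : Type*} [NormedAddCommGroup F] {u : ℝ → F} (hc : Continuous u)
    {R : ℝ} (hu : ∀ x, R ≤ |x| → u x = 0) : Integrable u :=
  hc.integrable_of_hasCompactSupport (hasCompactSupport_of_eq_zero hu)

lemma IsCutoff.integral_sq_le {T M : ℝ} (hT : 0 < T) {c c' s s' : ℝ → ℝ}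
    (h : IsCutoff T M c c' s s') : ∫ x, c' x ^ 2 ≤ 4 * M ^ 2 / T := by
  have h0 : ∀ x, x ∉ Icc (-(2 * T)) (2 * T) → c' x ^ 2 = 0 := fun x hx => by
    rw [h.deriv_eq_zero x (by by_contra! h; exact hx (abs_le.1 h.le))]
    norm_num
  rw [← setIntegral_eq_integral_of_forall_compl_eq_zero h0]
  calc ∫ x in Icc (-(2 * T)) (2 * T), c' x ^ 2
      ≤ ∫ x in Icc (-(2 * T)) (2 * T), (M / T) ^ 2 := by
        refine setIntegral_mono_on ?_ ?_ measurableSet_Icc fun x _ => ?_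
        · exact (h.cont.pow 2).continuousOn.integrableOn_compact isCompact_Icc
        · exact continuousOn_const.integrableOn_compact isCompact_Icc
        · rw [← sq_abs]
          exact pow_le_pow_left₀ (abs_nonneg _) (h.abs_deriv_le x) 2
    _ = 4 * M ^ 2 / T := by
        rw [setIntegral_const, smul_eq_mul, Real.volume_real_Icc_of_le (by linarith)]
        field_simp
        ring

end Cutoff

section MatrixStates

open Filter Topology Set
open scoped InnerProductSpace ComplexConjugate ENNReal

lemma setIntegral_Ioi_eq_sub {F : Type*} [NormedAddCommGroup F] [NormedSpace ℝ F] {u : ℝ → F}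
    (hu : Integrable u) (x : ℝ) :
    ∫ y in Ioi x, u y = (∫ y in Ioi (0 : ℝ), u y) - ∫ y in (0 : ℝ)..x, u y := by
  rw [← intervalIntegral.integral_interval_add_Ioi (a := 0) (b := x) hu.integrableOn
    hu.integrableOn]
  abel

lemma hasDerivAt_setIntegral_Ioi {F : Type*} [NormedAddCommGroup F] [NormedSpace ℝ F]
    [CompleteSpace F] {u : ℝ → F} (hu : Integrable u) (hc : Continuous u) (x : ℝ) :
    HasDerivAt (fun x => ∫ y in Ioi x, u y) (-u x) x := by
  rw [funext (setIntegral_Ioi_eq_sub hu)]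
  refine ((hasDerivAt_const x _).sub (intervalIntegral.integral_hasDerivAt_right
    hu.intervalIntegrable (hc.stronglyMeasurableAtFilter _ _) hc.continuousAt)).congr_deriv ?_
  simp

lemma tendsto_setIntegral_Ioi_zero {F : Type*} [NormedAddCommGroup F] [NormedSpace ℝ F]
    {u : ℝ → F} (hu : Integrable u) :
    Tendsto (fun x => ∫ y in Ioi x, u y) atTop (𝓝 0) := by
  rw [funext (setIntegral_Ioi_eq_sub hu)]
  simpa using (tendsto_const_nhds (x := ∫ y in Ioi (0 : ℝ), u y)).sub
    (intervalIntegral_tendsto_integral_Ioi (0 : ℝ) hu.integrableOn tendsto_id)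

lemma IsH1.tendsto_zero {E : Type*} [NormedAddCommGroup E] [InnerProductSpace ℂ E]
    {f f₁ : ℝ → E} (h : IsH1 f f₁) : Tendsto f atTop (𝓝 0) := by
  have h1 : Tendsto (fun y => ‖f y‖ ^ 2) atTop (𝓝 0) :=
    tendsto_zero_of_hasDerivAt_of_integrableOn_Ioi (a := 0)
      (fun y _ => hasDerivAt_norm_sq_complex (h.hasDerivAt y))
      (((h.memLp.integrable_inner₂ h.memLp_deriv).re.const_mul 2).integrableOn)
      h.memLp.integrable_norm_sq.integrableOn
  rw [tendsto_zero_iff_norm_tendsto_zero]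
  simpa using h1.sqrt

lemma matDeriv_zero_eq_zero {m n : Type*} {M : ℝ → Matrix m n ℂ} {a : ℝ}
    (hM : ∀ x, a ≤ x → MatDeriv M 0 x) (ht : Tendsto M atTop (𝓝 0)) {x : ℝ} (hx : a ≤ x) :
    M x = 0 := by
  have h1 : ∀ y, x ≤ y → M y = M x := fun y hy => by
    ext i j
    exact constant_of_has_deriv_right_zero
      (fun z hz => (hM z (hx.trans hz.1) i j).continuousAt.continuousWithinAt)
      (fun z hz => (hM z (hx.trans hz.1) i j).hasDerivWithinAt) y ⟨hy, le_rfl⟩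
  refine tendsto_nhds_unique (tendsto_const_nhds (f := atTop (α := ℝ))) (ht.congr' ?_)
  filter_upwards [eventually_ge_atTop x] with y hy using h1 y hy

lemma continuous_toEuclideanCLM {n : Type*} [Fintype n] [DecidableEq n] :
    Continuous (toEuclideanCLM (n := n) (𝕜 := ℂ)) :=
  LinearMap.continuous_of_finiteDimensional
    (toEuclideanCLM (n := n) (𝕜 := ℂ)).toAlgEquiv.toLinearMap

variable {m n p : Type*}

lemma Filter.Tendsto.matrix_mul [Fintype n] {F : ℝ → Matrix m n ℂ} {K : ℝ → Matrix n p ℂ}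
    {A : Matrix m n ℂ} {B : Matrix n p ℂ} {l : Filter ℝ} (hF : Tendsto F l (𝓝 A))
    (hK : Tendsto K l (𝓝 B)) : Tendsto (fun x => F x * K x) l (𝓝 (A * B)) :=
  tendsto_pi_nhds.2 fun i => tendsto_pi_nhds.2 fun j => by
    simp only [Matrix.mul_apply]
    exact tendsto_finsetSum _ fun k _ => (tendsto_pi_nhds.1 (tendsto_pi_nhds.1 hF i) k).mul
      (tendsto_pi_nhds.1 (tendsto_pi_nhds.1 hK k) j)

lemma Filter.Tendsto.rtr [Fintype n] {F : ℝ → Matrix n n ℂ} {A : Matrix n n ℂ} {l : Filter ℝ}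
    (hF : Tendsto F l (𝓝 A)) : Tendsto (fun x => rtr (F x)) l (𝓝 (rtr A)) :=
  ((Complex.continuous_re.comp (continuous_id.matrix_trace)).tendsto A).comp hF

lemma rtr_zero [Fintype n] : rtr (0 : Matrix n n ℂ) = 0 := by simp [rtr]

lemma Filter.Tendsto.conjTranspose_zero {F : ℝ → Matrix m n ℂ} {l : Filter ℝ}
    (hF : Tendsto F l (𝓝 0)) : Tendsto (fun x => (F x)ᴴ) l (𝓝 0) :=
  tendsto_pi_nhds.2 fun i => tendsto_pi_nhds.2 fun j => by
    simpa using (tendsto_pi_nhds.1 (tendsto_pi_nhds.1 hF j) i).star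

/-- The matrix of bound states together with its Gram matrix on the half lines `(x, ∞)`. -/
structure IsMatrixStates {n N : ℕ} (W : ℝ → Matrix (Fin n) (Fin n) ℂ)
    (Ψ Ψ₁ : ℝ → Matrix (Fin n) (Fin N) ℂ) (G : ℝ → Matrix (Fin N) (Fin N) ℂ) (e : Fin N → ℝ)
    (L : ℝ) : Prop where
  deriv : ∀ x, MatDeriv Ψ (Ψ₁ x) x
  deriv₁ : ∀ x, MatDeriv Ψ₁ (W x * Ψ x + Ψ x * diagonal fun j => (e j : ℂ)) x
  derivG : ∀ x, MatDeriv G (-((Ψ x)ᴴ * Ψ x)) x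
  posDef : ∀ x, (G x).PosDef
  tendsto : Tendsto Ψ atTop (𝓝 0)
  tendsto₁ : Tendsto Ψ₁ atTop (𝓝 0)
  tendstoG : Tendsto G atTop (𝓝 0)
  wronskian : ∀ x, (Ψ₁ x)ᴴ * Ψ x - (Ψ x)ᴴ * Ψ₁ x =
    G x * (diagonal fun j => (e j : ℂ)) - (diagonal fun j => (e j : ℂ)) * G x
  gram : ∀ x, L ≤ x → (Ψ x)ᴴ * Ψ x =
    (diagonal fun j => ((√(e j) : ℝ) : ℂ)) * G x + G x * diagonal fun j => ((√(e j) : ℝ) : ℂ)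

lemma IsBoundStates.isMatrixStates {n N : ℕ} {W : ℝ → Matrix (Fin n) (Fin n) ℂ}
    {f f₁ : Fin N → ℝ → EuclideanSpace ℂ (Fin n)} {e : Fin N → ℝ} {L : ℝ}
    (h : IsBoundStates (fun x => toEuclideanCLM (𝕜 := ℂ) (W x)) f f₁ e)
    (hWc : Continuous W) (hW : ∀ x, (W x).IsHermitian) (hL : ∀ x, L ≤ |x| → W x = 0) :
    IsMatrixStates W (fun x => Matrix.of fun i j => f j x i)
      (fun x => Matrix.of fun i j => f₁ j x i)
      (fun x => Matrix.of fun j l => ∫ y in Ioi x, ⟪f j y, f l y⟫_ℂ) e L := by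
  set Ψ : ℝ → Matrix (Fin n) (Fin N) ℂ := fun x => Matrix.of fun i j => f j x i with hΨ
  set Ψ₁ : ℝ → Matrix (Fin n) (Fin N) ℂ := fun x => Matrix.of fun i j => f₁ j x i with hΨ₁
  set G : ℝ → Matrix (Fin N) (Fin N) ℂ :=
    fun x => Matrix.of fun j l => ∫ y in Ioi x, ⟪f j y, f l y⟫_ℂ with hG
  set S : Matrix (Fin N) (Fin N) ℂ := diagonal fun j => (e j : ℂ) with hS
  set K : Matrix (Fin N) (Fin N) ℂ := diagonal fun j => ((√(e j) : ℝ) : ℂ) with hK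
  have hSH : Sᴴ = S := by
    rw [hS, diagonal_conjTranspose]; congr 1; funext j; simp
  have hKH : Kᴴ = K := by
    rw [hK, diagonal_conjTranspose]; congr 1; funext j; simp
  have hcoord : ∀ {u : ℝ → EuclideanSpace ℂ (Fin n)} {u' : EuclideanSpace ℂ (Fin n)} {x : ℝ}
      (_ : HasDerivAt u u' x) (i : Fin n), HasDerivAt (fun y => u y i) (u' i) x := by
    intro u u' x hu i
    have := (((EuclideanSpace.proj (𝕜 := ℂ) i).restrictScalars ℝ).hasFDerivAt.comp x
      hu.hasFDerivAt).hasDerivAt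
    refine this.congr_deriv ?_
    simp
  have dΨ : ∀ x, MatDeriv Ψ (Ψ₁ x) x := fun x i j => hcoord ((h.isH1 j).hasDerivAt x) i
  have dΨ₁ : ∀ x, MatDeriv Ψ₁ (W x * Ψ x + Ψ x * S) x := fun x i j => by
    refine (hcoord (h.deriv₁ j x) i).congr_deriv ?_
    simp only [hS, Matrix.add_apply, Matrix.mul_diagonal, PiLp.add_apply, PiLp.smul_apply,
      smul_eq_mul, hΨ, Matrix.of_apply, mul_comm (e j : ℂ)]
    rfl
  have hint : ∀ j l, Integrable fun y => ⟪f j y, f l y⟫_ℂ := fun j l =>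
    (h.isH1 j).memLp.integrable_inner₂ (h.isH1 l).memLp
  have hgram : ∀ x j l, ((Ψ x)ᴴ * Ψ x) j l = ⟪f j x, f l x⟫_ℂ := fun x j l => by
    simp only [Matrix.mul_apply, Matrix.conjTranspose_apply, hΨ, Matrix.of_apply,
      PiLp.inner_apply, RCLike.inner_apply]
    exact Finset.sum_congr rfl fun i _ => mul_comm _ _
  have dG : ∀ x, MatDeriv G (-((Ψ x)ᴴ * Ψ x)) x := fun x j l => by
    rw [Matrix.neg_apply, hgram]
    exact hasDerivAt_setIntegral_Ioi (hint j l)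
      ((h.isH1 j).continuous.inner (h.isH1 l).continuous) x
  have hGH : ∀ x, (G x)ᴴ = G x := fun x => by
    ext j l
    simp only [hG, Matrix.conjTranspose_apply, Matrix.of_apply]
    rw [Complex.star_def, ← integral_conj]
    simp only [inner_conj_symm]
  have hcomb : ∀ x (v : Fin N → ℂ), star v ⬝ᵥ G x *ᵥ v =
      ((∫ y in Ioi x, ‖∑ j, v j • f j y‖ ^ 2 : ℝ) : ℂ) := by
    intro x v
    have e1 : ∀ y, ((‖∑ j, v j • f j y‖ ^ 2 : ℝ) : ℂ) =
        ∑ j, ∑ l, (star (v j) * v l) * ⟪f j y, f l y⟫_ℂ := fun y => by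
      rw [Complex.ofReal_pow]
      refine (inner_self_eq_norm_sq_to_K (𝕜 := ℂ) (∑ j, v j • f j y)).symm.trans ?_
      simp only [sum_inner, inner_sum, inner_smul_left, inner_smul_right, Finset.mul_sum]
      rw [Finset.sum_comm]
      refine Finset.sum_congr rfl fun j _ => Finset.sum_congr rfl fun l _ => ?_
      rw [Complex.star_def]; ring
    rw [← integral_complex_ofReal]
    simp only [e1]
    rw [integral_finsetSum _ fun j _ => integrable_finsetSum _ fun l _ =>
      ((hint j l).const_mul _).integrableOn]
    simp only [dotProduct, Matrix.mulVec, Finset.mul_sum]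
    refine Finset.sum_congr rfl fun j _ => ?_
    rw [integral_finsetSum _ fun l _ => ((hint j l).const_mul _).integrableOn]
    refine Finset.sum_congr rfl fun l _ => ?_
    rw [integral_const_mul]
    simp only [hG, Matrix.of_apply, Pi.star_apply]
    ring
  obtain ⟨C, hC⟩ : ∃ C, ∀ x, ‖toEuclideanCLM (𝕜 := ℂ) (W x)‖ ≤ C := by
    exact (continuous_toEuclideanCLM.comp hWc).bounded_above_of_compact_support
      (hasCompactSupport_of_eq_zero (R := L) fun x hx => by simp [hL x hx])
  have hpos : ∀ x, (G x).PosDef := fun x => by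
    refine Matrix.PosDef.of_dotProduct_mulVec_pos (hGH x) fun v hv => ?_
    rw [hcomb]
    have hH : MemLp (fun y => ∑ j, v j • f j y) 2 :=
      memLp_finsetSum _ fun j _ => (h.isH1 j).memLp.const_smul (v j)
    have hcont : Continuous fun y => ∑ j, v j • f j y :=
      continuous_finsetSum _ fun j _ => (h.isH1 j).continuous.const_smul (v j)
    have h0 : 0 ≤ ∫ y in Ioi x, ‖∑ j, v j • f j y‖ ^ 2 := integral_nonneg fun y => by positivity
    refine Complex.zero_lt_real.2 (lt_of_le_of_ne h0 fun h1 => hv ?_)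
    refine h.eq_zero_of_halfline hC (a := x) fun y hy => ?_
    have h2 := (setIntegral_eq_zero_iff_of_nonneg_ae (Eventually.of_forall fun y => by positivity)
      hH.integrable_norm_sq.integrableOn).1 h1.symm
    have h3 := Measure.eqOn_open_of_ae_eq h2 isOpen_Ioi (hcont.norm.pow 2).continuousOn
      continuousOn_const hy
    simpa using h3
  have tG : Tendsto G atTop (𝓝 0) := tendsto_pi_nhds.2 fun j => tendsto_pi_nhds.2 fun l =>
    tendsto_setIntegral_Ioi_zero (hint j l)
  have hcoordt : ∀ {u : ℝ → EuclideanSpace ℂ (Fin n)} (_ : Tendsto u atTop (𝓝 0)) (i : Fin n),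
      Tendsto (fun y => u y i) atTop (𝓝 0) := fun hu i =>
    ((EuclideanSpace.proj (𝕜 := ℂ) i).continuous.tendsto' 0 0 (map_zero _)).comp hu
  have tΨ : Tendsto Ψ atTop (𝓝 0) := tendsto_pi_nhds.2 fun i => tendsto_pi_nhds.2 fun j =>
    hcoordt (h.isH1 j).tendsto_zero i
  have hout : ∀ j x, L ≤ x → f₁ j x = -((√(e j) : ℝ) : ℂ) • f j x := by
    intro j x hx
    have hk : 0 < √(e j) := Real.sqrt_pos.2 (h.pos j)
    have hsq : ((√(e j) : ℝ) : ℂ) * ((√(e j) : ℝ) : ℂ) = (e j : ℂ) := by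
      rw [← Complex.ofReal_mul, Real.mul_self_sqrt (h.pos j).le]
    have := eq_zero_of_hasDerivAt_smul_of_memLp (z := fun y => f₁ j y + ((√(e j) : ℝ) : ℂ) • f j y)
      hk (fun y hy => ?_)
      ((h.isH1 j).memLp_deriv.add ((h.isH1 j).memLp.const_smul ((√(e j) : ℝ) : ℂ))) hx
    · rw [neg_smul]; exact eq_neg_of_add_eq_zero_left this
    · refine ((h.deriv₁ j y).fun_add (((h.isH1 j).hasDerivAt y).fun_const_smul
        ((√(e j) : ℝ) : ℂ))).congr_deriv ?_
      rw [hL y (hy.trans (le_abs_self y)), map_zero, _root_.zero_apply, zero_add,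
        smul_add, smul_smul, hsq, add_comm]
  have hout' : ∀ x, L ≤ x → Ψ₁ x = -(Ψ x * K) := fun x hx => by
    ext i j
    simp only [hΨ₁, hΨ, hK, Matrix.of_apply, hout j x hx, Matrix.neg_apply, Matrix.mul_diagonal,
      PiLp.smul_apply, smul_eq_mul]
    ring
  have tΨ₁ : Tendsto Ψ₁ atTop (𝓝 0) := by
    have : Tendsto (fun x => -(Ψ x * K)) atTop (𝓝 0) := by
      simpa using (tΨ.matrix_mul (tendsto_const_nhds (x := K))).neg
    refine this.congr' ?_
    filter_upwards [eventually_ge_atTop L] with x hx using (hout' x hx).symm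
  refine ⟨dΨ, dΨ₁, dG, hpos, tΨ, tΨ₁, tG, fun x => ?_, fun x hx => ?_⟩
  · have hd : ∀ y, MatDeriv (fun x => (Ψ₁ x)ᴴ * Ψ x - (Ψ x)ᴴ * Ψ₁ x - (G x * S - S * G x)) 0 y :=
      fun y => by
        refine ((((dΨ₁ y).conjTranspose.mul (dΨ y)).sub ((dΨ y).conjTranspose.mul (dΨ₁ y))).sub
          (((dG y).mul (matDeriv_const S y)).sub ((matDeriv_const S y).mul (dG y)))).congr_deriv ?_
        simp only [conjTranspose_add, conjTranspose_mul, (hW y).eq, hSH, Matrix.add_mul,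
          Matrix.mul_add, Matrix.mul_assoc, Matrix.neg_mul, Matrix.mul_neg, Matrix.mul_zero,
          Matrix.zero_mul]
        abel
    have ht : Tendsto (fun x => (Ψ₁ x)ᴴ * Ψ x - (Ψ x)ᴴ * Ψ₁ x - (G x * S - S * G x)) atTop
        (𝓝 0) := by
      simpa using ((tΨ₁.conjTranspose_zero.matrix_mul tΨ).sub
        (tΨ.conjTranspose_zero.matrix_mul tΨ₁)).sub
        ((tG.matrix_mul (tendsto_const_nhds (x := S))).sub
          ((tendsto_const_nhds (x := S)).matrix_mul tG))
    exact sub_eq_zero.1 (matDeriv_zero_eq_zero (fun y _ => hd y) ht le_rfl)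
  · have hd : ∀ y, L ≤ y → MatDeriv (fun x => (Ψ x)ᴴ * Ψ x - (K * G x + G x * K)) 0 y :=
      fun y hy => by
        refine (((dΨ y).conjTranspose.mul (dΨ y)).sub
          (((matDeriv_const K y).mul (dG y)).add ((dG y).mul (matDeriv_const K y)))).congr_deriv ?_
        simp only [hout' y hy, conjTranspose_neg, conjTranspose_mul, hKH,
          Matrix.mul_assoc, Matrix.neg_mul, Matrix.mul_neg, Matrix.mul_zero,
          Matrix.zero_mul]
        abel
    have ht : Tendsto (fun x => (Ψ x)ᴴ * Ψ x - (K * G x + G x * K)) atTop (𝓝 0) := by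
      simpa using (tΨ.conjTranspose_zero.matrix_mul tΨ).sub
        (((tendsto_const_nhds (x := K)).matrix_mul tG).add
          (tG.matrix_mul (tendsto_const_nhds (x := K))))
    exact sub_eq_zero.1 (matDeriv_zero_eq_zero hd ht hx)

end MatrixStates

section SharpInequality

open Filter Topology Set
open scoped InnerProductSpace ComplexConjugate ENNReal

variable {n N : ℕ} {W : ℝ → Matrix (Fin n) (Fin n) ℂ}
  {Ψ Ψ₁ : ℝ → Matrix (Fin n) (Fin N) ℂ} {G : ℝ → Matrix (Fin N) (Fin N) ℂ} {e : Fin N → ℝ} {L : ℝ}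

lemma IsMatrixStates.isUnit_det (h : IsMatrixStates W Ψ Ψ₁ G e L) (x : ℝ) : IsUnit (G x).det :=
  (Matrix.isUnit_iff_isUnit_det _).1 (h.posDef x).isUnit

/-- The dual frame `P = G⁻¹ Ψᴴ` and its derivative. -/
lemma IsMatrixStates.exists_dual (h : IsMatrixStates W Ψ Ψ₁ G e L) :
    ∃ P Q : ℝ → Matrix (Fin N) (Fin n) ℂ, (∀ x, MatDeriv P (Q x) x) ∧
      (∀ x, G x * P x = (Ψ x)ᴴ) ∧ (∀ x, G x * Q x = (Ψ₁ x)ᴴ + (Ψ x)ᴴ * (Ψ x * P x)) ∧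
      (∀ x, 0 ≤ rtr (Ψ x * P x)) ∧ ∀ x, L ≤ x → rtr (Ψ x * P x) = 2 * ∑ j, √(e j) := by
  have hi := h.isUnit_det
  have hGP : ∀ x, G x * ((G x)⁻¹ * (Ψ x)ᴴ) = (Ψ x)ᴴ := fun x => by
    rw [← Matrix.mul_assoc, Matrix.mul_nonsing_inv _ (hi x), Matrix.one_mul]
  refine ⟨fun x => (G x)⁻¹ * (Ψ x)ᴴ, _, fun x =>
    ((h.derivG x).inv hi).mul (h.deriv x).conjTranspose, hGP, fun x => ?_, fun x => ?_,
    fun x hx => ?_⟩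
  · simp only [Matrix.mul_add, Matrix.mul_neg, Matrix.neg_mul, neg_neg, ← Matrix.mul_assoc,
      Matrix.mul_nonsing_inv _ (hi x), Matrix.one_mul]
    rw [add_comm]
  · have h1 : rtr (Ψ x * ((G x)⁻¹ * (Ψ x)ᴴ)) =
        rtr ((((G x)⁻¹ * (Ψ x)ᴴ)ᴴ * G x) * ((G x)⁻¹ * (Ψ x)ᴴ)) := by
      rw [Matrix.mul_assoc, hGP, ← Matrix.conjTranspose_mul, rtr_conjTranspose]
    rw [h1]
    exact (Complex.nonneg_iff.1
      ((h.posDef x).posSemidef.conjTranspose_mul_mul_same _).trace_nonneg).1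
  · rw [rtr_mul_comm, Matrix.mul_assoc, h.gram x hx, Matrix.mul_add, rtr_add, rtr_mul_comm,
      Matrix.mul_assoc, Matrix.mul_nonsing_inv _ (hi x), ← Matrix.mul_assoc,
      Matrix.nonsing_inv_mul _ (hi x), Matrix.mul_one, Matrix.one_mul, rtr, Matrix.trace_diagonal,
      ← Complex.ofReal_sum, Complex.ofReal_re]
    ring

/-- A primitive of a continuous matrix valued function supported in `[-R, R]`. -/
lemma exists_matDeriv_of_eq_zero {m p : Type*} {F : ℝ → Matrix m p ℂ} (hF : Continuous F)
    {R : ℝ} (h0 : ∀ x, R ≤ |x| → F x = 0) :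
    ∃ D : ℝ → Matrix m p ℂ, (∀ x, MatDeriv D (F x) x) ∧ (∀ x, x ≤ -R → D x = 0) ∧
      ∀ x, R ≤ x → D x = D R := by
  have hc : ∀ i j, Continuous fun x => F x i j := fun i j =>
    (continuous_apply j).comp ((continuous_apply i).comp hF)
  have hi : ∀ i j a b, IntervalIntegrable (fun x => F x i j) volume a b := fun i j a b =>
    (hc i j).intervalIntegrable a b
  refine ⟨fun x => Matrix.of fun i j => ∫ y in (-R)..x, F y i j, fun x i j =>
    intervalIntegral.integral_hasDerivAt_right (hi i j _ _)
      ((hc i j).stronglyMeasurableAtFilter _ _) (hc i j).continuousAt, fun x hx => ?_,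
      fun x hx => ?_⟩
  · ext i j
    simp only [Matrix.of_apply, Matrix.zero_apply]
    refine intervalIntegral.integral_zero_ae (Eventually.of_forall fun y hy => ?_)
    rw [uIoc_of_ge hx] at hy
    rw [h0 y (le_abs.2 (Or.inr (by linarith [hy.2]))), Matrix.zero_apply]
  · ext i j
    simp only [Matrix.of_apply]
    rw [← intervalIntegral.integral_add_adjacent_intervals (hi i j (-R) R) (hi i j R x)]
    simp only [add_eq_left]
    refine intervalIntegral.integral_zero_ae (Eventually.of_forall fun y hy => ?_)
    rw [uIoc_of_le hx] at hy
    rw [h0 y (le_abs.2 (Or.inl hy.1.le)), Matrix.zero_apply]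

/-- The telescoping boundary term. -/
lemma IsMatrixStates.hasDerivAt_boundary (h : IsMatrixStates W Ψ Ψ₁ G e L) {c d : ℝ → ℝ}
    {D P Q : ℝ → Matrix (Fin N) (Fin n) ℂ} {x : ℝ} (hc : HasDerivAt c (d x) x)
    (hP : MatDeriv P (Q x) x) (hD : MatDeriv D (-(c x • P x)) x) :
    HasDerivAt (fun y => rtr ((D y)ᴴ * ((Ψ y)ᴴ * (Ψ₁ y * D y))) + 2 * (c y * rtr (Ψ₁ y * D y)) +
      rtr ((D y)ᴴ * (G y * ((diagonal fun j => (e j : ℂ)) * D y))) + c y ^ 2 * rtr (Ψ y * P y))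
      (rtr ((-(c x • P x))ᴴ * ((Ψ x)ᴴ * (Ψ₁ x * D x)) +
        (D x)ᴴ * ((Ψ₁ x)ᴴ * (Ψ₁ x * D x) + (Ψ x)ᴴ *
          ((W x * Ψ x + Ψ x * diagonal fun j => (e j : ℂ)) * D x + Ψ₁ x * (-(c x • P x))))) +
      2 * (d x * rtr (Ψ₁ x * D x) + c x * rtr ((W x * Ψ x + Ψ x * diagonal fun j => (e j : ℂ)) * D x
        + Ψ₁ x * (-(c x • P x)))) +
      rtr ((-(c x • P x))ᴴ * (G x * ((diagonal fun j => (e j : ℂ)) * D x)) +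
        (D x)ᴴ * (-((Ψ x)ᴴ * Ψ x) * ((diagonal fun j => (e j : ℂ)) * D x) +
        G x * ((diagonal fun j => (e j : ℂ)) * (-(c x • P x))))) +
      (2 * c x * d x * rtr (Ψ x * P x) + c x ^ 2 * rtr (Ψ₁ x * P x + Ψ x * Q x))) x := by
  set S : Matrix (Fin N) (Fin N) ℂ := diagonal fun j => (e j : ℂ)
  have hSD : MatDeriv (fun y => S * D y) (S * (-(c x • P x))) x :=
    ((matDeriv_const S x).mul hD).congr_deriv (by rw [Matrix.zero_mul, zero_add])
  have d1 := (hD.conjTranspose.mul ((h.deriv x).conjTranspose.mul ((h.deriv₁ x).mul hD))).rtr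
  have d2 := (hc.fun_mul ((h.deriv₁ x).mul hD).rtr).const_mul 2
  have d3 := (hD.conjTranspose.mul ((h.derivG x).mul hSD)).rtr
  have d4 := (hc.fun_pow 2).fun_mul ((h.deriv x).mul hP).rtr
  refine (((d1.fun_add d2).fun_add d3).fun_add d4).congr_deriv ?_
  simp only [Nat.cast_ofNat, show 2 - 1 = 1 from rfl, pow_one]
  rfl

lemma rtr_conjTranspose_mul_eq_sum {m p : Type*} [Fintype m] [Fintype p]
    (u w : p → EuclideanSpace ℂ m) :
    rtr ((Matrix.of fun i k => u k i : Matrix m p ℂ)ᴴ * Matrix.of fun i k => w k i) =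
      ∑ k, (⟪u k, w k⟫_ℂ).re := by
  simp only [rtr, Matrix.trace, Matrix.diag, Matrix.mul_apply, Matrix.conjTranspose_apply,
    Matrix.of_apply, PiLp.inner_apply, RCLike.inner_apply, Complex.re_sum]
  exact Finset.sum_congr rfl fun k _ => Finset.sum_congr rfl fun i _ => by
    rw [mul_comm]; rfl

/-- The trial functions `c + Ψ D`, column by column. -/
lemma IsBoundStates.isH1_trial {E : Type*} [NormedAddCommGroup E] [InnerProductSpace ℂ E]
    {U : ℝ → E →L[ℂ] E}
    {f f₁ : Fin N → ℝ → E} (h : IsBoundStates U f f₁ e)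
    {c d : ℝ → ℝ} {R : ℝ} (hR : 0 < R) (hc : ∀ x, HasDerivAt c (d x) x) (hd : Continuous d)
    (hc0 : ∀ x, R ≤ |x| → c x = 0) (hd0 : ∀ x, R ≤ |x| → d x = 0) (v : E)
    {δ δ' : Fin N → ℝ → ℂ} (hδ : ∀ k x, HasDerivAt (δ k) (δ' k x) x)
    (hδc : ∀ k, Continuous (δ' k)) (hδ0 : ∀ k x, R ≤ |x| → δ' k x = 0)
    (hl : ∀ k x, x ≤ -R → δ k x = 0) (hr : ∀ k x, R ≤ x → δ k x = δ k R) :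
    IsH1 (fun x => c x • v + ∑ k, δ k x • f k x)
      (fun x => (d x • v + ∑ k, δ' k x • f k x) + ∑ k, δ k x • f₁ k x) := by
  have hcc : Continuous c := continuous_iff_continuousAt.2 fun x => (hc x).continuousAt
  have hδcc : ∀ k, Continuous (δ k) := fun k =>
    continuous_iff_continuousAt.2 fun x => (hδ k x).continuousAt
  have hf₁ : ∀ k, Continuous (f₁ k) := fun k =>
    continuous_iff_continuousAt.2 fun x => (h.deriv₁ k x).continuousAt
  have hf : ∀ k, Continuous (f k) := fun k => (h.isH1 k).continuous
  have hbd : ∀ k, ∃ C, ∀ x, ‖δ k x‖ ≤ C := fun k => by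
    obtain ⟨C, hC⟩ := (isCompact_Icc (a := -R) (b := R)).exists_bound_of_continuousOn
      (hδcc k).continuousOn
    have hC0 : 0 ≤ C := (norm_nonneg _).trans (hC R ⟨by linarith, le_rfl⟩)
    refine ⟨C, fun x => ?_⟩
    rcases le_total x (-R) with hx | hx
    · rwa [hl k x hx, norm_zero]
    rcases le_total R x with hx' | hx'
    · rw [hr k x hx']; exact hC R ⟨by linarith, le_rfl⟩
    · exact hC x ⟨hx, hx'⟩
  have hmul : ∀ k {u : ℝ → E}, Continuous u → MemLp u 2 → MemLp (fun x => δ k x • u x) 2 := by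
    intro k u hu hm
    obtain ⟨C, hC⟩ := hbd k
    refine hm.of_le_mul (c := C) ((hδcc k).smul hu).aestronglyMeasurable
      (Eventually.of_forall fun x => ?_)
    rw [norm_smul]
    gcongr
    exact hC x
  refine ⟨fun x => ?_, ?_, ?_⟩
  · refine (((hc x).smul_const v).fun_add (HasDerivAt.fun_sum fun k _ =>
      (hδ k x).fun_smul ((h.isH1 k).hasDerivAt x))).congr_deriv ?_
    rw [Finset.sum_add_distrib]
    abel
  · refine MemLp.add ((hcc.smul continuous_const).memLp_of_hasCompactSupport
      (hasCompactSupport_of_eq_zero (R := R) fun x hx => by simp [hc0 x hx])) ?_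
    exact memLp_finsetSum _ fun k _ => hmul k (hf k) (h.isH1 k).memLp
  · refine MemLp.add (Continuous.memLp_of_hasCompactSupport ?_
      (hasCompactSupport_of_eq_zero (R := R) fun x hx => by simp [hd0 x hx, hδ0 _ x hx])) ?_
    · exact (hd.smul continuous_const).add
        (continuous_finsetSum _ fun k _ => (hδc k).smul (hf k))
    · exact memLp_finsetSum _ fun k _ => hmul k (hf₁ k) (h.isH1 k).memLp_deriv

end SharpInequality

section SharpBound

open Filter Topology Set
open scoped InnerProductSpace ComplexConjugate ENNReal

variable {n N : ℕ} {W : ℝ → Matrix (Fin n) (Fin n) ℂ} {e : Fin N → ℝ} {L : ℝ}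
  {f f₁ : Fin N → ℝ → EuclideanSpace ℂ (Fin n)}

lemma continuous_of_matDeriv {m p : Type*} {F F' : ℝ → Matrix m p ℂ}
    (h : ∀ x, MatDeriv F (F' x) x) : Continuous F :=
  continuous_iff_continuousAt.2 fun x => (h x).continuousAt

/-- The sharp trace inequality at a fixed cutoff scale. -/
lemma IsBoundStates.trace_inequality_cutoff
    (h : IsBoundStates (fun x => toEuclideanCLM (𝕜 := ℂ) (W x)) f f₁ e)
    (hWc : Continuous W) (hW : ∀ x, (W x).IsHermitian) (hL : ∀ x, L ≤ |x| → W x = 0)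
    (hpos : ∀ F F₁ : ℝ → EuclideanSpace ℂ (Fin n), IsH1 F F₁ → (∀ j, ∫ x, ⟪f j x, F x⟫_ℂ = 0) →
      0 ≤ (∫ x, ‖F₁ x‖ ^ 2) + ∫ x, (⟪F x, toEuclideanCLM (𝕜 := ℂ) (W x) (F x)⟫_ℂ).re)
    {T M : ℝ} {c d s t : ℝ → ℝ} (hc : IsCutoff T M c d s t) (hT : 0 < T) (hLT : L ≤ T) :
    0 ≤ n * (4 * M ^ 2 / T) + (∫ x, rtr (W x)) + 4 * ∑ j, √(e j) := by
  have hm := h.isMatrixStates hWc hW hL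
  set Ψ : ℝ → Matrix (Fin n) (Fin N) ℂ := fun x => Matrix.of fun i j => f j x i with hΨ
  set Ψ₁ : ℝ → Matrix (Fin n) (Fin N) ℂ := fun x => Matrix.of fun i j => f₁ j x i with hΨ₁
  set G : ℝ → Matrix (Fin N) (Fin N) ℂ :=
    fun x => Matrix.of fun j l => ∫ y in Ioi x, ⟪f j y, f l y⟫_ℂ with hG
  obtain ⟨P, Q, hP, hGP, hGQ, hh0, hhL⟩ := hm.exists_dual
  set κ : ℝ := ∑ j, √(e j) with hκ
  have hPc := continuous_of_matDeriv hP
  have hcc := hc.continuous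
  obtain ⟨D, hD, hDl, hDr⟩ := exists_matDeriv_of_eq_zero (F := fun x => -(c x • P x))
    (hcc.smul hPc).neg (R := 2 * T) (fun x hx => by rw [hc.eq_zero x hx, zero_smul, neg_zero])
  -- trial functions
  set F : Fin n → ℝ → EuclideanSpace ℂ (Fin n) := fun i x =>
    c x • EuclideanSpace.single i (1 : ℂ) + ∑ k, D x k i • f k x with hF
  set F₁ : Fin n → ℝ → EuclideanSpace ℂ (Fin n) := fun i x =>
    (d x • EuclideanSpace.single i (1 : ℂ) + ∑ k, (-(c x • P x)) k i • f k x) +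
      ∑ k, D x k i • f₁ k x with hF₁
  have hFH : ∀ i, IsH1 (F i) (F₁ i) := fun i => h.isH1_trial (R := 2 * T) (by positivity) hc.deriv
    hc.cont hc.eq_zero hc.deriv_eq_zero _ (fun k x => hD x k i)
    (fun k => (continuous_apply i).comp ((continuous_apply k).comp (hcc.smul hPc).neg))
    (fun k x hx => by rw [hc.eq_zero x hx, zero_smul, neg_zero, Matrix.zero_apply])
    (fun k x hx => by rw [hDl x hx, Matrix.zero_apply]) (fun k x hx => by rw [hDr x hx])
  have hFm : ∀ x, (Matrix.of fun i k => F k x i : Matrix (Fin n) (Fin n) ℂ) =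
      c x • 1 + Ψ x * D x := fun x => by
    ext i k
    simp [hF, hΨ, Matrix.mul_apply, Matrix.one_apply, mul_comm]
  have hF₁m : ∀ x, (Matrix.of fun i k => F₁ k x i : Matrix (Fin n) (Fin n) ℂ) =
      d x • 1 - c x • (Ψ x * P x) + Ψ₁ x * D x := fun x => by
    ext i k
    simp [hF₁, hΨ, hΨ₁, Matrix.mul_apply, Matrix.one_apply, mul_comm,
      Finset.mul_sum, sub_eq_add_neg]
    exact Finset.sum_congr rfl fun _ _ => by ring
  have hen : ∀ x, ∑ i, (‖F₁ i x‖ ^ 2 + (⟪F i x, toEuclideanCLM (𝕜 := ℂ) (W x) (F i x)⟫_ℂ).re) =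
      rtr ((d x • (1 : Matrix (Fin n) (Fin n) ℂ) - c x • (Ψ x * P x) + Ψ₁ x * D x)ᴴ *
        (d x • 1 - c x • (Ψ x * P x) + Ψ₁ x * D x)) +
      rtr ((c x • (1 : Matrix (Fin n) (Fin n) ℂ) + Ψ x * D x)ᴴ *
        (W x * (c x • 1 + Ψ x * D x))) := by
    intro x
    rw [Finset.sum_add_distrib, ← hFm, ← hF₁m, rtr_conjTranspose_mul_eq_sum]
    congr 1
    · exact Finset.sum_congr rfl fun i _ => (inner_self_eq_norm_sq (𝕜 := ℂ) (F₁ i x)).symm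
    · rw [← rtr_conjTranspose_mul_eq_sum]
      rfl
  have horth : ∀ i j, ∫ x, ⟪f j x, F i x⟫_ℂ = 0 := by
    intro i j
    have hd : ∀ x, HasDerivAt (fun x => -(G x * D x) j i) ⟪f j x, F i x⟫_ℂ x := fun x => by
      refine ((hm.derivG x).mul (hD x) j i).fun_neg.congr_deriv ?_
      have e1 : ⟪f j x, F i x⟫_ℂ =
          ((Ψ x)ᴴ * (Matrix.of fun i k => F k x i : Matrix (Fin n) (Fin n) ℂ)) j i := by
        simp only [Matrix.mul_apply, Matrix.conjTranspose_apply, hΨ, Matrix.of_apply,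
          PiLp.inner_apply, RCLike.inner_apply]
        exact Finset.sum_congr rfl fun i _ => mul_comm _ _
      rw [e1, hFm, ← Matrix.neg_apply]
      refine congrFun (congrFun ?_ j) i
      simp only [Matrix.mul_neg, Matrix.mul_smul, hGP, Matrix.mul_add, Matrix.neg_mul,
        Matrix.mul_assoc, Matrix.mul_one]
      abel
    have t1 : Tendsto (fun x => -(G x * D x) j i) atBot (𝓝 0) := by
      refine tendsto_const_nhds.congr' ?_
      filter_upwards [eventually_le_atBot (-(2 * T))] with x hx
      rw [hDl x hx, Matrix.mul_zero, Matrix.zero_apply, neg_zero]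
    have t2 : Tendsto (fun x => -(G x * D x) j i) atTop (𝓝 0) := by
      have : Tendsto (fun x => -(G x * D (2 * T)) j i) atTop (𝓝 0) := by
        have := tendsto_pi_nhds.1 (tendsto_pi_nhds.1
          ((hm.tendstoG.matrix_mul (tendsto_const_nhds (x := D (2 * T)))).neg) j) i
        simpa using this
      refine this.congr' ?_
      filter_upwards [eventually_ge_atTop (2 * T)] with x hx
      rw [hDr x hx]
    have := integral_of_hasDerivAt_of_tendsto hd
      ((h.isH1 j).memLp.integrable_inner₂ (hFH i).memLp) t1 t2
    simpa using this
  -- boundary term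
  set S : Matrix (Fin N) (Fin N) ℂ := diagonal fun j => (e j : ℂ) with hS
  have hSH : Sᴴ = S := by
    rw [hS, diagonal_conjTranspose]; congr 1; funext j; simp
  set B : ℝ → ℝ := fun y => rtr ((D y)ᴴ * ((Ψ y)ᴴ * (Ψ₁ y * D y))) +
    2 * (c y * rtr (Ψ₁ y * D y)) + rtr ((D y)ᴴ * (G y * (S * D y))) +
    c y ^ 2 * rtr (Ψ y * P y) with hB
  obtain ⟨B', hB'⟩ : ∃ B' : ℝ → ℝ, ∀ x, HasDerivAt B (B' x) x ∧
      ∑ i, (‖F₁ i x‖ ^ 2 + (⟪F i x, toEuclideanCLM (𝕜 := ℂ) (W x) (F i x)⟫_ℂ).re) =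
      n * d x ^ 2 + c x ^ 2 * rtr (W x) - 4 * c x * d x * rtr (Ψ x * P x) + B' x := by
    refine ⟨_, fun x => ⟨hm.hasDerivAt_boundary (hc.deriv x) (hP x) (hD x), ?_⟩⟩
    rw [hen, energy_identity (c x) (d x) (hm.posDef x).isHermitian.eq hSH (hW x).eq (hGP x) (hGQ x)
      (hm.wronskian x), Fintype.card_fin]
  have hcW : ∀ x, c x ^ 2 * rtr (W x) = rtr (W x) := fun x => by
    rcases le_total |x| T with hx | hx
    · rw [hc.eq_one x hx]; ring
    · rw [hL x (hLT.trans hx), rtr_zero, mul_zero]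
  have hΨc := continuous_of_matDeriv hm.deriv
  have hrc : ∀ {m : ℕ} {A : ℝ → Matrix (Fin m) (Fin m) ℂ}, Continuous A →
      Continuous fun x => rtr (A x) := fun hA => Complex.continuous_re.comp hA.matrix_trace
  have hWi : Integrable fun x => rtr (W x) :=
    integrable_of_eq_zero (hrc hWc) (R := L) fun x hx => by rw [hL x hx, rtr_zero]
  have hdi : Integrable fun x => (n : ℝ) * d x ^ 2 :=
    integrable_of_eq_zero (continuous_const.mul (hc.cont.pow 2)) (R := 2 * T) fun x hx => by
      rw [hc.deriv_eq_zero x hx]; ring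
  have hci : Integrable fun x => 4 * c x * d x * rtr (Ψ x * P x) :=
    integrable_of_eq_zero (((continuous_const.mul hcc).mul hc.cont).mul
      (hrc (hΨc.matrix_mul hPc))) (R := 2 * T) fun x hx => by rw [hc.deriv_eq_zero x hx]; ring
  have hsi : Integrable fun x => 8 * κ * (s x * t x) := by
    refine integrable_of_eq_zero (R := 2 * T) (continuous_const.mul
      ((continuous_iff_continuousAt.2 fun x => (hc.deriv_right x).continuousAt).mul
        hc.cont_right)) fun x hx => ?_
    rcases le_abs.1 hx with hx | hx
    · rw [hc.right_eq_zero x hx]; ring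
    · rw [hc.deriv_right_of_le x (by linarith)]; ring
  have hi1 : ∀ i, Integrable fun x => ‖F₁ i x‖ ^ 2 := fun i =>
    (hFH i).memLp_deriv.integrable_norm_sq
  have hi2 : ∀ i, Integrable fun x => (⟪F i x, toEuclideanCLM (𝕜 := ℂ) (W x) (F i x)⟫_ℂ).re :=
    fun i => integrable_of_eq_zero (R := L) (Complex.continuous_re.comp
      ((hFH i).continuous.inner ((continuous_toEuclideanCLM.comp hWc).clm_apply
        (hFH i).continuous))) fun x hx => by simp [hL x hx]
  have hei : Integrable fun x =>
      ∑ i, (‖F₁ i x‖ ^ 2 + (⟪F i x, toEuclideanCLM (𝕜 := ℂ) (W x) (F i x)⟫_ℂ).re) :=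
    integrable_finsetSum _ fun i _ => (hi1 i).add (hi2 i)
  have hBi : Integrable B' := by
    refine (((hei.sub hdi).sub hWi).add hci).congr (Eventually.of_forall fun x => ?_)
    simp only [Pi.add_apply, Pi.sub_apply, (hB' x).2, hcW]
    ring
  have hΦ : ∫ x, (B' x - 8 * κ * (s x * t x)) = 4 * κ := by
    have t1 : Tendsto (fun x => B x - 4 * κ * s x ^ 2) atBot (𝓝 (-(4 * κ))) := by
      refine tendsto_const_nhds.congr' ?_
      filter_upwards [eventually_le_atBot (-(2 * T))] with x hx
      rw [hc.right_eq_one x (by linarith)]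
      simp [hB, hDl x hx, hc.eq_zero x (le_abs.2 (Or.inr (by linarith))), rtr_zero]
    have t2 : Tendsto (fun x => B x - 4 * κ * s x ^ 2) atTop (𝓝 0) := by
      have hD0 := tendsto_const_nhds (x := D (2 * T)) (f := atTop (α := ℝ))
      have hDs0 := tendsto_const_nhds (x := (D (2 * T))ᴴ) (f := atTop (α := ℝ))
      have hSD0 := tendsto_const_nhds (x := S * D (2 * T)) (f := atTop (α := ℝ))
      have : Tendsto (fun x => rtr ((D (2 * T))ᴴ * ((Ψ x)ᴴ * (Ψ₁ x * D (2 * T)))) +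
          rtr ((D (2 * T))ᴴ * (G x * (S * D (2 * T))))) atTop (𝓝 0) := by
        simpa [rtr_zero] using (hDs0.matrix_mul (hm.tendsto.conjTranspose_zero.matrix_mul
          (hm.tendsto₁.matrix_mul hD0))).rtr.add
          (hDs0.matrix_mul (hm.tendstoG.matrix_mul hSD0)).rtr
      refine this.congr' ?_
      filter_upwards [eventually_ge_atTop (2 * T)] with x hx
      simp [hB, hDr x hx, hc.eq_zero x (le_abs.2 (Or.inl hx)), hc.right_eq_zero x hx]
    have := integral_of_hasDerivAt_of_tendsto
      (fun x => (((hB' x).1.fun_sub (((hc.deriv_right x).fun_pow 2).const_mul (4 * κ))).congr_deriv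
        (show _ = B' x - 8 * κ * (s x * t x) by
          simp only [Nat.cast_ofNat, show 2 - 1 = 1 from rfl, pow_one]; ring)))
      (hBi.sub hsi) t1 t2
    rw [this]; ring
  have hle : ∀ x, ∑ i, (‖F₁ i x‖ ^ 2 +
      (⟪F i x, toEuclideanCLM (𝕜 := ℂ) (W x) (F i x)⟫_ℂ).re) ≤
      n * d x ^ 2 + rtr (W x) + (B' x - 8 * κ * (s x * t x)) := by
    intro x
    rw [(hB' x).2, hcW]
    rcases le_total x T with hx | hx
    · rw [hc.deriv_right_of_le x hx]
      have := mul_nonneg (mul_nonneg (hc.nonneg x) (hc.deriv_nonneg x hx)) (hh0 x)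
      linarith
    · obtain ⟨h1, h2⟩ := hc.right_eq x hx
      rw [h1, h2, hhL x (hLT.trans hx)]
      apply le_of_eq
      ring
  have hsum : 0 ≤ ∫ x, ∑ i, (‖F₁ i x‖ ^ 2 +
      (⟪F i x, toEuclideanCLM (𝕜 := ℂ) (W x) (F i x)⟫_ℂ).re) := by
    rw [integral_finsetSum (f := fun i x => ‖F₁ i x‖ ^ 2 +
      (⟪F i x, toEuclideanCLM (𝕜 := ℂ) (W x) (F i x)⟫_ℂ).re) _ fun i _ => (hi1 i).add (hi2 i)]
    refine Finset.sum_nonneg fun i _ => ?_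
    rw [integral_add (hi1 i) (hi2 i)]
    exact hpos (F i) (F₁ i) (hFH i) (horth i)
  have hint := integral_mono hei ((hdi.add hWi).add (hBi.sub hsi)) hle
  have hsplit : ∫ x, ((fun x => (n : ℝ) * d x ^ 2) + (fun x => rtr (W x)) +
      (B' - fun x => 8 * κ * (s x * t x))) x = n * (∫ x, d x ^ 2) + (∫ x, rtr (W x)) + 4 * κ := by
    rw [integral_add' (hdi.add hWi) (hBi.sub hsi), integral_add' hdi hWi, integral_const_mul, ← hΦ]
    rfl
  have hd2 := hc.integral_sq_le hT
  have hn : (n : ℝ) * (∫ x, d x ^ 2) ≤ n * (4 * M ^ 2 / T) := by gcongr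
  linarith [hsum.trans hint]

/-- The sharp trace inequality for compactly supported potentials. -/
lemma IsBoundStates.trace_inequality
    (h : IsBoundStates (fun x => toEuclideanCLM (𝕜 := ℂ) (W x)) f f₁ e)
    (hWc : Continuous W) (hW : ∀ x, (W x).IsHermitian) (hL : ∀ x, L ≤ |x| → W x = 0)
    (hpos : ∀ F F₁ : ℝ → EuclideanSpace ℂ (Fin n), IsH1 F F₁ → (∀ j, ∫ x, ⟪f j x, F x⟫_ℂ = 0) →
      0 ≤ (∫ x, ‖F₁ x‖ ^ 2) + ∫ x, (⟪F x, toEuclideanCLM (𝕜 := ℂ) (W x) (F x)⟫_ℂ).re) :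
    0 ≤ (∫ x, rtr (W x)) + 4 * ∑ j, √(e j) := by
  obtain ⟨M, hM, hc⟩ := exists_isCutoff
  have ht : Tendsto (fun T : ℝ => n * (4 * M ^ 2 / T) + (∫ x, rtr (W x)) + 4 * ∑ j, √(e j)) atTop
      (𝓝 (n * 0 + (∫ x, rtr (W x)) + 4 * ∑ j, √(e j))) :=
    ((tendsto_const_nhds.mul (tendsto_const_nhds.div_atTop tendsto_id)).add
      tendsto_const_nhds).add tendsto_const_nhds
  have := ge_of_tendsto ht <| by
    filter_upwards [eventually_ge_atTop (max L 1)] with T hT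
    have hT0 : 0 < T := by linarith [le_max_right L 1]
    obtain ⟨c, d, s, t, hcut⟩ := hc T hT0
    exact h.trace_inequality_cutoff hWc hW hL hpos hcut hT0 ((le_max_left _ _).trans hT)
  simpa using this

end SharpBound

section MinMax

open Filter Topology Set
open scoped InnerProductSpace ComplexConjugate ENNReal

lemma exists_supported_ker_of_card_lt {N : ℕ} {F : Type*} [AddCommGroup F] [Module ℂ F]
    [FiniteDimensional ℂ F] (φ : (Fin N → ℂ) →ₗ[ℂ] F) (J : Finset (Fin N))
    (h : Module.finrank ℂ F < J.card) :
    ∃ c : Fin N → ℂ, c ≠ 0 ∧ (∀ j, j ∉ J → c j = 0) ∧ φ c = 0 := by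
  let ι := Function.ExtendByZero.linearMap ℂ (Subtype.val : J → Fin N)
  have hker : LinearMap.ker (φ ∘ₗ ι) ≠ ⊥ := LinearMap.ker_ne_bot_of_finrank_lt <| by
    simpa using h
  obtain ⟨b, hb, hb0⟩ := (Submodule.ne_bot_iff _).1 hker
  have hι : ∀ j : J, ι b j = b j := fun j => Subtype.val_injective.extend_apply b 0 j
  refine ⟨ι b, fun h0 => hb0 (funext fun j => ?_), fun j hj => ?_, hb⟩
  · rw [← hι, h0]; rfl
  · exact Function.extend_apply' _ _ _ fun ⟨a, ha⟩ => hj (ha ▸ a.2)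

variable {H : Type*} [NormedAddCommGroup H] [InnerProductSpace ℂ H] {A : H →L[ℂ] H}
  {v w : H →ₗ⋆[ℂ] H →ₗ[ℂ] ℂ} {N : ℕ} {g : Fin N → H} {E : Fin N → ℝ}

lemma IsEigenfamily.norm_sq_sum (hg : IsEigenfamily A w g E) (c : Fin N → ℂ) :
    ‖A (∑ j, c j • g j)‖ ^ 2 = ∑ j, ‖c j‖ ^ 2 := by
  have h1 : A (∑ j, c j • g j) = ∑ j, c j • A (g j) := by simp
  have h2 := hg.orthonormal.inner_sum c c Finset.univ
  rw [h1]
  have h3 := inner_self_eq_norm_sq (𝕜 := ℂ) (∑ j, c j • A (g j))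
  rw [h2] at h3
  rw [← h3]
  simp [Complex.conj_mul', ← Complex.ofReal_pow]

lemma IsEigenfamily.schrForm_sum (hg : IsEigenfamily A w g E) (c : Fin N → ℂ) :
    (schrForm A w (∑ j, c j • g j) (∑ j, c j • g j)).re = -∑ j, E j * ‖c j‖ ^ 2 := by
  have h1 : A (∑ j, c j • g j) = ∑ j, c j • A (g j) := by simp
  rw [map_sum]
  simp only [map_smul, hg.eigen, h1]
  have h2 : ∀ j, ⟪∑ l, c l • A (g l), A (g j)⟫_ℂ = conj (c j) := fun j =>
    hg.orthonormal.inner_left_sum c (Finset.mem_univ j)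
  simp only [h2, smul_eq_mul, Complex.re_sum, ← Finset.sum_neg_distrib]
  refine Finset.sum_congr rfl fun j _ => ?_
  rw [mul_left_comm, Complex.mul_conj', ← Complex.ofReal_pow, ← Complex.ofReal_neg,
    ← Complex.ofReal_mul, Complex.ofReal_re, neg_mul]

lemma norm_sq_sum_pos {c : Fin N → ℂ} (hc : c ≠ 0) : 0 < ∑ j, ‖c j‖ ^ 2 := by
  obtain ⟨j, hj⟩ := Function.ne_iff.1 hc
  exact Finset.sum_pos' (fun _ _ => by positivity) ⟨j, Finset.mem_univ j, by
    have : 0 < ‖c j‖ := norm_pos_iff.2 hj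
    positivity⟩

variable [CompleteSpace H] [TopologicalSpace.SeparableSpace H]

/-- Comparison of the negative eigenvalues of two forms. -/
lemma IsEigenfamily.exists_comparison (hA : ∀ g, ‖A g‖ ≤ ‖g‖) (hv : IsCompactForm A v)
    (hg : IsEigenfamily A w g E) {s : ℝ} (hs : 0 ≤ s)
    (hcomp : ∀ c : Fin N → ℂ, (schrForm A v (∑ j, c j • g j) (∑ j, c j • g j)).re ≤
      (schrForm A w (∑ j, c j • g j) (∑ j, c j • g j)).re + s * ‖A (∑ j, c j • g j)‖ ^ 2) :
    ∃ (M : ℕ) (g' : Fin M → H) (E' : Fin M → ℝ), IsEigenfamily A v g' E' ∧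
      ∑ j, √(E j) - N * √s ≤ ∑ j, √(E' j) := by
  have key : ∀ J : Finset (Fin N), (∀ j ∈ J, s < E j) → ∃ (g' : Fin J.card → H)
      (E' : Fin J.card → ℝ), IsEigenfamily A v g' E' ∧ ∑ j ∈ J, √(E j - s) ≤ ∑ j, √(E' j) := by
    intro J
    induction J using Finset.induction_on_min_value E with
    | empty =>
      exact fun _ => ⟨fun j => j.elim0, fun j => j.elim0, ⟨fun j => j.elim0,
        ⟨fun j => j.elim0, fun j => j.elim0⟩, fun j => j.elim0⟩, by
          rw [Finset.sum_empty]
          exact Finset.sum_nonneg fun j _ => Real.sqrt_nonneg _⟩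
    | insert a J ha hmin ih =>
      intro hJ
      obtain ⟨g', E', hg', hE'⟩ := ih fun j hj => hJ j (Finset.mem_insert_of_mem hj)
      let φ : (Fin N → ℂ) →ₗ[ℂ] (Fin J.card → ℂ) := LinearMap.pi fun i =>
        (innerₛₗ ℂ (A (g' i))) ∘ₗ A.toLinearMap ∘ₗ Fintype.linearCombination ℂ g
      have hφ : ∀ c i, φ c i = ⟪A (g' i), A (∑ j, c j • g j)⟫_ℂ := fun c i => rfl
      have hcard : (insert a J).card = J.card + 1 := Finset.card_insert_of_notMem ha
      obtain ⟨c, hc0, hcJ, hφc⟩ := exists_supported_ker_of_card_lt φ (insert a J) (by simp [hcard])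
      have has : s < E a := hJ a (Finset.mem_insert_self a J)
      have hn := hg.norm_sq_sum c
      have hp := norm_sq_sum_pos hc0
      obtain ⟨k, E₁, hE₁, hk⟩ := hg'.exists_snoc hA hv (g₀ := ∑ j, c j • g j)
        (fun j => by rw [← hφ, hφc]; rfl) (fun h0 => by rw [h0, norm_zero] at hn; linarith)
        (sub_pos.2 has) (by
          refine (hcomp c).trans ?_
          rw [hg.schrForm_sum, hn, neg_mul, sub_mul]
          have : E a * ∑ j, ‖c j‖ ^ 2 ≤ ∑ j, E j * ‖c j‖ ^ 2 := by
            rw [Finset.mul_sum]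
            refine Finset.sum_le_sum fun j _ => ?_
            by_cases hj : j ∈ insert a J
            · have : E a ≤ E j := by
                rcases Finset.mem_insert.1 hj with rfl | hj
                · exact le_rfl
                · exact hmin j hj
              gcongr
            · simp [hcJ j hj]
          linarith)
      rw [hcard]
      refine ⟨_, _, hk, ?_⟩
      rw [Finset.sum_insert ha, Fin.sum_univ_castSucc]
      simp only [Fin.snoc_castSucc, Fin.snoc_last]
      have := Real.sqrt_le_sqrt hE₁
      linarith
  obtain ⟨g', E', hg', hE'⟩ := key (Finset.univ.filter fun j => s < E j) (by simp)
  refine ⟨_, g', E', hg', le_trans ?_ hE'⟩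
  have h1 : ∑ j, √(E j) - N * √s = ∑ j : Fin N, (√(E j) - √s) := by simp
  rw [h1, Finset.sum_filter]
  refine Finset.sum_le_sum fun j _ => ?_
  split_ifs with h
  · have : √(E j) ≤ √(E j - s) + √s := by
      refine Real.sqrt_le_iff.2 ⟨by positivity, ?_⟩
      have h1 := Real.sq_sqrt (sub_nonneg.2 h.le)
      have h2 := Real.sq_sqrt hs
      nlinarith [Real.sqrt_nonneg (E j - s), Real.sqrt_nonneg s]
    linarith
  · exact sub_nonpos.2 (Real.sqrt_le_sqrt (not_lt.1 h))

end MinMax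

section Finiteness

open Filter Topology Set
open scoped InnerProductSpace ComplexConjugate ENNReal

variable {E : Type*} [NormedAddCommGroup E] [InnerProductSpace ℂ E]

lemma sq_intervalIntegral_le {u : ℝ → ℝ} (hu : Continuous u) {a b : ℝ} (hab : a ≤ b) :
    (∫ x in a..b, u x) ^ 2 ≤ (b - a) * ∫ x in a..b, u x ^ 2 := by
  rcases hab.eq_or_lt with rfl | hab'
  · simp
  set S := ∫ x in a..b, u x
  have h0 : 0 ≤ ∫ x in a..b, ((b - a) * u x - S) ^ 2 :=
    intervalIntegral.integral_nonneg hab fun x _ => sq_nonneg _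
  have h1 : ∫ x in a..b, ((b - a) * u x - S) ^ 2 =
      (b - a) ^ 2 * (∫ x in a..b, u x ^ 2) - 2 * (b - a) * S * S + (b - a) * S ^ 2 := by
    have e : ∀ x, ((b - a) * u x - S) ^ 2 =
        (b - a) ^ 2 * u x ^ 2 - 2 * (b - a) * S * u x + S ^ 2 := fun x => by ring
    simp only [e]
    rw [intervalIntegral.integral_add, intervalIntegral.integral_sub,
      intervalIntegral.integral_const_mul, intervalIntegral.integral_const_mul,
      intervalIntegral.integral_const, smul_eq_mul]
    all_goals exact Continuous.intervalIntegrable (by fun_prop) _ _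
  rw [h1] at h0
  have hl : 0 < b - a := sub_pos.2 hab'
  have : 0 ≤ (b - a) * ((b - a) * (∫ x in a..b, u x ^ 2) - S ^ 2) := by linarith
  linarith [nonneg_of_mul_nonneg_right this hl]

lemma integral_norm_sq_le_of_eq_zero [CompleteSpace E] {f f₁ : ℝ → E}
    (hf : ∀ x, HasDerivAt f (f₁ x) x)
    (hf₁ : Continuous f₁) {a b : ℝ} (hab : a ≤ b) (h0 : f a = 0) :
    ∫ x in a..b, ‖f x‖ ^ 2 ≤ (b - a) ^ 2 * ∫ x in a..b, ‖f₁ x‖ ^ 2 := by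
  have hfc : Continuous f := continuous_iff_continuousAt.2 fun x => (hf x).continuousAt
  have hn := hf₁.norm
  have hpt : ∀ x ∈ Icc a b, ‖f x‖ ^ 2 ≤ (b - a) * ∫ x in a..b, ‖f₁ x‖ ^ 2 := fun x hx => by
    refine le_trans ?_ (sq_intervalIntegral_le hn hab)
    have h1 : f x = ∫ y in a..x, f₁ y := by
      rw [intervalIntegral.integral_eq_sub_of_hasDerivAt (fun y _ => hf y)
        (hf₁.intervalIntegrable _ _), h0, sub_zero]
    gcongr
    rw [h1]
    refine (intervalIntegral.norm_integral_le_integral_norm hx.1).trans ?_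
    exact intervalIntegral.integral_mono_interval le_rfl hx.1 hx.2
      (ae_of_all _ fun _ => norm_nonneg _) (hn.intervalIntegrable _ _)
  have := intervalIntegral.integral_mono_on hab
    ((hfc.norm.pow 2).intervalIntegrable (μ := volume) a b)
    (continuous_const.intervalIntegrable (μ := volume) a b) hpt
  refine this.trans_eq ?_
  rw [intervalIntegral.integral_const, smul_eq_mul]
  ring

lemma integral_norm_sq_le_of_grid [CompleteSpace E] {f f₁ : ℝ → E}
    (hf : ∀ x, HasDerivAt f (f₁ x) x)
    (hf₁ : Continuous f₁) {a h : ℝ} (hh : 0 ≤ h) {m : ℕ} (h0 : ∀ i < m, f (a + i * h) = 0) :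
    ∫ x in a..(a + m * h), ‖f x‖ ^ 2 ≤ h ^ 2 * ∫ x in a..(a + m * h), ‖f₁ x‖ ^ 2 := by
  have hfc : Continuous f := continuous_iff_continuousAt.2 fun x => (hf x).continuousAt
  have h1 := intervalIntegral.sum_integral_adjacent_intervals (μ := volume) (n := m)
    (f := fun x => ‖f x‖ ^ 2) (a := fun i : ℕ => a + i * h)
    fun k _ => (hfc.norm.pow 2).intervalIntegrable _ _
  have h2 := intervalIntegral.sum_integral_adjacent_intervals (μ := volume) (n := m)
    (f := fun x => ‖f₁ x‖ ^ 2) (a := fun i : ℕ => a + i * h)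
    fun k _ => (hf₁.norm.pow 2).intervalIntegrable _ _
  simp only [Nat.cast_zero, zero_mul, add_zero] at h1 h2
  rw [← h1, ← h2, Finset.mul_sum]
  refine Finset.sum_le_sum fun i hi => ?_
  have := integral_norm_sq_le_of_eq_zero hf hf₁ (a := a + i * h) (b := a + ((i + 1 : ℕ) : ℝ) * h)
    (by push_cast; nlinarith) (h0 i (Finset.mem_range.1 hi))
  have e : a + ((i + 1 : ℕ) : ℝ) * h - (a + i * h) = h := by push_cast; ring
  rwa [e] at this

variable [FiniteDimensional ℂ E]

lemma IsEigenfamily.exists_isBoundStates {U : ℝ → E →L[ℂ] E} (hU : IsPotential U) {N : ℕ}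
    {g : Fin N → L2R E} {e : Fin N → ℝ} (hg : IsEigenfamily primL (potForm hU) g e) :
    ∃ f₁, IsBoundStates U (fun j => prim (g j)) f₁ e ∧
      ∀ j, g j =ᵐ[volume] fun x => prim (g j) x + f₁ j x := by
  choose f₁ h1 h2 h3 using fun j => hU.exists_isH1_of_eigen (g := g j) (lam := -e j)
    fun h => by simpa using hg.eigen j h
  refine ⟨f₁, ⟨hg.pos, h1, fun j x => by simpa using h2 j x, fun j l => ?_⟩, h3⟩
  rw [← orthonormal_iff_ite.1 hg.orthonormal j l, L2.inner_def]
  refine integral_congr_ae ?_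
  filter_upwards [primL_coeFn (g j), primL_coeFn (g l)] with x h1 h2
  rw [h1, h2]

lemma IsEigenfamily.exists_isH1_sum {U : ℝ → E →L[ℂ] E} (hU : IsPotential U) {N : ℕ}
    {g : Fin N → L2R E} {e : Fin N → ℝ} (hg : IsEigenfamily primL (potForm hU) g e)
    (c : Fin N → ℂ) :
    ∃ f₁, Continuous f₁ ∧ ∃ h : IsH1 (prim (∑ j, c j • g j : L2R E)) f₁,
      h.toL2 = ∑ j, c j • g j := by
  obtain ⟨f₁, hb, hgf⟩ := hg.exists_isBoundStates hU
  have hp : prim (∑ j, c j • g j : L2R E) = fun x => ∑ j, c j • prim (g j) x :=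
    funext fun x => prim_Lp_sum _ c g x
  have hH : IsH1 (prim (∑ j, c j • g j : L2R E)) fun x => ∑ j, c j • f₁ j x := by
    rw [hp]
    exact ⟨hb.hasDerivAt_sum c, memLp_finsetSum _ fun j _ => (hb.isH1 j).memLp.const_smul (c j),
      memLp_finsetSum _ fun j _ => (hb.isH1 j).memLp_deriv.const_smul (c j)⟩
  refine ⟨_, continuous_finsetSum _ fun j _ => Continuous.const_smul
    (continuous_iff_continuousAt.2 fun x => (hb.deriv₁ j x).continuousAt) _, hH, ?_⟩
  refine Lp.ext ?_
  have h1 : ⇑(∑ j, c j • g j : L2R E) =ᵐ[volume] fun x => ∑ j, c j • g j x := by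
    have h2 : ∀ᵐ x, ∀ j, (c j • g j : L2R E) x = c j • g j x :=
      ae_all_iff.2 fun j => Lp.coeFn_smul (c j) (g j)
    filter_upwards [Lp.coeFn_finsetSum Finset.univ fun j => c j • g j, h2] with x h3 h4
    rw [h3, Finset.sum_apply]
    exact Finset.sum_congr rfl fun j _ => h4 j
  filter_upwards [(hH.memLp.add hH.memLp_deriv).coeFn_toLp, h1, ae_all_iff.2 hgf] with x h2 h3 h4
  refine h2.trans ?_
  rw [h3, hp, Pi.add_apply, ← Finset.sum_add_distrib]
  exact Finset.sum_congr rfl fun j _ => by rw [h4 j, smul_add]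

variable (E) in
/-- A bound for the number of negative eigenvalues of a potential which is nonnegative outside
`[-ρ, ρ]` and at least `-C` everywhere. -/
lemma exists_card_eigenfamily_le {C ρ : ℝ} (hC : 0 ≤ C) (hρ : 0 < ρ) :
    ∃ N₀ : ℕ, ∀ {U : ℝ → E →L[ℂ] E} (hU : IsPotential U),
      (∀ x v, -C * ‖v‖ ^ 2 ≤ (⟪v, U x v⟫_ℂ).re) →
      (∀ x v, ρ ≤ |x| → 0 ≤ (⟪v, U x v⟫_ℂ).re) →
      ∀ (N : ℕ) (g : Fin N → L2R E) (e : Fin N → ℝ), IsEigenfamily primL (potForm hU) g e →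
        N ≤ N₀ := by
  obtain ⟨m, hm⟩ := exists_nat_ge (4 * ρ ^ 2 * C + 1)
  have hm1 : (1 : ℝ) ≤ m := le_trans (by nlinarith [mul_nonneg (sq_nonneg ρ) hC]) hm
  set h : ℝ := 2 * ρ / m with hh
  have hh0 : 0 ≤ h := by positivity
  have hmh : -ρ + m * h = ρ := by rw [hh]; field_simp; ring
  have hCh : C * h ^ 2 ≤ 1 := by
    rw [hh, div_pow, ← mul_div_assoc, div_le_one (by positivity)]
    nlinarith
  refine ⟨m * Module.finrank ℂ E, fun {U} hU hUC hU0 N g e hg => ?_⟩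
  by_contra! hN
  let φ : (Fin N → ℂ) →ₗ[ℂ] (Fin m → E) := LinearMap.pi fun i =>
    (primEval (-ρ + i * h)).toLinearMap ∘ₗ Fintype.linearCombination ℂ g
  have hφ : ∀ c i, φ c i = prim (∑ j, c j • g j : L2R E) (-ρ + (i : ℕ) * h) := fun c i => rfl
  obtain ⟨c, hc0, -, hc⟩ := exists_supported_ker_of_card_lt φ Finset.univ
    (by rw [Module.finrank_pi_fintype]; simpa using hN)
  obtain ⟨f₁, hf₁, hH, hHg⟩ := hg.exists_isH1_sum hU c
  set f := prim (∑ j, c j • g j : L2R E)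
  have hq := hg.schrForm_sum c
  rw [← hHg, hH.schrForm_re hU] at hq
  have hgrid := integral_norm_sq_le_of_grid hH.hasDerivAt hf₁ (a := -ρ) hh0 (m := m)
    fun i hi => (hφ c ⟨i, hi⟩).symm.trans (by rw [hc]; rfl)
  rw [hmh] at hgrid
  have hlt : -∑ j, e j * ‖c j‖ ^ 2 < 0 := by
    obtain ⟨j, hj⟩ := Function.ne_iff.1 hc0
    refine neg_neg_of_pos (Finset.sum_pos' (fun i _ => ?_) ⟨j, Finset.mem_univ j, ?_⟩)
    · have := hg.pos i
      positivity
    · have := hg.pos j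
      have : 0 < ‖c j‖ := norm_pos_iff.2 hj
      positivity
  have hfi : Integrable fun x => (⟪f x, U x (f x)⟫_ℂ).re := (hU.integrable_inner _ _).re
  have hkin : ∫ x in (-ρ)..ρ, ‖f₁ x‖ ^ 2 ≤ ∫ x, ‖f₁ x‖ ^ 2 := by
    rw [intervalIntegral.integral_of_le (by linarith)]
    exact setIntegral_le_integral hH.memLp_deriv.integrable_norm_sq
      (ae_of_all _ fun x => by positivity)
  have hpot : -C * ∫ x in (-ρ)..ρ, ‖f x‖ ^ 2 ≤ ∫ x, (⟪f x, U x (f x)⟫_ℂ).re := by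
    rw [intervalIntegral.integral_of_le (by linarith), ← integral_const_mul,
      ← integral_indicator measurableSet_Ioc]
    refine integral_mono ((hH.memLp.integrable_norm_sq.const_mul _).indicator measurableSet_Ioc)
      hfi fun x => ?_
    by_cases hx : x ∈ Ioc (-ρ) ρ
    · simpa [hx] using hUC x (f x)
    · simp only [indicator_of_notMem hx]
      refine hU0 x _ (le_abs'.2 ?_)
      by_contra! hcon
      exact hx ⟨hcon.1, hcon.2.le⟩
  have hk0 : 0 ≤ ∫ x in (-ρ)..ρ, ‖f₁ x‖ ^ 2 :=
    intervalIntegral.integral_nonneg (by linarith) fun x _ => by positivity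
  have h1 := mul_le_mul_of_nonneg_left hgrid hC
  have h2 := mul_le_mul_of_nonneg_right hCh hk0
  linarith

instance : TopologicalSpace.SeparableSpace (L2R E) :=
  have : Fact ((2 : ENNReal) ≠ ⊤) := ⟨by simp⟩
  inferInstanceAs (TopologicalSpace.SeparableSpace (Lp E 2 (volume : Measure ℝ)))

/-- If the number of negative eigenvalues is bounded, there is a finite eigenfamily on whose
orthogonal complement the Schrödinger form is nonnegative. -/
lemma IsPotential.exists_maximal_eigenfamily {U : ℝ → E →L[ℂ] E} (hU : IsPotential U) {N₀ : ℕ}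
    (hN₀ : ∀ (N : ℕ) (g : Fin N → L2R E) (e : Fin N → ℝ),
      IsEigenfamily primL (potForm hU) g e → N ≤ N₀) :
    ∃ (N : ℕ) (g : Fin N → L2R E) (e : Fin N → ℝ), IsEigenfamily primL (potForm hU) g e ∧
      ∀ F F₁, IsH1 F F₁ → (∀ j, ∫ x, ⟪prim (g j) x, F x⟫_ℂ = 0) →
        0 ≤ (∫ x, ‖F₁ x‖ ^ 2) + ∫ x, (⟪F x, U x (F x)⟫_ℂ).re := by
  obtain ⟨N, ⟨g, e, hg⟩, hN⟩ : ∃ N : ℕ, (∃ (g : Fin N → L2R E) (e : Fin N → ℝ),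
      IsEigenfamily primL (potForm hU) g e) ∧ ¬ ∃ (g : Fin (N + 1) → L2R E) (e : Fin (N + 1) → ℝ),
      IsEigenfamily primL (potForm hU) g e := by
    by_contra! hcon
    have hall : ∀ N : ℕ, ∃ (g : Fin N → L2R E) (e : Fin N → ℝ),
        IsEigenfamily primL (potForm hU) g e := fun N => by
      induction N with
      | zero => exact ⟨fun j => j.elim0, fun j => j.elim0, ⟨fun j => j.elim0,
          ⟨fun j => j.elim0, fun j => j.elim0⟩, fun j => j.elim0⟩⟩
      | succ N ih => exact hcon N ih
    obtain ⟨g, e, hg⟩ := hall (N₀ + 1)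
    exact absurd (hN₀ _ g e hg) (by simp)
  refine ⟨N, g, e, hg, fun F F₁ hF horth => ?_⟩
  by_contra! hneg
  rw [← hF.schrForm_re hU] at hneg
  have hv := hU.isCompactForm
  have hA : primL hF.toL2 ≠ 0 := fun h0 => by
    rw [schrForm_self_re, h0, hv.ker _ h0, norm_zero] at hneg
    nlinarith [sq_nonneg ‖hF.toL2‖]
  have hn : 0 < ‖primL hF.toL2‖ ^ 2 := by
    have := norm_pos_iff.2 hA
    positivity
  have hE : (schrForm primL (potForm hU) hF.toL2 hF.toL2).re ≤
      -(-(schrForm primL (potForm hU) hF.toL2 hF.toL2).re / ‖primL hF.toL2‖ ^ 2) *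
        ‖primL hF.toL2‖ ^ 2 := by
    rw [neg_div, neg_neg, div_mul_cancel₀ _ hn.ne']
  have ho : ∀ j, ⟪primL (g j), primL hF.toL2⟫_ℂ = 0 := fun j => by
    rw [← horth j, L2.inner_def]
    refine integral_congr_ae ?_
    filter_upwards [primL_coeFn (g j), hF.primL_toL2] with x h1 h2
    rw [h1, h2]
  obtain ⟨k, E₁, -, hk⟩ := IsEigenfamily.exists_snoc (H := L2R E) (A := primL) norm_primL_le
    (v := potForm hU) hv hg (g₀ := hF.toL2) ho hA (div_pos (neg_pos.2 hneg) hn) hE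
  exact hN ⟨_, _, hk⟩

end Finiteness

section MatrixPotential

open Filter Topology Set
open scoped InnerProductSpace ComplexConjugate ENNReal

/-- A continuous cutoff function, equal to one for `|x| ≤ R` and to zero for `2 R ≤ |x|`. -/
noncomputable def bump (R x : ℝ) : ℝ := downStep (|x| / R)

lemma continuous_bump (R : ℝ) : Continuous (bump R) :=
  contDiff_downStep.continuous.comp (continuous_abs.div_const R)

lemma bump_nonneg (R x : ℝ) : 0 ≤ bump R x := downStep_nonneg _

lemma bump_le_one (R x : ℝ) : bump R x ≤ 1 := downStep_le_one _

lemma bump_eq_one {R x : ℝ} (hR : 0 < R) (hx : |x| ≤ R) : bump R x = 1 :=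
  downStep_eq_one ((div_le_one hR).2 hx)

lemma bump_eq_zero {R x : ℝ} (hR : 0 < R) (hx : 2 * R ≤ |x|) : bump R x = 0 :=
  downStep_eq_zero ((le_div_iff₀ hR).2 hx)

lemma integrable_one_sub_bump_mul {a : ℝ → ℝ} (ha : Integrable a) (R : ℝ) :
    Integrable fun x => (1 - bump R x) * a x := by
  refine ha.bdd_mul (c := 1) (continuous_const.sub (continuous_bump R)).aestronglyMeasurable
    (ae_of_all _ fun x => ?_)
  rw [Real.norm_of_nonneg (sub_nonneg.2 (bump_le_one R x))]
  linarith [bump_nonneg R x]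

lemma tendsto_integral_one_sub_bump_mul {a : ℝ → ℝ} (ha : Integrable a) :
    Tendsto (fun R => ∫ x, (1 - bump R x) * a x) atTop (𝓝 0) := by
  have h0 : ∫ _ : ℝ, (0 : ℝ) = 0 := integral_zero _ _
  rw [← h0]
  refine tendsto_integral_filter_of_dominated_convergence (fun x => ‖a x‖)
    (.of_forall fun R => (integrable_one_sub_bump_mul ha R).aestronglyMeasurable)
    (.of_forall fun R => ae_of_all _ fun x => ?_) ha.norm (ae_of_all _ fun x => ?_)
  · rw [norm_mul, Real.norm_of_nonneg (sub_nonneg.2 (bump_le_one R x))]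
    exact mul_le_of_le_one_left (norm_nonneg _) (by linarith [bump_nonneg R x])
  · refine tendsto_const_nhds.congr' ?_
    filter_upwards [eventually_ge_atTop |x|, eventually_gt_atTop 0] with R hR hR0
    rw [bump_eq_one hR0 hR, sub_self, zero_mul]

variable {n : ℕ}

lemma Matrix.IsHermitian.inner_toEuclideanCLM {A : Matrix (Fin n) (Fin n) ℂ} (hA : A.IsHermitian)
    (v w : EuclideanSpace ℂ (Fin n)) :
    ⟪toEuclideanCLM (𝕜 := ℂ) A v, w⟫_ℂ = ⟪v, toEuclideanCLM (𝕜 := ℂ) A w⟫_ℂ := by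
  have h : ContinuousLinearMap.adjoint (toEuclideanCLM (𝕜 := ℂ) A) = toEuclideanCLM (𝕜 := ℂ) A := by
    rw [← ContinuousLinearMap.star_eq_adjoint, ← map_star, star_eq_conjTranspose, hA.eq]
  rw [← ContinuousLinearMap.adjoint_inner_right, h]

lemma Matrix.IsHermitian.isPotential {V : ℝ → Matrix (Fin n) (Fin n) ℂ}
    (hV : ∀ x, (V x).IsHermitian) (hVc : Continuous V)
    (hVi : Integrable fun x => ‖toEuclideanCLM (𝕜 := ℂ) (V x)‖) :
    IsPotential fun x => toEuclideanCLM (𝕜 := ℂ) (V x) :=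
  ⟨continuous_toEuclideanCLM.comp hVc, fun x => (hV x).inner_toEuclideanCLM, hVi⟩

lemma abs_re_inner_toEuclideanCLM_le (A : Matrix (Fin n) (Fin n) ℂ)
    (v : EuclideanSpace ℂ (Fin n)) :
    |(⟪v, toEuclideanCLM (𝕜 := ℂ) A v⟫_ℂ).re| ≤ ‖toEuclideanCLM (𝕜 := ℂ) A‖ * ‖v‖ ^ 2 := by
  refine (Complex.abs_re_le_norm _).trans ((norm_inner_le_norm _ _).trans ?_)
  calc _ ≤ ‖v‖ * (‖toEuclideanCLM (𝕜 := ℂ) A‖ * ‖v‖) := by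
        gcongr; exact ContinuousLinearMap.le_opNorm _ _
    _ = _ := by ring

/-- The potential `V`, lifted to a nonnegative one outside `[-2 R, 2 R]` and then cut off outside
`[-2 L, 2 L]`. -/
noncomputable def truncPot (V : ℝ → Matrix (Fin n) (Fin n) ℂ) (R L x : ℝ) :
    Matrix (Fin n) (Fin n) ℂ :=
  bump L x • (V x + ((1 - bump R x) * ‖toEuclideanCLM (𝕜 := ℂ) (V x)‖) • 1)

variable {V : ℝ → Matrix (Fin n) (Fin n) ℂ}

lemma inner_truncPot_re (R L x : ℝ) (v : EuclideanSpace ℂ (Fin n)) :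
    (⟪v, toEuclideanCLM (𝕜 := ℂ) (truncPot V R L x) v⟫_ℂ).re =
      bump L x * ((⟪v, toEuclideanCLM (𝕜 := ℂ) (V x) v⟫_ℂ).re +
        (1 - bump R x) * ‖toEuclideanCLM (𝕜 := ℂ) (V x)‖ * ‖v‖ ^ 2) := by
  have hs : ∀ (r : ℝ) (M : Matrix (Fin n) (Fin n) ℂ),
      toEuclideanCLM (𝕜 := ℂ) (r • M) = (r : ℂ) • toEuclideanCLM (𝕜 := ℂ) M := fun r M => by
    rw [← Complex.coe_smul, map_smul]
  have hv : (⟪v, v⟫_ℂ).re = ‖v‖ ^ 2 := inner_self_eq_norm_sq (𝕜 := ℂ) v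
  rw [truncPot, hs, map_add, hs, map_one]
  simp only [_root_.smul_apply, _root_.add_apply,
    one_apply_eq_self, inner_smul_right, inner_add_right, Complex.re_ofReal_mul,
    Complex.add_re, hv]

lemma rtr_truncPot (R L x : ℝ) :
    rtr (truncPot V R L x) = bump L x * (rtr (V x) +
      (1 - bump R x) * ‖toEuclideanCLM (𝕜 := ℂ) (V x)‖ * n) := by
  rw [truncPot, rtr_smul, rtr_add, rtr_smul, rtr_one, Fintype.card_fin]

lemma continuous_truncPot (hVc : Continuous V) (R L : ℝ) : Continuous (truncPot V R L) :=
  (continuous_bump L).smul (hVc.add (((continuous_const.sub (continuous_bump R)).mul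
    (continuous_toEuclideanCLM.comp hVc).norm).smul continuous_const))

lemma isHermitian_truncPot (hV : ∀ x, (V x).IsHermitian) (R L x : ℝ) :
    (truncPot V R L x).IsHermitian := by
  simp only [truncPot, IsHermitian, conjTranspose_smul, conjTranspose_add, star_trivial,
    (hV x).eq, conjTranspose_one]

lemma truncPot_eq_zero {R L x : ℝ} (hL : 0 < L) (hx : 2 * L ≤ |x|) : truncPot V R L x = 0 := by
  rw [truncPot, bump_eq_zero hL hx, zero_smul]

lemma isPotential_truncPot (hV : ∀ x, (V x).IsHermitian) (hVc : Continuous V) (R : ℝ) {L : ℝ}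
    (hL : 0 < L) : IsPotential fun x => toEuclideanCLM (𝕜 := ℂ) (truncPot V R L x) :=
  IsHermitian.isPotential (isHermitian_truncPot hV R L) (continuous_truncPot hVc R L)
    (integrable_of_eq_zero (continuous_toEuclideanCLM.comp (continuous_truncPot hVc R L))
      (R := 2 * L) fun x hx => by simp [truncPot_eq_zero hL hx]).norm

lemma le_inner_truncPot_re (R L x : ℝ) (v : EuclideanSpace ℂ (Fin n)) :
    -(bump R x * ‖toEuclideanCLM (𝕜 := ℂ) (V x)‖) * ‖v‖ ^ 2 ≤
      (⟪v, toEuclideanCLM (𝕜 := ℂ) (truncPot V R L x) v⟫_ℂ).re := by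
  rw [inner_truncPot_re]
  have h1 := neg_le_of_abs_le (abs_re_inner_toEuclideanCLM_le (V x) v)
  have h2 : -(bump R x * ‖toEuclideanCLM (𝕜 := ℂ) (V x)‖ * ‖v‖ ^ 2) ≤
      (⟪v, toEuclideanCLM (𝕜 := ℂ) (V x) v⟫_ℂ).re +
        (1 - bump R x) * ‖toEuclideanCLM (𝕜 := ℂ) (V x)‖ * ‖v‖ ^ 2 := by linarith
  have h3 : 0 ≤ bump R x * ‖toEuclideanCLM (𝕜 := ℂ) (V x)‖ * ‖v‖ ^ 2 :=
    mul_nonneg (mul_nonneg (bump_nonneg R x) (norm_nonneg _)) (sq_nonneg _)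
  nlinarith [mul_le_mul_of_nonneg_left h2 (bump_nonneg L x),
    mul_le_of_le_one_left h3 (bump_le_one L x)]

lemma inner_le_inner_truncPot_re_add {R L x : ℝ} (v : EuclideanSpace ℂ (Fin n)) :
    (⟪v, toEuclideanCLM (𝕜 := ℂ) (V x) v⟫_ℂ).re ≤
      (⟪v, toEuclideanCLM (𝕜 := ℂ) (truncPot V R L x) v⟫_ℂ).re +
        (1 - bump L x) * ‖toEuclideanCLM (𝕜 := ℂ) (V x)‖ * ‖v‖ ^ 2 := by
  rw [inner_truncPot_re]
  have h1 := le_of_abs_le (abs_re_inner_toEuclideanCLM_le (V x) v)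
  have h2 := mul_le_mul_of_nonneg_left h1 (sub_nonneg.2 (bump_le_one L x))
  have h3 : 0 ≤ bump L x * ((1 - bump R x) * ‖toEuclideanCLM (𝕜 := ℂ) (V x)‖ * ‖v‖ ^ 2) :=
    mul_nonneg (bump_nonneg L x) (mul_nonneg (mul_nonneg (sub_nonneg.2 (bump_le_one R x))
      (norm_nonneg _)) (sq_nonneg _))
  linarith

end MatrixPotential

section LowerBound

open Filter Topology Set
open scoped InnerProductSpace ComplexConjugate ENNReal

variable {n : ℕ} {V : ℝ → Matrix (Fin n) (Fin n) ℂ}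

lemma schrForm_le_schrForm_truncPot_add
    (hU : IsPotential fun x => toEuclideanCLM (𝕜 := ℂ) (V x)) {R L C : ℝ}
    (hW : IsPotential fun x => toEuclideanCLM (𝕜 := ℂ) (truncPot V R L x))
    (hC : ∀ x, bump R x * ‖toEuclideanCLM (𝕜 := ℂ) (V x)‖ ≤ C)
    {g : L2R (EuclideanSpace ℂ (Fin n))} (hg : (schrForm primL (potForm hW) g g).re ≤ 0) :
    (schrForm primL (potForm hU) g g).re ≤ (schrForm primL (potForm hW) g g).re +
      (1 + C) * (∫ x, (1 - bump L x) * ‖toEuclideanCLM (𝕜 := ℂ) (V x)‖) * ‖primL g‖ ^ 2 := by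
  have hWi : Integrable fun x =>
      (⟪prim g x, toEuclideanCLM (𝕜 := ℂ) (truncPot V R L x) (prim g x)⟫_ℂ).re :=
    (hW.integrable_inner g g).re
  have hUi : Integrable fun x => (⟪prim g x, toEuclideanCLM (𝕜 := ℂ) (V x) (prim g x)⟫_ℂ).re :=
    (hU.integrable_inner g g).re
  have hA : ‖primL g‖ ^ 2 = ∫ x, ‖prim g x‖ ^ 2 := by
    rw [Lp_norm_sq]
    refine integral_congr_ae ?_
    filter_upwards [primL_coeFn g] with x hx
    rw [hx]
  have hm := memLp_prim (Lp.memLp g)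
  have hnorm : ‖g‖ ^ 2 ≤ (1 + C) * ‖primL g‖ ^ 2 := by
    have h1 : -C * ‖primL g‖ ^ 2 ≤ (potForm hW g g).re := by
      rw [potForm_self_re, hA, ← integral_const_mul]
      refine integral_mono (hm.integrable_norm_sq.const_mul _) hWi fun x => ?_
      refine le_trans ?_ (le_inner_truncPot_re R L x (prim g x))
      exact mul_le_mul_of_nonneg_right (neg_le_neg (hC x)) (sq_nonneg _)
    rw [schrForm_self_re] at hg
    linarith
  set τ := ∫ x, (1 - bump L x) * ‖toEuclideanCLM (𝕜 := ℂ) (V x)‖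
  have hτ : 0 ≤ τ := integral_nonneg fun x =>
    mul_nonneg (sub_nonneg.2 (bump_le_one L x)) (norm_nonneg _)
  have hpot : (potForm hU g g).re ≤ (potForm hW g g).re + τ * ‖g‖ ^ 2 := by
    have hti := (integrable_one_sub_bump_mul hU.integrable L).mul_const (‖g‖ ^ 2)
    rw [potForm_self_re, potForm_self_re, ← integral_mul_const, ← integral_add hWi hti]
    refine integral_mono hUi (hWi.add hti) fun x => ?_
    refine (inner_le_inner_truncPot_re_add (R := R) (L := L) (prim g x)).trans ?_
    refine add_le_add le_rfl (mul_le_mul_of_nonneg_left ?_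
      (mul_nonneg (sub_nonneg.2 (bump_le_one L x)) (norm_nonneg _)))
    have := norm_prim_le g x
    gcongr
  rw [schrForm_self_re, schrForm_self_re]
  linarith [mul_le_mul_of_nonneg_left hnorm hτ]

lemma integral_rtr_truncPot_le (hVc : Continuous V) {a : ℝ → ℝ} (ha : Integrable a)
    (hVa : ∀ x, ‖toEuclideanCLM (𝕜 := ℂ) (V x)‖ ≤ a x) (htr : ∀ x, |rtr (V x)| ≤ a x) (R : ℝ)
    {L : ℝ} (hL : 0 < L) :
    ∫ x, rtr (truncPot V R L x) ≤ (∫ x, rtr (V x)) + (∫ x, (1 - bump L x) * a x) +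
      n * ∫ x, (1 - bump R x) * a x := by
  have hrc : ∀ {W : ℝ → Matrix (Fin n) (Fin n) ℂ}, Continuous W → Continuous fun x => rtr (W x) :=
    fun hW => Complex.continuous_re.comp hW.matrix_trace
  have hi : Integrable fun x => rtr (V x) := ha.mono' (hrc hVc).aestronglyMeasurable
    (ae_of_all _ htr)
  have hWi : Integrable fun x => rtr (truncPot V R L x) :=
    integrable_of_eq_zero (hrc (continuous_truncPot hVc R L)) (R := 2 * L) fun x hx => by
      rw [truncPot_eq_zero hL hx, rtr_zero]
  have h1 := integrable_one_sub_bump_mul ha L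
  have h2 := (integrable_one_sub_bump_mul ha R).const_mul (n : ℝ)
  rw [← integral_const_mul, ← integral_add hi h1, ← integral_add (hi.fun_add h1) h2]
  refine integral_mono hWi ((hi.fun_add h1).fun_add h2) fun x => ?_
  simp only [rtr_truncPot]
  have hL0 := sub_nonneg.2 (bump_le_one L x)
  have hR0 := sub_nonneg.2 (bump_le_one R x)
  have ha0 : 0 ≤ a x := (norm_nonneg _).trans (hVa x)
  have h3 : (1 - bump L x) * -rtr (V x) ≤ (1 - bump L x) * a x :=
    mul_le_mul_of_nonneg_left (neg_le.1 (neg_le_of_abs_le (htr x))) hL0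
  have h4 : bump L x * ((1 - bump R x) * ‖toEuclideanCLM (𝕜 := ℂ) (V x)‖ * n) ≤
      (1 - bump R x) * a x * n := by
    refine (mul_le_of_le_one_left (by positivity) (bump_le_one L x)).trans ?_
    have := hVa x
    gcongr
  linarith

lemma exists_eigenfamily_sum_sqrt_ge (hVc : Continuous V) (hV : ∀ x, (V x).IsHermitian)
    {a : ℝ → ℝ} (ha : Integrable a)
    (hVa : ∀ x, ‖toEuclideanCLM (𝕜 := ℂ) (V x)‖ ≤ a x) (htr : ∀ x, |rtr (V x)| ≤ a x)
    (hU : IsPotential fun x => toEuclideanCLM (𝕜 := ℂ) (V x)) {δ : ℝ} (hδ : 0 < δ) :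
    ∃ (N : ℕ) (g : Fin N → L2R (EuclideanSpace ℂ (Fin n))) (e : Fin N → ℝ),
      IsEigenfamily primL (potForm hU) g e ∧ -(1 / 4) * (∫ x, rtr (V x)) - δ ≤ ∑ j, √(e j) := by
  have hlim := tendsto_integral_one_sub_bump_mul ha
  obtain ⟨R, hR, hR0⟩ := (((hlim.const_mul (n : ℝ)).eventually_le_const
    (by simpa using hδ : (n : ℝ) * 0 < δ)).and (eventually_gt_atTop 0)).exists
  obtain ⟨C, hC⟩ : ∃ C, ∀ x, bump R x * ‖toEuclideanCLM (𝕜 := ℂ) (V x)‖ ≤ C := by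
    obtain ⟨C, hC⟩ := ((continuous_bump R).mul
      (continuous_toEuclideanCLM.comp hVc).norm).bounded_above_of_compact_support
      (hasCompactSupport_of_eq_zero (R := 2 * R) fun x hx => by
        simp [bump_eq_zero hR0 hx])
    exact ⟨C, fun x => (le_abs_self _).trans (hC x)⟩
  have hC0 : 0 ≤ C := (mul_nonneg (bump_nonneg R 0) (norm_nonneg _)).trans (hC 0)
  obtain ⟨N₀, hN₀⟩ := exists_card_eigenfamily_le (EuclideanSpace ℂ (Fin n)) hC0
    (by linarith : 0 < 2 * R)
  have hlim2 : Tendsto (fun L => N₀ *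
      √((1 + C) * ∫ x, (1 - bump L x) * ‖toEuclideanCLM (𝕜 := ℂ) (V x)‖)) atTop (𝓝 0) := by
    simpa using (((tendsto_integral_one_sub_bump_mul hU.integrable).const_mul
      (1 + C)).sqrt).const_mul (N₀ : ℝ)
  obtain ⟨L, ⟨hL1, hL2⟩, hL0⟩ := (((hlim.eventually_le_const hδ).and
    (hlim2.eventually_le_const (half_pos hδ))).and (eventually_gt_atTop 0)).exists
  have hW := isPotential_truncPot hV hVc R hL0
  have hNW := hN₀ hW
    (fun x v => (mul_le_mul_of_nonneg_right (neg_le_neg (hC x)) (sq_nonneg _)).trans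
      (le_inner_truncPot_re R L x v))
    (fun x v hx => by simpa [bump_eq_zero hR0 hx] using le_inner_truncPot_re (V := V) R L x v)
  obtain ⟨N, g, e, hg, hpos⟩ := hW.exists_maximal_eigenfamily hNW
  obtain ⟨f₁, hb, -⟩ := hg.exists_isBoundStates hW
  have hineq := hb.trace_inequality (continuous_truncPot hVc R L) (isHermitian_truncPot hV R L)
    (fun x hx => truncPot_eq_zero hL0 hx) hpos
  have hs : 0 ≤ (1 + C) * ∫ x, (1 - bump L x) * ‖toEuclideanCLM (𝕜 := ℂ) (V x)‖ :=
    mul_nonneg (by linarith) (integral_nonneg fun x =>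
      mul_nonneg (sub_nonneg.2 (bump_le_one L x)) (norm_nonneg _))
  have hcomp := fun c : Fin N → ℂ => schrForm_le_schrForm_truncPot_add hU hW hC
    (g := ∑ j, c j • g j) (by
      rw [hg.schrForm_sum]
      exact neg_nonpos.2 (Finset.sum_nonneg fun j _ => mul_nonneg (hg.pos j).le (sq_nonneg _)))
  obtain ⟨M, g', e', hg', he'⟩ := IsEigenfamily.exists_comparison
    (H := L2R (EuclideanSpace ℂ (Fin n))) (A := primL) norm_primL_le (v := potForm hU)
    hU.isCompactForm (w := potForm hW) hg hs hcomp
  refine ⟨M, g', e', hg', ?_⟩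
  have h1 := integral_rtr_truncPot_le hVc ha hVa htr R hL0
  have h2 : N * √((1 + C) * ∫ x, (1 - bump L x) * ‖toEuclideanCLM (𝕜 := ℂ) (V x)‖) ≤
      N₀ * √((1 + C) * ∫ x, (1 - bump L x) * ‖toEuclideanCLM (𝕜 := ℂ) (V x)‖) := by
    have : (N : ℝ) ≤ N₀ := by exact_mod_cast hNW N g e hg
    gcongr
  linarith

lemma trNeg_sub_trPos (A : Matrix (Fin n) (Fin n) ℂ) (hA : A.IsHermitian) :
    trNeg A hA - trPos A hA = -rtr A := by
  rw [trNeg, trPos, ← Finset.sum_sub_distrib, rtr, hA.trace_eq_sum_eigenvalues, Complex.re_sum,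
    ← Finset.sum_neg_distrib]
  refine Finset.sum_congr rfl fun i _ => ?_
  change _ = -hA.eigenvalues i
  rcases le_total (hA.eigenvalues i) 0 with h | h
  · rw [max_eq_left (by linarith), max_eq_right h, sub_zero]
  · rw [max_eq_right (by linarith), max_eq_left h, zero_sub]

lemma trPos_nonneg (A : Matrix (Fin n) (Fin n) ℂ) (hA : A.IsHermitian) : 0 ≤ trPos A hA :=
  Finset.sum_nonneg fun _ _ => le_max_right _ _

lemma trNeg_nonneg (A : Matrix (Fin n) (Fin n) ℂ) (hA : A.IsHermitian) : 0 ≤ trNeg A hA :=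
  Finset.sum_nonneg fun _ _ => le_max_right _ _

lemma norm_toEuclideanCLM_le (A : Matrix (Fin n) (Fin n) ℂ) (hA : A.IsHermitian) :
    ‖toEuclideanCLM (𝕜 := ℂ) A‖ ≤ trPos A hA + trNeg A hA := by
  have h1 : trPos A hA + trNeg A hA = ∑ i, |hA.eigenvalues i| := by
    rw [trPos, trNeg, ← Finset.sum_add_distrib]
    refine Finset.sum_congr rfl fun i _ => ?_
    rcases le_total (hA.eigenvalues i) 0 with h | h
    · rw [max_eq_right h, max_eq_left (by linarith), zero_add, abs_of_nonpos h]
    · rw [max_eq_left h, max_eq_right (by linarith), add_zero, abs_of_nonneg h]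
  rw [h1]
  refine ContinuousLinearMap.opNorm_le_bound _ (Finset.sum_nonneg fun _ _ => abs_nonneg _)
    fun v => ?_
  have h2 : ∀ i, toEuclideanCLM (𝕜 := ℂ) A (hA.eigenvectorBasis i) =
      (hA.eigenvalues i : ℂ) • hA.eigenvectorBasis i := fun i => by
    ext j
    have := congrFun (hA.mulVec_eigenvectorBasis i) j
    simpa using this
  conv_lhs => rw [← hA.eigenvectorBasis.sum_repr' v]
  rw [map_sum, Finset.sum_mul]
  refine norm_sum_le_of_le _ fun i _ => ?_
  rw [map_smul, h2, norm_smul, norm_smul, hA.eigenvectorBasis.norm_eq_one, mul_one,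
    Complex.norm_real, Real.norm_eq_abs, mul_comm]
  gcongr
  refine (norm_inner_le_norm _ _).trans_eq ?_
  rw [hA.eigenvectorBasis.norm_eq_one, one_mul]

end LowerBound

/-- **Lower bound `L^cl_{1/2,1} ∫ (tr V₋ - tr V₊) dx ≤ ∑ E_l^{1/2}`:** for every `δ > 0`
there is a finite orthonormal family of eigenfunctions of `-d²/dx² ⊗ 1 + V` with negative
eigenvalues `-E_j` such that `∑ √E_j ≥ (1/4) ∫ (tr V₋ - tr V₊) dx - δ`. -/
theorem lieb_thirring_lower_bound_half (n : ℕ) (hn : 1 ≤ n)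
    (V : ℝ → Matrix (Fin n) (Fin n) ℂ)
    (hVcont : Continuous V)
    (hV : ∀ x, (V x).IsHermitian)
    (hVintPos : Integrable fun x => trPos (V x) (hV x))
    (hVintNeg : Integrable fun x => trNeg (V x) (hV x)) :
    ∀ δ : ℝ, 0 < δ →
      ∃ (N : ℕ) (ψ : Fin N → ℝ → Fin n → ℂ) (E : Fin N → ℝ),
        (∀ j, 0 < E j) ∧
        (∀ j i, ContDiff ℝ 2 fun x => ψ j x i) ∧
        (∀ j, Integrable fun x => ∑ i, Complex.normSq (ψ j x i)) ∧
        (∀ j l, (∫ x : ℝ, ∑ i, (starRingEnd ℂ) (ψ j x i) * ψ l x i)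
          = if j = l then 1 else 0) ∧
        (∀ j x i,
          -(deriv (fun y => deriv (fun z => ψ j z i) y) x) + (V x *ᵥ ψ j x) i
            = -(E j : ℂ) * ψ j x i) ∧
        (1 / 4) * (∫ x : ℝ, (trNeg (V x) (hV x) - trPos (V x) (hV x))) - δ ≤
          ∑ j, Real.sqrt (E j) := by
  intro δ hδ
  have ha := hVintPos.add hVintNeg
  have hle : ∀ x, ‖toEuclideanCLM (𝕜 := ℂ) (V x)‖ ≤ trPos (V x) (hV x) + trNeg (V x) (hV x) :=
    fun x => norm_toEuclideanCLM_le _ _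
  have hU := IsHermitian.isPotential hV hVcont <|
    ha.mono' (continuous_toEuclideanCLM.comp hVcont).norm.aestronglyMeasurable
      (ae_of_all _ fun x => by simpa using hle x)
  obtain ⟨N, g, e, hg, hsum⟩ := exists_eigenfamily_sum_sqrt_ge hVcont hV ha hle (fun x => by
    have h1 := trNeg_sub_trPos (V x) (hV x)
    have h2 := trPos_nonneg (V x) (hV x)
    have h3 := trNeg_nonneg (V x) (hV x)
    rw [Pi.add_apply, abs_le]
    constructor <;> linarith) hU hδ
  obtain ⟨f₁, hb, -⟩ := hg.exists_isBoundStates hU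
  set f := fun j => prim (g j)
  have hc : ∀ {u u' : ℝ → EuclideanSpace ℂ (Fin n)} {x : ℝ}, HasDerivAt u (u' x) x →
      ∀ i, HasDerivAt (fun y => u y i) (u' x i) x := fun h i =>
    ((EuclideanSpace.proj (𝕜 := ℂ) i).restrictScalars ℝ).hasFDerivAt.comp_hasDerivAt _ h
  have h1 : ∀ j i x, HasDerivAt (fun y => f j y i) (f₁ j x i) x := fun j i x =>
    hc ((hb.isH1 j).hasDerivAt x) i
  have h2 : ∀ j i x, HasDerivAt (fun y => f₁ j y i)
      ((V x *ᵥ f j x) i + (e j : ℂ) * f j x i) x := fun j i x =>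
    hc (u' := fun x => toEuclideanCLM (𝕜 := ℂ) (V x) (f j x) + (e j : ℂ) • f j x)
      (hb.deriv₁ j x) i
  have hd1 : ∀ j i, deriv (fun y => f j y i) = fun x => f₁ j x i := fun j i =>
    funext fun x => (h1 j i x).deriv
  have hd2 : ∀ j i, deriv (fun y => f₁ j y i) = fun x => (V x *ᵥ f j x) i + (e j : ℂ) * f j x i :=
    fun j i => funext fun x => (h2 j i x).deriv
  refine ⟨N, fun j x i => f j x i, e, hb.pos, fun j i => ?_, fun j => ?_, fun j l => ?_,
    fun j x i => ?_, ?_⟩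
  · have hfc : ∀ i, Continuous fun x => f j x i := fun i =>
      continuous_iff_continuousAt.2 fun x => (h1 j i x).continuousAt
    rw [show (2 : WithTop ℕ∞) = 1 + 1 by norm_num, contDiff_succ_iff_deriv]
    refine ⟨fun x => (h1 j i x).differentiableAt, by simp, ?_⟩
    rw [hd1, contDiff_one_iff_deriv]
    refine ⟨fun x => (h2 j i x).differentiableAt, ?_⟩
    rw [hd2]
    exact ((continuous_apply i).comp (hVcont.matrix_mulVec (continuous_pi hfc))).add
      (continuous_const.mul (hfc i))
  · refine (hb.isH1 j).memLp.integrable_norm_sq.congr (ae_of_all _ fun x => ?_)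
    simp only [EuclideanSpace.norm_sq_eq, Complex.normSq_eq_norm_sq]
  · rw [← hb.orthonormal j l]
    refine integral_congr_ae (ae_of_all _ fun x => ?_)
    simp only [PiLp.inner_apply, RCLike.inner_apply, mul_comm]
  · simp only [hd1, hd2]
    have : (V x *ᵥ fun i => f j x i) i = (V x *ᵥ f j x) i := rfl
    rw [this]
    ring
  · have : ∫ x, (trNeg (V x) (hV x) - trPos (V x) (hV x)) = -∫ x, rtr (V x) := by
      rw [← integral_neg]
      exact integral_congr_ae (ae_of_all _ fun x => trNeg_sub_trPos _ _)
    rw [this]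
    linarith
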